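/- (Theorem 1.2.) Fix α ∈ [0,T), an integer N ≥ 0, and a sector S with the ordering property. Assume p_m ∈ W_{N+m−n+2}[α,T] for m = 0,…,n−2. Then for ρ ∈ S̄ with |ρ| ≥ ρ_α and x ∈ [0,T] there exists a fundamental system of solutions {y_k(x,ρ)}_{k=1,…,n} of the equation y^{(n)} + Σ_{m=0}^{n−2} p_m(x) y^{(m)} = ρ^n y such that: (1) the functions y_k^{(ν)}(x,ρ), ν = 0,…,n−1, are continuous in (x,ρ) for x ∈ [0,T], ρ ∈ S̄, |ρ| ≥ ρ_α; (2) for each x ∈ [0,T] they are analytic in ρ on {ρ ∈ S : |ρ| > ρ_α}; (3) as |ρ| → ∞, ρ ∈ S̄, uniformly in x ∈ [α,T], y_k^{(ν)}(x,ρ) = (ρR_k)^ν exp(ρR_k x)(1 + Σ_{s=1}^{N+1} β_{sν}(x)/(ρR_k)^s + o(1/ρ^{N+1})) for ν = 0,…,n−1, where β_{sν}(x) = Σ_{r=0}^{ν} C(ν,r) β_{s−r}^{(r)}(x), and the functions β_s are determined by β_0(x) ≡ 1, β_s(x) ≡ 0 for s < 0, β_s(α) = 0 for s ≥ 1, together with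 the recurrence β_s'(x) = −(1/n)(Σ_{r=2}^{n} C(n,r) β_{s+1−r}^{(r)}(x) + Σ_{m=0}^{n−2} p_m(x) β_{s−n+m+1,m}(x)) for s ≥ 1; moreover β_s ∈ W_{N−s+2}[α,T]. -/

import Mathlib

open MeasureTheory Set Finset

/-- `ρ_α := max_{0≤m≤n−2} (2∫_α^T |p_m(t)| dt)^{1/(n−1−m)}`. -/
noncomputable def rhoAlpha (n : ℕ) (T α : ℝ) (p : Fin (n - 1) → ℝ → ℂ) : ℝ :=
  ⨆ m : Fin (n - 1), (2 * ∫ t in α..T, ‖p m t‖) ^ (((n : ℝ) - 1 - (m : ℕ))⁻¹)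

/-- `d : ℕ → ℝ → ℂ` is the derivative tower of a solution `y = d 0` of equation (1.1),
`y^{(n)} + Σ_{m=0}^{n−2} p_m(x) y^{(m)} = ρ^n y`, on `[0,T]`: `d ν` has derivative
`d (ν+1)` on `[0,T]` for `ν < n−1`, `d (n−1)` is absolutely continuous with integrable
a.e. derivative `d n`, and the equation holds a.e. on `[0,T]`. -/
def IsSolutionODE (n : ℕ) (T : ℝ) (p : Fin (n - 1) → ℝ → ℂ) (ρ : ℂ)
    (d : ℕ → ℝ → ℂ) : Prop :=
  (∀ ν < n - 1, ∀ x ∈ Set.Icc (0 : ℝ) T,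
      HasDerivWithinAt (d ν) (d (ν + 1) x) (Set.Icc (0 : ℝ) T) x) ∧
  IntervalIntegrable (d n) volume 0 T ∧
  (∀ x ∈ Set.Icc (0 : ℝ) T, d (n - 1) x = d (n - 1) 0 + ∫ t in (0 : ℝ)..x, d n t) ∧
  (∀ᵐ x ∂(volume.restrict (Set.Icc (0 : ℝ) T)),
      d n x + ∑ m : Fin (n - 1), p m x * d (m : ℕ) x = ρ ^ n * d 0 x)


/-- `f ∈ W_M[a,b]`: for `M ≥ 1`, the derivatives `f, f', …, f^{(M−1)}` are absolutely
continuous (encoded through a tower `g ν = f^{(ν)}` with integral representation) and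
`f^{(ν)} ∈ L¹(a,b)` for `ν = 0,…,M`; for `M = 0` (and hence for the truncated value of
any nonpositive index) this is just integrability. -/
def MemW (M : ℕ) (f : ℝ → ℂ) (a b : ℝ) : Prop :=
  ∃ g : ℕ → ℝ → ℂ, g 0 = f ∧
    (∀ ν ≤ M, IntervalIntegrable (g ν) volume a b) ∧
    (∀ ν < M, ∀ x ∈ Set.Icc a b, g ν x = g ν a + ∫ t in a..x, g (ν + 1) t)

/-- Given a tower `B s r = β_s^{(r)}` (with the convention `β_{s} = 0` for `s < 0`,
implemented by the guard `r ≤ s`), this is `β_{sν}(x) = Σ_{r=0}^{ν} C(ν,r) β_{s−r}^{(r)}(x)`. -/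
noncomputable def betaNu (B : ℕ → ℕ → ℝ → ℂ) (s ν : ℕ) (x : ℝ) : ℂ :=
  ∑ r ∈ Finset.range (ν + 1), if r ≤ s then (ν.choose r : ℂ) * B (s - r) r x else 0

/-- `f` is absolutely continuous on `[a, b]` with integrable almost everywhere derivative `f'`. -/
structure HasIntegralDeriv (f f' : ℝ → ℂ) (a b : ℝ) : Prop where
  integrable : IntervalIntegrable f' volume a b
  eq : ∀ x ∈ Set.Icc a b, f x = f a + ∫ t in a..x, f' t

namespace HasIntegralDeriv

variable {f g f' g' : ℝ → ℂ} {a b : ℝ}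

theorem integrable_sub (hf : HasIntegralDeriv f f' a b) {x y : ℝ} (hx : x ∈ Set.Icc a b)
    (hy : y ∈ Set.Icc a b) : IntervalIntegrable f' volume x y :=
  hf.integrable.mono_set (by
    rw [uIcc_of_le (hx.1.trans hx.2)]
    exact uIcc_subset_Icc hx hy)

theorem sub_eq (hf : HasIntegralDeriv f f' a b) {x y : ℝ} (hx : x ∈ Set.Icc a b)
    (hy : y ∈ Set.Icc a b) : f y - f x = ∫ t in x..y, f' t := by
  have ha : a ∈ Set.Icc a b := left_mem_Icc.2 (hx.1.trans hx.2)
  rw [hf.eq x hx, hf.eq y hy, ← intervalIntegral.integral_interval_sub_left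
    (hf.integrable_sub ha hy) (hf.integrable_sub ha hx)]
  ring

theorem mono (hf : HasIntegralDeriv f f' a b) {c d : ℝ} (hc : a ≤ c) (hd : d ≤ b) (hcd : c ≤ d) :
    HasIntegralDeriv f f' c d := by
  have hc' : c ∈ Set.Icc a b := ⟨hc, hcd.trans hd⟩
  refine ⟨hf.integrable_sub hc' ⟨hc.trans hcd, hd⟩, fun x hx => ?_⟩
  rw [← hf.sub_eq hc' ⟨hc.trans hx.1, hx.2.trans hd⟩]
  ring

theorem continuousOn (hf : HasIntegralDeriv f f' a b) (hab : a ≤ b) :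
    ContinuousOn f (Set.Icc a b) := by
  have h := intervalIntegral.continuousOn_primitive_interval' hf.integrable left_mem_uIcc
  rw [uIcc_of_le hab] at h
  exact (continuousOn_const.add h).congr hf.eq

theorem congr (hf : HasIntegralDeriv f f' a b) (hab : a ≤ b) (hfg : ∀ x ∈ Set.Icc a b, g x = f x)
    (hfg' : ∀ᵐ x ∂volume.restrict (Set.Icc a b), g' x = f' x) : HasIntegralDeriv g g' a b := by
  have hi : ∀ x ∈ Set.Icc a b, f' =ᵐ[volume.restrict (Set.uIoc a x)] g' := by
    intro x hx
    rw [uIoc_of_le hx.1]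
    exact ae_restrict_of_ae_restrict_of_subset
      (Ioc_subset_Icc_self.trans (Icc_subset_Icc_right hx.2)) (hfg'.mono fun _ h => h.symm)
  refine ⟨hf.integrable.congr_ae (hi b (right_mem_Icc.2 hab)), fun x hx => ?_⟩
  rw [hfg x hx, hfg a (left_mem_Icc.2 hab), hf.eq x hx,
    intervalIntegral.integral_congr_ae_restrict (hi x hx)]

theorem const (c : ℂ) (a b : ℝ) : HasIntegralDeriv (fun _ => c) (fun _ => 0) a b :=
  ⟨intervalIntegrable_const, by simp⟩

theorem add (hf : HasIntegralDeriv f f' a b) (hg : HasIntegralDeriv g g' a b) :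
    HasIntegralDeriv (fun x => f x + g x) (fun x => f' x + g' x) a b := by
  refine ⟨hf.integrable.add hg.integrable, fun x hx => ?_⟩
  have ha : a ∈ Set.Icc a b := left_mem_Icc.2 (hx.1.trans hx.2)
  rw [intervalIntegral.integral_add (hf.integrable_sub ha hx) (hg.integrable_sub ha hx),
    hf.eq x hx, hg.eq x hx]
  ring

theorem const_mul (c : ℂ) (hf : HasIntegralDeriv f f' a b) :
    HasIntegralDeriv (fun x => c * f x) (fun x => c * f' x) a b := by
  refine ⟨hf.integrable.const_mul c, fun x hx => ?_⟩
  rw [intervalIntegral.integral_const_mul, hf.eq x hx]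
  ring

theorem sub (hf : HasIntegralDeriv f f' a b) (hg : HasIntegralDeriv g g' a b) :
    HasIntegralDeriv (fun x => f x - g x) (fun x => f' x - g' x) a b := by
  simpa [sub_eq_add_neg] using hf.add (hg.const_mul (-1))

theorem sum {ι : Type*} (s : Finset ι) {F F' : ι → ℝ → ℂ}
    (h : ∀ i ∈ s, HasIntegralDeriv (F i) (F' i) a b) :
    HasIntegralDeriv (fun x => ∑ i ∈ s, F i x) (fun x => ∑ i ∈ s, F' i x) a b := by
  classical
  induction s using Finset.induction_on with
  | empty => simpa using const 0 a b
  | insert i s hi ih =>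
    simp only [Finset.sum_insert hi]
    exact (h i (Finset.mem_insert_self i s)).add
      (ih fun j hj => h j (Finset.mem_insert_of_mem hj))

theorem _root_.AbsolutelyContinuousOnInterval.congr_on {u v : ℝ → ℂ}
    (hu : AbsolutelyContinuousOnInterval u a b) (huv : ∀ x ∈ uIcc a b, v x = u x) :
    AbsolutelyContinuousOnInterval v a b := by
  rw [absolutelyContinuousOnInterval_iff] at hu ⊢
  intro ε hε
  obtain ⟨δ, hδ, h⟩ := hu ε hε
  refine ⟨δ, hδ, fun E hE hlt => ?_⟩
  refine lt_of_le_of_lt (le_of_eq (Finset.sum_congr rfl fun i hi => ?_)) (h E hE hlt)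
  rw [huv _ (hE.left i hi).left, huv _ (hE.left i hi).right]

theorem _root_.IntervalIntegrable.absolutelyContinuousOnInterval_add_integral
    (hf : IntervalIntegrable f' volume a b) (c : ℂ) :
    AbsolutelyContinuousOnInterval (fun x => c + ∫ t in a..x, f' t) a b := by
  have hre : IntervalIntegrable (fun t => (f' t).re) volume a b := ⟨hf.1.re, hf.2.re⟩
  have him : IntervalIntegrable (fun t => (f' t).im) volume a b := ⟨hf.1.im, hf.2.im⟩
  have hconst : ∀ c : ℂ, AbsolutelyContinuousOnInterval (fun _ : ℝ => c) a b := fun c =>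
    ((LipschitzWith.const c).lipschitzOnWith).absolutelyContinuousOnInterval
  have h1 := (hre.absolutelyContinuousOnInterval_intervalIntegral left_mem_uIcc).smul (hconst 1)
  have h2 := (him.absolutelyContinuousOnInterval_intervalIntegral left_mem_uIcc).smul
    (hconst Complex.I)
  refine ((hconst c).add (h1.add h2)).congr_on fun x hx => ?_
  have hi : IntervalIntegrable f' volume a x := hf.mono_set (uIcc_subset_uIcc_left hx)
  have e1 : (∫ t in a..x, (f' t).re) = (∫ t in a..x, f' t).re :=
    intervalIntegral.intervalIntegral_re hi
  have e2 : (∫ t in a..x, (f' t).im) = (∫ t in a..x, f' t).im :=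
    intervalIntegral.intervalIntegral_im hi
  simp [e1, e2]

theorem mul (hab : a ≤ b) (hf : HasIntegralDeriv f f' a b) (hg : HasIntegralDeriv g g' a b) :
    HasIntegralDeriv (fun x => f x * g x) (fun x => f' x * g x + f x * g' x) a b := by
  have hfc := hf.continuousOn hab
  have hgc := hg.continuousOn hab
  rw [← uIcc_of_le hab] at hfc hgc
  have hfg_int : IntervalIntegrable (fun x => f' x * g x + f x * g' x) volume a b :=
    (hf.integrable.mul_continuousOn hgc).add (hg.integrable.continuousOn_mul hfc)
  refine ⟨hfg_int, ?_⟩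
  set F : ℝ → ℂ := fun x => f a + ∫ t in a..x, f' t with hF
  set G : ℝ → ℂ := fun x => g a + ∫ t in a..x, g' t with hG
  have hD : AbsolutelyContinuousOnInterval (fun x => F x * G x -
      (0 + ∫ t in a..x, f' t * g t + f t * g' t)) a b :=
    ((hf.integrable.absolutelyContinuousOnInterval_add_integral _).fun_smul
      (hg.integrable.absolutelyContinuousOnInterval_add_integral _)).sub
      (hfg_int.absolutelyContinuousOnInterval_add_integral _)
  obtain ⟨C, hC⟩ := hD.const_of_ae_hasDerivAt_zero (by
    filter_upwards [hf.integrable.ae_hasDerivAt_integral, hg.integrable.ae_hasDerivAt_integral,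
      hfg_int.ae_hasDerivAt_integral] with x h1 h2 h3 hx
    have hx' : x ∈ Set.Icc a b := by rwa [uIcc_of_le hab] at hx
    have e1 := ((h1 hx a left_mem_uIcc).const_add (f a))
    have e2 := ((h2 hx a left_mem_uIcc).const_add (g a))
    have e3 := ((h3 hx a left_mem_uIcc).const_add 0)
    have := (e1.mul e2).sub e3
    rw [← hf.eq x hx', ← hg.eq x hx', sub_self] at this
    exact this)
  intro x hx
  have h1 := hC x (by rwa [uIcc_of_le hab])
  have h2 := hC a left_mem_uIcc
  simp only [hF, hG, ← hf.eq x hx, ← hg.eq x hx] at h1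
  simp only [hF, hG, intervalIntegral.integral_same, add_zero, sub_zero, zero_add] at h1 h2
  rw [h2, ← h1]
  ring

theorem of_hasDerivAt (hd : ∀ x, HasDerivAt f (f' x) x) (hc : Continuous f') (a b : ℝ) :
    HasIntegralDeriv f f' a b := by
  refine ⟨hc.intervalIntegrable a b, fun x _ => ?_⟩
  rw [intervalIntegral.integral_eq_sub_of_hasDerivAt (fun x _ => hd x) (hc.intervalIntegrable a x)]
  ring

theorem cexp (c : ℂ) (a b : ℝ) :
    HasIntegralDeriv (fun x => Complex.exp (c * x)) (fun x => c * Complex.exp (c * x)) a b := by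
  refine of_hasDerivAt (fun x => ?_) (by fun_prop) a b
  have := ((Complex.ofRealCLM.hasDerivAt (x := x)).const_mul c).cexp
  simpa [mul_comm] using this

end HasIntegralDeriv

theorem HasIntegralDeriv.pow {f f' : ℝ → ℂ} {a b : ℝ} (hab : a ≤ b)
    (hf : HasIntegralDeriv f f' a b) (k : ℕ) :
    HasIntegralDeriv (fun x => f x ^ (k + 1)) (fun x => (k + 1) * (f' x * f x ^ k)) a b := by
  induction k with
  | zero => simpa using hf
  | succ k ih =>
    refine (ih.mul hab hf).congr hab (fun x _ => pow_succ _ _) (.of_forall fun x => ?_)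
    push_cast
    ring

theorem integral_mul_pow_primitive {a : ℝ → ℝ} {T : ℝ} (hT : 0 ≤ T)
    (ha : IntervalIntegrable a volume 0 T) (k : ℕ) {x : ℝ} (hx : x ∈ Set.Icc 0 T) :
    ∫ t in (0 : ℝ)..x, a t * (∫ s in (0 : ℝ)..t, a s) ^ k =
      (∫ s in (0 : ℝ)..x, a s) ^ (k + 1) / (k + 1) := by
  have h : HasIntegralDeriv (fun x => ((∫ s in (0 : ℝ)..x, a s : ℝ) : ℂ)) (fun t => (a t : ℂ)) 0 T :=
    ⟨⟨ha.1.ofReal, ha.2.ofReal⟩, fun x _ => by simp [intervalIntegral.integral_ofReal]⟩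
  have := (h.pow hT k).eq x hx
  simp only [intervalIntegral.integral_same, Complex.ofReal_zero, zero_pow (Nat.succ_ne_zero k),
    zero_add, intervalIntegral.integral_const_mul] at this
  rw [eq_div_iff (by positivity)]
  have h2 : (((∫ t in (0 : ℝ)..x, a t * (∫ s in (0 : ℝ)..t, a s) ^ k) : ℝ) : ℂ) =
      ∫ t in (0 : ℝ)..x, (a t : ℂ) * ((∫ s in (0 : ℝ)..t, a s : ℝ) : ℂ) ^ k := by
    rw [← intervalIntegral.integral_ofReal]
    simp
  rw [← h2] at this
  apply Complex.ofReal_injective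
  push_cast
  rw [mul_comm, ← this]

section Volterra

variable {ι : Type*} [Fintype ι] {T : ℝ}

theorem intervalIntegrable_mulVec {A : ℝ → Matrix ι ι ℂ} {a b : ℝ}
    (hA : ∀ i j, IntervalIntegrable (fun t => A t i j) volume a b) {y : ℝ → ι → ℂ}
    (hy : ∀ j, ContinuousOn (fun t => y t j) (uIcc a b)) (i : ι) :
    IntervalIntegrable (fun t => (A t).mulVec (y t) i) volume a b := by
  simp only [Matrix.mulVec, dotProduct]
  have := IntervalIntegrable.sum (μ := volume) (a := a) (b := b) Finset.univ
    (f := fun j t => A t i j * y t j) fun j _ => (hA i j).mul_continuousOn (hy j)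
  simpa only [Finset.sum_fn] using this

/-- The sum of the moduli of all entries. -/
noncomputable def entrySum (A : Matrix ι ι ℂ) : ℝ := ∑ i, ∑ j, ‖A i j‖

theorem entrySum_nonneg (A : Matrix ι ι ℂ) : 0 ≤ entrySum A := by
  unfold entrySum; positivity

theorem norm_mulVec_le_entrySum (A : Matrix ι ι ℂ) (v : ι → ℂ) (i : ι) :
    ‖A.mulVec v i‖ ≤ entrySum A * ‖v‖ := by
  calc ‖A.mulVec v i‖ ≤ ∑ j, ‖A i j * v j‖ := norm_sum_le _ _
    _ ≤ ∑ j, ‖A i j‖ * ‖v‖ := by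
        gcongr with j
        rw [norm_mul]
        gcongr
        exact norm_le_pi_norm v j
    _ = (∑ j, ‖A i j‖) * ‖v‖ := by rw [Finset.sum_mul]
    _ ≤ entrySum A * ‖v‖ := by
        gcongr
        exact Finset.single_le_sum (f := fun i => ∑ j, ‖A i j‖)
          (fun i _ => by positivity) (Finset.mem_univ i)

theorem intervalIntegrable_entrySum {A : ℝ → Matrix ι ι ℂ} {a b : ℝ}
    (hA : ∀ i j, IntervalIntegrable (fun t => A t i j) volume a b) :
    IntervalIntegrable (fun t => entrySum (A t)) volume a b := by
  have := IntervalIntegrable.sum (μ := volume) (a := a) (b := b) Finset.univ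
    (f := fun i t => ∑ j, ‖A t i j‖) fun i _ => by
      have := IntervalIntegrable.sum (μ := volume) (a := a) (b := b) Finset.univ
        (f := fun j t => ‖A t i j‖) fun j _ => (hA i j).norm
      simpa only [Finset.sum_fn] using this
  simp only [Finset.sum_fn] at this
  exact this

variable (hT : 0 ≤ T) {A : ℝ → Matrix ι ι ℂ}
  (hA : ∀ i j, IntervalIntegrable (fun t => A t i j) volume 0 T)

omit [Fintype ι] in
theorem continuous_projIcc_apply (y : C(Set.Icc 0 T, ι → ℂ)) (j : ι) :
    Continuous fun t => y (projIcc 0 T hT t) j :=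
  (continuous_apply j).comp (y.continuous.comp continuous_projIcc)

include hA in
theorem norm_volterra_le (y : C(Set.Icc 0 T, ι → ℂ)) {φ : ℝ → ℝ} (hφc : ContinuousOn φ (Set.Icc 0 T))
    (hφ : ∀ t ∈ Set.Icc 0 T, ‖y (projIcc 0 T hT t)‖ ≤ φ t) {x : ℝ} (hx : x ∈ Set.Icc 0 T) (i : ι) :
    ‖∫ t in (0 : ℝ)..x, (A t).mulVec (y (projIcc 0 T hT t)) i‖ ≤
      ∫ t in (0 : ℝ)..x, entrySum (A t) * φ t := by
  have hsub : uIcc 0 x ⊆ uIcc 0 T := by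
    rw [uIcc_of_le hx.1, uIcc_of_le hT]
    exact Icc_subset_Icc_right hx.2
  refine intervalIntegral.norm_integral_le_of_norm_le hx.1 (.of_forall fun t ht => ?_) ?_
  · refine (norm_mulVec_le_entrySum _ _ _).trans ?_
    gcongr
    · exact entrySum_nonneg _
    · exact hφ t ⟨ht.1.le, ht.2.trans hx.2⟩
  · refine ((intervalIntegrable_entrySum hA).mono_set hsub).mul_continuousOn (hφc.mono ?_)
    rw [← uIcc_of_le hT]
    exact hsub

/-- The Volterra operator `y ↦ ∫₀ˣ A(t) y(t) dt` on continuous vector functions. -/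
noncomputable def volterra : C(Set.Icc 0 T, ι → ℂ) →L[ℂ] C(Set.Icc 0 T, ι → ℂ) :=
  LinearMap.mkContinuous
    { toFun := fun y =>
        { toFun := fun x i => ∫ t in (0 : ℝ)..x, (A t).mulVec (y (projIcc 0 T hT t)) i
          continuous_toFun := by
            refine continuous_pi fun i => ?_
            have h := intervalIntegral.continuousOn_primitive_interval'
              (intervalIntegrable_mulVec hA
                (fun j => (continuous_projIcc_apply hT y j).continuousOn) i) left_mem_uIcc
            rw [uIcc_of_le hT] at h
            exact continuousOn_iff_continuous_domRestrict.1 h }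
      map_add' := fun y z => by
        ext x i
        have hsub : uIcc (0 : ℝ) x ⊆ uIcc 0 T := by
          rw [uIcc_of_le x.2.1, uIcc_of_le hT]
          exact Icc_subset_Icc_right x.2.2
        have h := fun y : C(Set.Icc 0 T, ι → ℂ) => (intervalIntegrable_mulVec hA
          (fun j => (continuous_projIcc_apply hT y j).continuousOn) i).mono_set hsub
        simp only [ContinuousMap.coe_mk, ContinuousMap.add_apply, Matrix.mulVec_add, Pi.add_apply]
        exact intervalIntegral.integral_add (h y) (h z)
      map_smul' := fun c y => by
        ext x i
        simp only [ContinuousMap.coe_mk, ContinuousMap.smul_apply, Matrix.mulVec_smul,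
          Pi.smul_apply, RingHom.id_apply, intervalIntegral.integral_smul] }
    (∫ t in (0 : ℝ)..T, entrySum (A t)) (fun y => by
      have hnn : ∀ x ∈ Set.Icc 0 T, 0 ≤ ∫ t in (0 : ℝ)..x, entrySum (A t) := fun x hx =>
        intervalIntegral.integral_nonneg hx.1 fun t _ => entrySum_nonneg _
      rw [ContinuousMap.norm_le _ (mul_nonneg (hnn T ⟨hT, le_rfl⟩) (norm_nonneg _))]
      intro x
      refine (pi_norm_le_iff_of_nonneg (mul_nonneg (hnn T ⟨hT, le_rfl⟩) (norm_nonneg _))).2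
        fun i => ?_
      refine (norm_volterra_le hT hA y (φ := fun _ => ‖y‖) continuousOn_const
        (fun t _ => y.norm_coe_le_norm _) x.2 i).trans ?_
      rw [intervalIntegral.integral_mul_const]
      gcongr
      refine intervalIntegral.integral_mono_interval le_rfl x.2.1 x.2.2
        (.of_forall fun t => entrySum_nonneg _) (intervalIntegrable_entrySum hA))

theorem volterra_apply (y : C(Set.Icc 0 T, ι → ℂ)) (x : Set.Icc 0 T) (i : ι) :
    volterra hT hA y x i = ∫ t in (0 : ℝ)..x, (A t).mulVec (y (projIcc 0 T hT t)) i := rfl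

theorem norm_volterra_pow_apply_le (k : ℕ) (y : C(Set.Icc 0 T, ι → ℂ)) (x : Set.Icc 0 T) :
    ‖((volterra hT hA) ^ k) y x‖ ≤
      (∫ t in (0 : ℝ)..x, entrySum (A t)) ^ k / k.factorial * ‖y‖ := by
  induction k generalizing x with
  | zero => simpa using y.norm_coe_le_norm x
  | succ k ih =>
    have hnn : ∀ x ∈ Set.Icc 0 T, 0 ≤ ∫ t in (0 : ℝ)..x, entrySum (A t) := fun x hx =>
      intervalIntegral.integral_nonneg hx.1 fun t _ => entrySum_nonneg _
    have hx := hnn x x.2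
    rw [pow_succ', mul_apply_eq_comp]
    refine (pi_norm_le_iff_of_nonneg (by positivity)).2 fun i => ?_
    have hc : ContinuousOn (fun x => ∫ t in (0 : ℝ)..x, entrySum (A t)) (Set.Icc 0 T) := by
      rw [← uIcc_of_le hT]
      exact intervalIntegral.continuousOn_primitive_interval' (intervalIntegrable_entrySum hA)
        left_mem_uIcc
    refine (norm_volterra_le hT hA _
      (φ := fun t => (∫ s in (0 : ℝ)..t, entrySum (A s)) ^ k / k.factorial * ‖y‖)
      (by fun_prop) (fun t ht => ?_) x.2 i).trans (le_of_eq ?_)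
    · have := ih (projIcc 0 T hT t)
      rwa [projIcc_of_mem hT ht] at this ⊢
    · have h := integral_mul_pow_primitive hT (intervalIntegrable_entrySum hA) k x.2
      calc _ = ∫ t in (0 : ℝ)..x, (entrySum (A t) * (∫ s in (0 : ℝ)..t, entrySum (A s)) ^ k) *
              (‖y‖ / k.factorial) := by
            congr 1; ext t; ring
        _ = _ := by
            rw [intervalIntegral.integral_mul_const, h, Nat.factorial_succ]
            push_cast
            field_simp

theorem isUnit_one_sub_of_norm_pow_lt_one {R : Type*} [NormedRing R] [HasSummableGeomSeries R]
    (x : R) (k : ℕ) (h : ‖x ^ k‖ < 1) : IsUnit (1 - x) := by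
  have h1 : IsUnit (1 - x ^ k) := (Units.oneSub _ h).isUnit
  have hc : Commute (1 - x) (∑ i ∈ Finset.range k, x ^ i) :=
    Commute.sum_right _ _ _ fun i _ =>
      (Commute.one_left _).sub_left ((Commute.refl _).pow_right i)
  rw [← mul_neg_geom_sum] at h1
  exact (hc.isUnit_mul_iff.1 h1).1

theorem isUnit_one_sub_volterra : IsUnit (1 - volterra hT hA) := by
  have hnn : 0 ≤ ∫ t in (0 : ℝ)..T, entrySum (A t) :=
    intervalIntegral.integral_nonneg hT fun t _ => entrySum_nonneg _
  obtain ⟨k, hk⟩ := ((FloorSemiring.tendsto_pow_div_factorial_atTop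
    (∫ t in (0 : ℝ)..T, entrySum (A t))).eventually (gt_mem_nhds (zero_lt_one' ℝ))).exists
  have hlt : ‖(volterra hT hA) ^ k‖ < 1 := by
    refine lt_of_le_of_lt (ContinuousLinearMap.opNorm_le_bound _ (by positivity) fun y => ?_) hk
    rw [ContinuousMap.norm_le _ (by positivity)]
    intro x
    refine (norm_volterra_pow_apply_le hT hA k y x).trans ?_
    have h0 : 0 ≤ ∫ t in (0 : ℝ)..x, entrySum (A t) :=
      intervalIntegral.integral_nonneg x.2.1 fun t _ => entrySum_nonneg _
    gcongr
    exact intervalIntegral.integral_mono_interval le_rfl x.2.1 x.2.2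
        (.of_forall fun t => entrySum_nonneg _) (intervalIntegrable_entrySum hA)
  exact isUnit_one_sub_of_norm_pow_lt_one (volterra hT hA) k hlt

end Volterra

theorem differentiable_inverse_one_sub_add_smul {E : Type*} [NormedAddCommGroup E]
    [NormedSpace ℂ E] [CompleteSpace E] (L₀ L₁ : E →L[ℂ] E)
    (h : ∀ c : ℂ, IsUnit (1 - (L₀ + c • L₁))) :
    Differentiable ℂ fun c : ℂ => Ring.inverse (1 - (L₀ + c • L₁)) := by
  refine Differentiable.inverse ?_ h
  fun_prop

theorem exists_fundamental_matrix {ι : Type*} [Fintype ι] [DecidableEq ι] {T : ℝ} (hT : 0 ≤ T)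
    {A₀ A₁ : ℝ → Matrix ι ι ℂ} (h₀ : ∀ i j, IntervalIntegrable (fun t => A₀ t i j) volume 0 T)
    (h₁ : ∀ i j, IntervalIntegrable (fun t => A₁ t i j) volume 0 T) :
    ∃ Φ : ℂ → ℝ → Matrix ι ι ℂ,
      (∀ c i j, HasIntegralDeriv (fun x => Φ c x i j)
        (fun t => ((A₀ t + c • A₁ t) * Φ c t) i j) 0 T) ∧
      (∀ c, Φ c 0 = 1) ∧
      (∀ i j, ContinuousOn (fun q : ℝ × ℂ => Φ q.2 q.1 i j) (Set.Icc 0 T ×ˢ Set.univ)) ∧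
      ∀ x ∈ Set.Icc 0 T, ∀ i j, Differentiable ℂ fun c => Φ c x i j := by
  have hc : ∀ (c : ℂ) i j, IntervalIntegrable (fun t => (A₀ t + c • A₁ t) i j) volume 0 T :=
    fun c i j => (h₀ i j).add ((h₁ i j).const_mul c)
  have hsplit : ∀ c, volterra hT (hc c) = volterra hT h₀ + c • volterra hT h₁ := by
    intro c
    ext y x i
    have hsub : uIcc (0 : ℝ) x ⊆ uIcc 0 T := by
      rw [uIcc_of_le x.2.1, uIcc_of_le hT]
      exact Icc_subset_Icc_right x.2.2
    have e0 := (intervalIntegrable_mulVec h₀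
          (fun j => (continuous_projIcc_apply hT y j).continuousOn) i).mono_set hsub
    have e1 := (intervalIntegrable_mulVec h₁
          (fun j => (continuous_projIcc_apply hT y j).continuousOn) i).mono_set hsub
    simp only [volterra_apply, _root_.add_apply, _root_.smul_apply,
      ContinuousMap.add_apply, ContinuousMap.smul_apply, Pi.add_apply, Pi.smul_apply,
      Matrix.add_mulVec, Matrix.smul_mulVec]
    have h := intervalIntegral.integral_add e0 (e1.const_mul c)
    rw [intervalIntegral.integral_const_mul] at h
    exact h
  set J : ℂ → (C(Set.Icc 0 T, ι → ℂ) →L[ℂ] C(Set.Icc 0 T, ι → ℂ)) :=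
    fun c => Ring.inverse (1 - volterra hT (hc c)) with hJ
  have hJd : Differentiable ℂ J := by
    have h := fun c => isUnit_one_sub_volterra hT (hc c)
    simp only [hJ, hsplit] at h ⊢
    exact differentiable_inverse_one_sub_add_smul _ _ h
  let e : ι → C(Set.Icc 0 T, ι → ℂ) := fun j => ContinuousMap.const _ (Pi.single j 1)
  have hfix : ∀ c j, J c (e j) = e j + volterra hT (hc c) (J c (e j)) := by
    intro c j
    have h := Ring.mul_inverse_cancel _ (isUnit_one_sub_volterra hT (hc c))
    have h2 := congrArg (fun L : C(Set.Icc 0 T, ι → ℂ) →L[ℂ] C(Set.Icc 0 T, ι → ℂ) => L (e j)) h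
    simp only [mul_apply_eq_comp, _root_.sub_apply,
      one_apply_eq_self] at h2
    exact sub_eq_iff_eq_add.1 h2
  refine ⟨fun c x => Matrix.of fun i j => J c (e j) (projIcc 0 T hT x) i, ?_, ?_, ?_, ?_⟩
  all_goals simp only [Matrix.of_apply]
  · intro c i j
    have hval : ∀ x ∈ Set.Icc 0 T, J c (e j) (projIcc 0 T hT x) i = (Pi.single j 1 : ι → ℂ) i +
        ∫ t in (0 : ℝ)..x, (A₀ t + c • A₁ t).mulVec (J c (e j) (projIcc 0 T hT t)) i := by
      intro x hx
      conv_lhs => rw [hfix c j]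
      simp only [ContinuousMap.add_apply, Pi.add_apply, volterra_apply, projIcc_of_mem hT hx]
      rfl
    refine ⟨intervalIntegrable_mulVec (hc c)
      (fun j' => (continuous_projIcc_apply hT (J c (e j)) j').continuousOn) i, fun x hx => ?_⟩
    rw [hval x hx, hval 0 ⟨le_rfl, hT⟩, intervalIntegral.integral_same, add_zero]
    rfl
  · intro c
    ext i j
    rw [Matrix.of_apply, hfix c j]
    simp [volterra_apply, e, Matrix.one_apply, Pi.single_apply]
  · intro i j
    refine Continuous.continuousOn ?_
    have h1 : Continuous fun q : ℝ × ℂ => (J q.2 (e j)) (projIcc 0 T hT q.1) := by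
      have : Continuous fun q : ℝ × ℂ => J q.2 (e j) :=
        (hJd.continuous.comp continuous_snd).clm_apply continuous_const
      exact this.eval (continuous_projIcc.comp continuous_fst)
    exact (continuous_apply i).comp h1
  · intro x hx i j
    have h1 : Differentiable ℂ fun c => J c (e j) := hJd.clm_apply (differentiable_const _)
    have h2 := ((ContinuousMap.evalCLM ℂ (projIcc 0 T hT x)).differentiable).comp h1
    exact differentiable_pi.1 h2 i

theorem exists_fundamental_matrix_det_ne_zero {ι : Type*} [Fintype ι] [DecidableEq ι] {T : ℝ}
    (hT : 0 ≤ T) {A₀ A₁ : ℝ → Matrix ι ι ℂ}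
    (h₀ : ∀ i j, IntervalIntegrable (fun t => A₀ t i j) volume 0 T)
    (h₁ : ∀ i j, IntervalIntegrable (fun t => A₁ t i j) volume 0 T) :
    ∃ Φ : ℂ → ℝ → Matrix ι ι ℂ,
      (∀ c i j, HasIntegralDeriv (fun x => Φ c x i j)
        (fun t => ((A₀ t + c • A₁ t) * Φ c t) i j) 0 T) ∧
      (∀ c, ∀ x ∈ Set.Icc 0 T, (Φ c x).det ≠ 0) ∧
      (∀ i j, ContinuousOn (fun q : ℝ × ℂ => Φ q.2 q.1 i j) (Set.Icc 0 T ×ˢ Set.univ)) ∧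
      ∀ x ∈ Set.Icc 0 T, ∀ i j, Differentiable ℂ fun c => Φ c x i j := by
  obtain ⟨Φ, h1, h2, h3, h4⟩ := exists_fundamental_matrix hT h₀ h₁
  obtain ⟨Ψ, g1, g2, -, -⟩ := exists_fundamental_matrix hT
    (A₀ := fun t => -(A₀ t).transpose) (A₁ := fun t => -(A₁ t).transpose)
    (fun i j => (h₀ j i).neg) (fun i j => (h₁ j i).neg)
  refine ⟨Φ, h1, fun c x hx => ?_, h3, h4⟩
  have key : (Ψ c x).transpose * Φ c x = 1 := by
    ext i j
    have hd := HasIntegralDeriv.sum Finset.univ fun l _ => (g1 c l i).mul hT (h1 c l j)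
    have h0 : ∀ t, ∑ l, (((-(A₀ t).transpose + c • -(A₁ t).transpose) * Ψ c t) l i * Φ c t l j +
        Ψ c t l i * ((A₀ t + c • A₁ t) * Φ c t) l j) = 0 := by
      intro t
      have : (((-(A₀ t).transpose + c • -(A₁ t).transpose) * Ψ c t).transpose * Φ c t +
        (Ψ c t).transpose * ((A₀ t + c • A₁ t) * Φ c t)) = 0 := by
        rw [Matrix.transpose_mul, Matrix.mul_assoc, ← Matrix.mul_add, ← Matrix.add_mul]
        simp only [Matrix.transpose_add, Matrix.transpose_neg, Matrix.transpose_smul,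
          Matrix.transpose_transpose, smul_neg]
        rw [show -A₀ t + -(c • A₁ t) + (A₀ t + c • A₁ t) = 0 by abel, Matrix.zero_mul,
          Matrix.mul_zero]
      have := congrFun (congrFun this i) j
      rw [Matrix.add_apply, Matrix.mul_apply, Matrix.mul_apply] at this
      rw [Finset.sum_add_distrib]
      exact this
    have := hd.eq x hx
    simp only [h0, intervalIntegral.integral_zero, add_zero, g2, h2] at this
    rw [Matrix.mul_apply]
    simp only [Matrix.transpose_apply]
    rw [this]
    simp [Matrix.one_apply, eq_comm]
  intro hdet
  have := congrArg Matrix.det key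
  simp [hdet] at this

section ZeroElimination

open Filter Topology

theorem AnalyticAt.dslope {f : ℂ → ℂ} {a z : ℂ} (hz : AnalyticAt ℂ f z) :
    AnalyticAt ℂ (dslope f a) z := by
  rcases eq_or_ne z a with rfl | hne
  · obtain ⟨p, hp⟩ := hz
    exact ⟨_, hp.has_fpower_series_dslope_fslope⟩
  · refine AnalyticAt.congr ?_ (dslope_eventuallyEq_slope_of_ne f hne).symm
    simp only [slope_fun_def, vsub_eq_sub]
    exact ((analyticAt_id.sub analyticAt_const).inv (sub_ne_zero.2 hne)).smul
      (hz.sub analyticAt_const)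

/-- An analytic function with finitely many zeros on `K` is a product of linear factors and a
function without zeros. -/
theorem exists_eq_prod_sub_mul {K : Set ℂ} (Z : Finset ℂ) {f : ℂ → ℂ}
    (hf : AnalyticOnNhd ℂ f K) (hne : ∀ z ∈ K, ¬ ∀ᶠ ρ in 𝓝 z, f ρ = 0)
    (hZ : ∀ z ∈ K, f z = 0 → z ∈ Z) :
    ∃ (s : Multiset ℂ) (h : ℂ → ℂ), AnalyticOnNhd ℂ h K ∧ (∀ z ∈ K, h z ≠ 0) ∧
      (∀ a ∈ s, a ∈ K) ∧ ∀ z ∈ K, ∀ᶠ ρ in 𝓝 z, f ρ = (s.map fun a => ρ - a).prod * h ρ := by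
  induction Z using Finset.induction_on generalizing f with
  | empty =>
    exact ⟨0, f, hf, fun z hz h => by simpa using hZ z hz h, by simp, fun z _ => by simp⟩
  | insert a Z ha ih =>
    by_cases hfa : a ∈ K ∧ f a = 0
    swap
    · refine ih hf hne fun z hz h => ?_
      rcases Finset.mem_insert.1 (hZ z hz h) with rfl | h'
      · exact (hfa ⟨hz, h⟩).elim
      · exact h'
    obtain ⟨haK, hfa⟩ := hfa
    obtain ⟨n, g, hg, hga, hfg⟩ :=
      (hf a haK).exists_eventuallyEq_pow_smul_nonzero_iff.2 (hne a haK)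
    set F : ℂ → ℂ := fun ρ => if ρ = a then g a else f ρ / (ρ - a) ^ n with hF
    have hFa : F =ᶠ[𝓝 a] g := by
      filter_upwards [hfg] with ρ hρ
      by_cases h : ρ = a
      · simp [hF, h]
      · have : ρ - a ≠ 0 := sub_ne_zero.2 h
        simp only [hF, h, if_false, hρ, smul_eq_mul]
        field_simp
    have hFz : ∀ z, z ≠ a → F =ᶠ[𝓝 z] fun ρ => f ρ / (ρ - a) ^ n := fun z hz => by
      filter_upwards [eventually_ne_nhds hz] with ρ hρ
      simp [hF, hρ]
    have hFan : AnalyticOnNhd ℂ F K := fun z hz => by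
      rcases eq_or_ne z a with rfl | h
      · exact hg.congr hFa.symm
      · exact AnalyticAt.congr ((hf z hz).div ((analyticAt_id.sub analyticAt_const).pow n)
          (pow_ne_zero _ (sub_ne_zero.2 h))) (hFz z h).symm
    have hfF : ∀ z, ∀ᶠ ρ in 𝓝 z, f ρ = (ρ - a) ^ n * F ρ := fun z => by
      rcases eq_or_ne z a with rfl | h
      · filter_upwards [hfg, hFa] with ρ h1 h2
        rw [h1, h2, smul_eq_mul]
      · filter_upwards [hFz z h, eventually_ne_nhds h] with ρ h1 h2
        have : ρ - a ≠ 0 := sub_ne_zero.2 h2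
        rw [h1]
        field_simp
    obtain ⟨s, h, h1, h2, h3, h4⟩ := ih hFan
      (fun z hz h0 => hne z hz (by
        filter_upwards [h0, hfF z] with ρ h1 h2
        rw [h2, h1, mul_zero]))
      (fun z hz h0 => by
        by_cases h : z = a
        · simp [hF, h, hga] at h0
        · have := (hfF z).self_of_nhds
          rw [h0, mul_zero] at this
          exact (Finset.mem_insert.1 (hZ z hz this)).resolve_left h)
    refine ⟨Multiset.replicate n a + s, h, h1, h2, fun b hb => ?_, fun z hz => ?_⟩
    · rcases Multiset.mem_add.1 hb with hb | hb
      · rwa [Multiset.eq_of_mem_replicate hb]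
      · exact h3 b hb
    · filter_upwards [hfF z, h4 z hz] with ρ h5 h6
      rw [h5, h6]
      simp [mul_assoc]

theorem exists_eq_prod_sub_mul_of_eventually_ne_zero {K : Set ℂ} (hK : IsClosed K)
    (hpre : IsPreconnected K) [(Bornology.cobounded ℂ ⊓ 𝓟 K).NeBot] {f : ℂ → ℂ}
    (hf : AnalyticOnNhd ℂ f K) (hne : ∀ᶠ ρ in Bornology.cobounded ℂ ⊓ 𝓟 K, f ρ ≠ 0) :
    ∃ (s : Multiset ℂ) (h : ℂ → ℂ), AnalyticOnNhd ℂ h K ∧ (∀ z ∈ K, h z ≠ 0) ∧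
      (∀ a ∈ s, a ∈ K) ∧ ∀ z ∈ K, ∀ᶠ ρ in 𝓝 z, f ρ = (s.map fun a => ρ - a).prod * h ρ := by
  have hnz : ∀ z ∈ K, ¬ ∃ᶠ ρ in 𝓝[≠] z, f ρ = 0 := by
    intro z hz hfr
    have h0 := hf.eqOn_zero_of_preconnected_of_frequently_eq_zero hpre hz hfr
    obtain ⟨ρ, h1, h2⟩ := (hne.and (mem_inf_of_right (mem_principal_self K))).exists
    exact h1 (h0 h2)
  have hfin : {z ∈ K | f z = 0}.Finite := by
    rw [eventually_inf_principal, ← comap_norm_atTop, eventually_comap] at hne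
    obtain ⟨r, hr⟩ := eventually_atTop.1 hne
    by_contra hinf
    have hsub : {z ∈ K | f z = 0} ⊆ Metric.closedBall 0 r ∩ K := fun z hz => by
      refine ⟨?_, hz.1⟩
      rw [mem_closedBall_zero_iff]
      by_contra hlt
      exact hr ‖z‖ (not_le.1 hlt).le z rfl hz.1 hz.2
    obtain ⟨z, hz, hacc⟩ := Set.Infinite.exists_accPt_of_subset_isCompact hinf
      ((isCompact_closedBall 0 r).inter_right hK) hsub
    refine hnz z hz.2 ?_
    rw [accPt_iff_frequently_nhdsNE] at hacc
    exact hacc.mono fun y hy => hy.2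
  refine exists_eq_prod_sub_mul hfin.toFinset hf (fun z hz h => ?_) fun z hz h => by
    simpa using ⟨hz, h⟩
  exact hnz z hz (h.filter_mono nhdsWithin_le_nhds).frequently

/-- In a half plane the polynomial `∑ zⁱ` of `z = (a+b)/(ρ+b)` has no zeros if `b` is suitably
far outside the half plane. -/
theorem exists_shift_geom_sum_ne_zero {ω : ℂ} (hω : ω ≠ 0) (a : ℂ) {M : ℕ} (hM : 0 < M) :
    ∃ b : ℂ, ∀ ρ : ℂ, 0 ≤ (ω * ρ).re → ρ + b ≠ 0 ∧
      (∑ i ∈ Finset.range M, ((a + b) / (ρ + b)) ^ i) ≠ 0 := by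
  have hω2 : 0 < Complex.normSq ω := Complex.normSq_pos.2 hω
  have key : ∀ w ∈ (Polynomial.nthRootsFinset M (1 : ℂ)).erase 1, ∀ᶠ t : ℝ in atTop,
      (ω * w * a).re < t * (Complex.normSq ω * (1 - w.re)) := by
    intro w hw
    rw [Finset.mem_erase, Polynomial.mem_nthRootsFinset hM] at hw
    have hn : ‖w‖ = 1 := Complex.norm_eq_one_of_pow_eq_one hw.2 hM.ne'
    have hlt : w.re < 1 := by
      refine lt_of_le_of_ne (hn ▸ Complex.re_le_norm w) fun h => hw.1 ?_
      have h2 := Complex.normSq_apply w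
      rw [Complex.normSq_eq_norm_sq, hn, h] at h2
      have him : w.im = 0 := by
        have : w.im * w.im = 0 := by linarith
        simpa using this
      exact Complex.ext h him
    exact (tendsto_id.atTop_mul_const (mul_pos hω2 (sub_pos.2 hlt))).eventually_gt_atTop _
  obtain ⟨t, ht, ht0⟩ := (((Finset.eventually_all _).2 key).and (eventually_gt_atTop 0)).exists
  refine ⟨t * (starRingEnd ℂ) ω, fun ρ hρ => ?_⟩
  have hb : ω * (t * (starRingEnd ℂ) ω) = ((t * Complex.normSq ω : ℝ) : ℂ) := by
    push_cast
    rw [← Complex.mul_conj]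
    ring
  set b : ℂ := t * (starRingEnd ℂ) ω
  have hρb : ρ + b ≠ 0 := by
    intro h
    have : (ω * ρ + ω * b).re = 0 := by rw [← mul_add, h]; simp
    rw [hb, Complex.add_re, Complex.ofReal_re] at this
    nlinarith [mul_pos ht0 hω2]
  refine ⟨hρb, fun hsum => ?_⟩
  set z := (a + b) / (ρ + b) with hz
  have hzM : z ^ M = 1 := by
    have := mul_neg_geom_sum z M
    rw [hsum, mul_zero] at this
    exact (sub_eq_zero.1 this.symm).symm
  have hz1 : z ≠ 1 := by
    intro h
    rw [h] at hsum
    simp only [one_pow, Finset.sum_const, Finset.card_range, nsmul_eq_mul, mul_one] at hsum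
    exact hM.ne' (by exact_mod_cast hsum)
  have hz0 : z ≠ 0 := by
    intro h
    rw [h, zero_pow hM.ne'] at hzM
    exact zero_ne_one hzM
  have hw := ht z⁻¹ (by
    rw [Finset.mem_erase, Polynomial.mem_nthRootsFinset hM]
    exact ⟨fun h => hz1 (inv_eq_one.1 h), by rw [inv_pow, hzM, inv_one]⟩)
  have hρ2 : ω * ρ = ω * z⁻¹ * a - (1 - z⁻¹) * (ω * b) := by
    have hab : a + b ≠ 0 := fun h => hz0 (by rw [hz, h, zero_div])
    rw [hz, inv_div]
    field_simp
    ring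
  rw [hρ2, hb] at hρ
  simp only [Complex.sub_re, Complex.mul_re, Complex.ofReal_re, Complex.ofReal_im, mul_zero,
    sub_zero, Complex.one_re] at hρ hw
  linarith

theorem exists_updateCol_det_eq {K : Set ℂ} {ω : ℂ} (hω : ω ≠ 0)
    (hK : ∀ ρ ∈ K, 0 ≤ (ω * ρ).re) {a : ℂ} {M : ℕ} (hM : 0 < M) {m : ℕ}
    {G : ℂ → Matrix (Fin m) (Fin m) ℂ} (hG : ∀ i j, AnalyticOnNhd ℂ (fun ρ => G ρ i j) K)
    (hdet : (G a).det = 0) :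
    ∃ (H U : ℂ → Matrix (Fin m) (Fin m) ℂ) (u : ℂ → ℂ),
      (∀ i j, AnalyticOnNhd ℂ (fun ρ => H ρ i j) K) ∧ AnalyticOnNhd ℂ u K ∧
      (∀ ρ ∈ K, u ρ ≠ 0) ∧
      (∀ z ∈ K, ∀ᶠ ρ in 𝓝 z, (G ρ).det = (ρ - a) * (u ρ * (H ρ).det)) ∧
      (∀ᶠ ρ in Bornology.cobounded ℂ ⊓ 𝓟 K, H ρ = G ρ * U ρ) ∧
      (∀ ρ i j, j < i → U ρ i j = 0) ∧
      ∀ i j, (fun ρ => (U ρ - 1) i j) =O[Bornology.cobounded ℂ ⊓ 𝓟 K] fun ρ => (ρ ^ M)⁻¹ := by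
  obtain ⟨c, k, hck, hclt, hc0⟩ : ∃ (c : Fin m → ℂ) (k : Fin m), c k = 1 ∧ (∀ i, k < i → c i = 0) ∧
      (G a).mulVec c = 0 := by
    obtain ⟨v, hv, hv0⟩ := Matrix.exists_mulVec_eq_zero_iff.2 hdet
    obtain ⟨i, hi⟩ := Function.ne_iff.1 hv
    have hne : (Finset.univ.filter fun i => v i ≠ 0).Nonempty := ⟨i, by simpa using hi⟩
    set k := (Finset.univ.filter fun i => v i ≠ 0).max' hne with hk
    have hkm : v k ≠ 0 := by
      have := Finset.max'_mem _ hne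
      rw [← hk] at this
      simpa using this
    refine ⟨(v k)⁻¹ • v, k, by simp [hkm], fun i hi => ?_, by
      rw [Matrix.mulVec_smul, hv0, smul_zero]⟩
    have : v i = 0 := by
      by_contra h
      exact absurd (Finset.le_max' _ i (by simpa using h)) (not_le.2 hi)
    simp [this]
  obtain ⟨b, hb⟩ := exists_shift_geom_sum_ne_zero hω a hM
  set z : ℂ → ℂ := fun ρ => (a + b) / (ρ + b) with hz
  set u : ℂ → ℂ := fun ρ => (ρ + b)⁻¹ * ∑ i ∈ Finset.range M, z ρ ^ i with hu
  have hzan : AnalyticOnNhd ℂ z K := fun ρ hρ =>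
    analyticAt_const.div (analyticAt_id.add analyticAt_const) (hb ρ (hK ρ hρ)).1
  have huan : AnalyticOnNhd ℂ u K := fun ρ hρ =>
    ((analyticAt_id.add analyticAt_const).inv (hb ρ (hK ρ hρ)).1).mul
      (Finset.analyticAt_fun_sum _ fun i _ => (hzan ρ hρ).pow i)
  have hu0 : ∀ ρ ∈ K, u ρ ≠ 0 := fun ρ hρ =>
    mul_ne_zero (inv_ne_zero (hb ρ (hK ρ hρ)).1) (hb ρ (hK ρ hρ)).2
  have hv : ∀ ρ, ρ + b ≠ 0 → (ρ - a) * u ρ = 1 - z ρ ^ M := by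
    intro ρ hρ
    rw [← mul_neg_geom_sum, hu]
    simp only
    rw [← mul_assoc]
    congr 1
    rw [hz]
    field_simp
    ring
  set E : ℂ → Fin m → ℂ := fun ρ i => dslope (fun ρ => (G ρ).mulVec c i) a ρ with hE
  have hEan : ∀ i, AnalyticOnNhd ℂ (fun ρ => E ρ i) K := fun i ρ hρ => by
    refine AnalyticAt.dslope ?_
    simp only [Matrix.mulVec, dotProduct]
    exact Finset.analyticAt_fun_sum _ fun j _ => (hG i j ρ hρ).mul analyticAt_const
  have hEeq : ∀ ρ i, (ρ - a) * E ρ i = (G ρ).mulVec c i := fun ρ i => by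
    have := sub_smul_dslope (fun ρ => (G ρ).mulVec c i) a ρ
    rw [hc0] at this
    simpa using this
  set κ : ℂ → ℂ := fun ρ => z ρ ^ M / u ρ with hκ
  refine ⟨fun ρ => (G ρ).updateCol k ((fun i => G ρ i k) + κ ρ • E ρ),
    fun ρ => 1 + Matrix.of fun i j => if j = k then κ ρ / (ρ - a) * c i else 0, u, ?_, huan, hu0,
    ?_, ?_, ?_, ?_⟩
  · intro i j ρ hρ
    by_cases h : j = k
    · simp only [h, Matrix.updateCol_self, Pi.add_apply, Pi.smul_apply, smul_eq_mul]
      exact (hG i k ρ hρ).add ((((hzan ρ hρ).pow M).div (huan ρ hρ) (hu0 ρ hρ)).mul (hEan i ρ hρ))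
    · simp only [Matrix.updateCol_ne h]
      exact hG i j ρ hρ
  · intro z₀ hz₀
    have e1 : ∀ᶠ ρ in 𝓝 z₀, ρ + b ≠ 0 :=
      (continuousAt_id.add continuousAt_const).eventually_ne (hb z₀ (hK z₀ hz₀)).1
    have e2 : ∀ᶠ ρ in 𝓝 z₀, u ρ ≠ 0 := (huan z₀ hz₀).continuousAt.eventually_ne (hu0 z₀ hz₀)
    filter_upwards [e1, e2] with ρ h1 h2
    rw [Matrix.det_updateCol_add, Matrix.det_updateCol_smul, Matrix.updateCol_eq_self]
    have h3 : (ρ - a) * ((G ρ).updateCol k (E ρ)).det = (G ρ).det := by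
      rw [← Matrix.det_updateCol_smul]
      have : (ρ - a) • E ρ = fun i => ∑ j, c j • G ρ i j := by
        ext i
        rw [Pi.smul_apply, smul_eq_mul, hEeq]
        simp [Matrix.mulVec, dotProduct, mul_comm]
      rw [this, Matrix.det_updateCol_sum, hck, one_smul]
    have h4 := hv ρ h1
    have h5 : u ρ * κ ρ = z ρ ^ M := by rw [hκ]; field_simp
    calc (G ρ).det = ((ρ - a) * u ρ + z ρ ^ M) * (G ρ).det := by rw [h4]; ring
      _ = (ρ - a) * u ρ * (G ρ).det + u ρ * κ ρ * ((ρ - a) * ((G ρ).updateCol k (E ρ)).det) := by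
        rw [h3, h5]; ring
      _ = _ := by ring
  · have : ∀ᶠ ρ in Bornology.cobounded ℂ ⊓ 𝓟 K, ρ ≠ a :=
      Filter.Eventually.filter_mono inf_le_left (Bornology.eventually_ne_cobounded a)
    filter_upwards [this] with ρ hρ
    have hρ' : ρ - a ≠ 0 := sub_ne_zero.2 hρ
    ext i j
    rw [Matrix.mul_add, Matrix.mul_one, Matrix.add_apply, Matrix.mul_apply]
    by_cases h : j = k
    · subst h
      simp only [Matrix.updateCol_self, Pi.add_apply, Pi.smul_apply, smul_eq_mul, Matrix.of_apply,
        if_true]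
      congr 1
      have : E ρ i = (G ρ).mulVec c i / (ρ - a) := by rw [← hEeq]; field_simp
      rw [this]
      simp only [Matrix.mulVec, dotProduct, Finset.sum_div, Finset.mul_sum]
      exact Finset.sum_congr rfl fun l _ => by ring
    · simp [h]
  · intro ρ i j hij
    simp only [Matrix.add_apply, Matrix.one_apply_ne hij.ne', Matrix.of_apply]
    split_ifs with h
    · rw [hclt i (h ▸ hij)]; simp
    · simp
  · intro i j
    have hlim : Tendsto (fun ρ : ℂ => ρ + b) (Bornology.cobounded ℂ) (Bornology.cobounded ℂ) :=
      tendsto_add_const_cobounded b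
    have hz0 : Tendsto z (Bornology.cobounded ℂ ⊓ 𝓟 K) (𝓝 0) := by
      refine Tendsto.mono_left ?_ inf_le_left
      simpa [hz, div_eq_mul_inv] using
        (tendsto_inv₀_cobounded.comp hlim).const_mul (a + b)
    have hzO : z =O[Bornology.cobounded ℂ ⊓ 𝓟 K] fun ρ => ρ⁻¹ := by
      refine Asymptotics.IsBigO.mono ?_ inf_le_left
      have h1 : (fun ρ : ℂ => ρ) =O[Bornology.cobounded ℂ] fun ρ => ρ + b := by
        refine Asymptotics.IsBigO.of_bound 2 ?_
        filter_upwards [(tendsto_norm_cobounded_atTop (E := ℂ)).eventually_ge_atTop (2 * ‖b‖)]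
          with ρ hρ
        have := norm_sub_le (ρ + b) b
        rw [add_sub_cancel_right] at this
        linarith
      have h2 := h1.inv_rev (by
        filter_upwards [Bornology.eventually_ne_cobounded (0 : ℂ)] with ρ hρ h
        exact (hρ h).elim)
      exact (h2.const_mul_left (a + b)).congr_left fun ρ => by
        simp only [hz, div_eq_mul_inv]
    have h1 : (fun ρ => z ρ ^ M / (1 - z ρ ^ M)) =O[Bornology.cobounded ℂ ⊓ 𝓟 K]
        fun ρ => (ρ ^ M)⁻¹ := by
      have hl : Tendsto (fun ρ => (1 - z ρ ^ M)⁻¹) (Bornology.cobounded ℂ ⊓ 𝓟 K) (𝓝 1) := by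
        have := ((tendsto_const_nhds (x := (1 : ℂ))).sub (hz0.pow M)).inv₀ (by simp [hM.ne'])
        simpa [hM.ne'] using this
      simpa [div_eq_mul_inv] using (hzO.pow M).mul (hl.isBigO_one ℂ)
    simp only [add_sub_cancel_left, Matrix.of_apply]
    split_ifs with h
    · refine (h1.const_mul_left (c i)).congr' ?_ EventuallyEq.rfl
      filter_upwards [mem_inf_of_right (mem_principal_self K)] with ρ hρ
      rw [← hv ρ (hb ρ (hK ρ hρ)).1, hκ]
      simp only [div_eq_mul_inv, mul_inv]
      ring
    · exact Asymptotics.isBigO_zero _ _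

/-- Zeros of the determinant in `K` can be removed by an analytic upper triangular change of the
columns that tends to the identity at infinity to any prescribed order. -/
theorem exists_upperTriangular_det_ne_zero {K : Set ℂ} (hKc : IsClosed K)
    (hpre : IsPreconnected K) [hnb : (Bornology.cobounded ℂ ⊓ 𝓟 K).NeBot] {ω : ℂ} (hω : ω ≠ 0)
    (hK : ∀ ρ ∈ K, 0 ≤ (ω * ρ).re) {M : ℕ} (hM : 0 < M) {m : ℕ}
    {G : ℂ → Matrix (Fin m) (Fin m) ℂ} (hG : ∀ i j, AnalyticOnNhd ℂ (fun ρ => G ρ i j) K)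
    (hdet : ∀ᶠ ρ in Bornology.cobounded ℂ ⊓ 𝓟 K, (G ρ).det ≠ 0) :
    ∃ H U : ℂ → Matrix (Fin m) (Fin m) ℂ,
      (∀ i j, AnalyticOnNhd ℂ (fun ρ => H ρ i j) K) ∧ (∀ ρ ∈ K, (H ρ).det ≠ 0) ∧
      (∀ᶠ ρ in Bornology.cobounded ℂ ⊓ 𝓟 K, H ρ = G ρ * U ρ) ∧
      (∀ ρ i j, j < i → U ρ i j = 0) ∧
      ∀ i j, (fun ρ => (U ρ - 1) i j) =O[Bornology.cobounded ℂ ⊓ 𝓟 K] fun ρ => (ρ ^ M)⁻¹ := by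
  have hdan : ∀ {G : ℂ → Matrix (Fin m) (Fin m) ℂ},
      (∀ i j, AnalyticOnNhd ℂ (fun ρ => G ρ i j) K) → AnalyticOnNhd ℂ (fun ρ => (G ρ).det) K := by
    intro G hG ρ hρ
    simp only [Matrix.det_apply]
    exact Finset.analyticAt_fun_sum _ fun σ _ =>
      AnalyticAt.const_smul (Finset.analyticAt_fun_prod _ fun i _ => hG _ _ ρ hρ)
  obtain ⟨s, h, hh, hh0, hs, heq⟩ :=
    exists_eq_prod_sub_mul_of_eventually_ne_zero hKc hpre (hdan hG) hdet
  clear hdet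
  induction s using Multiset.induction_on generalizing G h with
  | empty =>
    refine ⟨G, fun _ => 1, hG, fun ρ hρ => ?_, by simp, fun ρ i j hij =>
      Matrix.one_apply_ne hij.ne', fun i j => by simpa using Asymptotics.isBigO_zero _ _⟩
    have := (heq ρ hρ).self_of_nhds
    simp only [Multiset.map_zero, Multiset.prod_zero, one_mul] at this
    rw [this]
    exact hh0 ρ hρ
  | cons a s ih =>
    have haK : a ∈ K := hs a (Multiset.mem_cons_self a s)
    have hda : (G a).det = 0 := by
      rw [(heq a haK).self_of_nhds]
      simp
    obtain ⟨H, U, u, hH, hu, hu0, hGH, hHU, hU, hUO⟩ := exists_updateCol_det_eq hω hK hM hG hda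
    obtain ⟨H', U', g1, g2, g3, g4, g5⟩ := ih hH (h / u) (hh.div hu hu0)
      (fun z hz => div_ne_zero (hh0 z hz) (hu0 z hz))
      (fun b hb => hs b (Multiset.mem_cons_of_mem hb)) (fun z hz => by
        have e1 : (fun ρ => (H ρ).det) =ᶠ[𝓝[≠] z]
            fun ρ => (s.map fun a => ρ - a).prod * (h / u) ρ := by
          have e2 : ∀ᶠ ρ in 𝓝 z, u ρ ≠ 0 := (hu z hz).continuousAt.eventually_ne (hu0 z hz)
          have e3 : ∀ᶠ ρ in 𝓝[≠] z, ρ ≠ a := by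
            rcases eq_or_ne z a with rfl | h
            · exact eventually_mem_nhdsWithin
            · exact (eventually_ne_nhds h).filter_mono nhdsWithin_le_nhds
          filter_upwards [e3, e2.filter_mono nhdsWithin_le_nhds,
            (heq z hz).filter_mono nhdsWithin_le_nhds,
            (hGH z hz).filter_mono nhdsWithin_le_nhds] with ρ h1 h2 h3 h4
          have h5 : ρ - a ≠ 0 := sub_ne_zero.2 h1
          rw [h4, Multiset.map_cons, Multiset.prod_cons, mul_assoc] at h3
          have h6 := mul_left_cancel₀ h5 h3
          rw [Pi.div_apply]
          field_simp
          rw [mul_comm, h6]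
        refine (ContinuousAt.eventuallyEq_nhds_iff_eventuallyEq_nhdsNE (hdan hH z hz).continuousAt
          ?_).1 e1
        refine ContinuousAt.mul ?_ ((hh.div hu hu0) z hz).continuousAt
        have : Continuous fun ρ : ℂ => (s.map fun a => ρ - a).prod :=
          continuous_multiset_prod _ fun b _ => by fun_prop
        exact this.continuousAt)
    refine ⟨H', fun ρ => U ρ * U' ρ, g1, g2, ?_, ?_, ?_⟩
    · filter_upwards [hHU, g3] with ρ h1 h2
      rw [h2, h1, Matrix.mul_assoc]
    · intro ρ i j hij
      simp only [Matrix.mul_apply]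
      refine Finset.sum_eq_zero fun l _ => ?_
      rcases lt_or_ge l i with h | h
      · rw [hU ρ i l h, zero_mul]
      · rw [g4 ρ l j (hij.trans_le h), mul_zero]
    · intro i j
      have hone : (fun ρ : ℂ => (ρ ^ M)⁻¹) =O[Bornology.cobounded ℂ ⊓ 𝓟 K] fun _ => (1 : ℂ) := by
        refine Asymptotics.IsBigO.mono ?_ inf_le_left
        simpa [← inv_pow] using ((tendsto_inv₀_cobounded (α := ℂ)).pow M).isBigO_one ℂ
      have hexp : ∀ ρ, (U ρ * U' ρ - 1) i j =
          ∑ l, (U ρ - 1) i l * (U' ρ - 1) l j + (U ρ - 1) i j + (U' ρ - 1) i j := by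
        intro ρ
        have : U ρ * U' ρ - 1 = (U ρ - 1) * (U' ρ - 1) + (U ρ - 1) + (U' ρ - 1) := by
          rw [sub_mul, mul_sub, mul_one, one_mul]
          abel
        rw [this, Matrix.add_apply, Matrix.add_apply, Matrix.mul_apply]
      simp only [hexp]
      refine ((Asymptotics.IsBigO.fun_sum fun l _ => ?_).add (hUO i j)).add (g5 i j)
      simpa using (hUO i l).mul ((g5 l j).trans hone)

end ZeroElimination

theorem norm_cexp_mul_le_one {l : ℂ} {x t : ℝ} (h : l.re * (x - t) ≤ 0) :
    ‖Complex.exp (l * (x - t))‖ ≤ 1 := by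
  rw [Complex.norm_exp, Real.exp_le_one_iff]
  simpa [Complex.mul_re] using h

theorem norm_integral_le_integral_Icc {g : ℝ → ℂ} {h : ℝ → ℝ} {a b c x : ℝ} (hc : c ∈ Set.Icc a b)
    (hx : x ∈ Set.Icc a b) (hh : IntervalIntegrable h volume a b)
    (hh0 : ∀ t, 0 ≤ h t) (hg : ∀ t ∈ uIcc c x, ‖g t‖ ≤ h t) :
    ‖∫ t in c..x, g t‖ ≤ ∫ t in a..b, h t := by
  have hab : a ≤ b := hc.1.trans hc.2
  have hsub : Set.uIoc c x ⊆ Set.Ioc a b := by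
    rw [Set.uIoc]
    exact Ioc_subset_Ioc (le_min hc.1 hx.1) (max_le hc.2 hx.2)
  rw [intervalIntegral.norm_integral_eq_norm_integral_uIoc, intervalIntegral.integral_of_le hab]
  have hi : IntegrableOn h (Set.Ioc a b) := hh.1
  calc ‖∫ t in Set.uIoc c x, g t‖ ≤ ∫ t in Set.uIoc c x, h t :=
        norm_integral_le_of_norm_le (hi.mono_set hsub)
          ((ae_restrict_mem measurableSet_uIoc).mono fun t ht => hg t (uIoc_subset_uIcc ht))
    _ ≤ ∫ t in Set.Ioc a b, h t :=
        setIntegral_mono_set hi (.of_forall fun t => hh0 t) (LE.le.eventuallyLE hsub)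

/-- A uniform Riemann–Lebesgue lemma. -/
theorem exists_norm_integral_cexp_mul_le {f : ℝ → ℂ} {a b : ℝ} (hab : a ≤ b)
    (hf : IntervalIntegrable f volume a b) {ε : ℝ} (hε : 0 < ε) :
    ∃ Λ : ℝ, ∀ l : ℂ, Λ ≤ ‖l‖ → ∀ c ∈ Set.Icc a b,
      (∀ x ∈ Set.Icc a b, ∀ t ∈ uIcc c x, l.re * (x - t) ≤ 0) →
      ∀ x ∈ Set.Icc a b, ‖∫ t in c..x, Complex.exp (l * (x - t)) * f t‖ ≤ ε := by
  have hfL : MemLp f 1 (volume.restrict (Set.Ioc a b)) := memLp_one_iff_integrable.2 hf.1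
  obtain ⟨g, -, hgd, hfg⟩ := hfL.exist_eLpNorm_sub_le ENNReal.one_ne_top le_rfl (half_pos hε)
  have hgc : Continuous g := hgd.continuous
  have hg'c : Continuous (deriv g) := hgd.continuous_deriv (by simp)
  have hgi : HasIntegralDeriv g (deriv g) a b := HasIntegralDeriv.of_hasDerivAt
    (fun x => (hgd.differentiable (by simp) x).hasDerivAt) hg'c a b
  have hsub : IntervalIntegrable (fun t => f t - g t) volume a b :=
    hf.sub (hgc.intervalIntegrable a b)
  have hI : ∫ t in a..b, ‖f t - g t‖ ≤ ε / 2 := by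
    rw [intervalIntegral.integral_of_le hab]
    have h1 : eLpNorm (f - g) 1 (volume.restrict (Set.Ioc a b)) =
        ENNReal.ofReal (∫ t in Set.Ioc a b, ‖f t - g t‖) := by
      rw [eLpNorm_one_eq_lintegral_enorm, ofReal_integral_norm_eq_lintegral_enorm hsub.1]
      rfl
    rw [h1] at hfg
    exact (ENNReal.ofReal_le_ofReal_iff (by positivity)).1 hfg
  obtain ⟨C, hC⟩ := isCompact_Icc.exists_bound_of_continuousOn (hgc.continuousOn (s := Set.Icc a b))
  set D := ∫ t in a..b, ‖deriv g t‖ with hD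
  have hD0 : 0 ≤ D := intervalIntegral.integral_nonneg hab fun t _ => norm_nonneg _
  have hC0 : 0 ≤ C := (norm_nonneg _).trans (hC a ⟨le_rfl, hab⟩)
  refine ⟨(2 * C + D + 1) / (ε / 2), fun l hl c hc hadm x hx => ?_⟩
  have hlpos : 0 < ‖l‖ := lt_of_lt_of_le (by positivity) hl
  have hl0 : l ≠ 0 := norm_pos_iff.1 hlpos
  have hexp : ∀ t ∈ uIcc c x, ‖Complex.exp (l * (x - t))‖ ≤ 1 := fun t ht =>
    norm_cexp_mul_le_one (hadm x hx t ht)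
  have hsubc : uIcc c x ⊆ uIcc a b := by
    rw [uIcc_of_le hab]
    exact uIcc_subset_Icc hc hx
  have hcontE : Continuous fun t : ℝ => Complex.exp (l * (x - t)) := by fun_prop
  have e1 : IntervalIntegrable (fun t => Complex.exp (l * (x - t)) * (f t - g t)) volume c x :=
    (hsub.mono_set hsubc).continuousOn_mul hcontE.continuousOn
  have e2 : IntervalIntegrable (fun t => Complex.exp (l * (x - t)) * g t) volume c x :=
    (hcontE.mul hgc).intervalIntegrable c x
  have hsplit : ∫ t in c..x, Complex.exp (l * (x - t)) * f t =
      (∫ t in c..x, Complex.exp (l * (x - t)) * (f t - g t)) +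
        ∫ t in c..x, Complex.exp (l * (x - t)) * g t := by
    rw [← intervalIntegral.integral_add e1 e2]
    congr 1
    ext t
    ring
  have hA : ‖∫ t in c..x, Complex.exp (l * (x - t)) * (f t - g t)‖ ≤ ε / 2 := by
    refine (norm_integral_le_integral_Icc hc hx hsub.norm (fun t => norm_nonneg _)
      fun t ht => ?_).trans hI
    rw [norm_mul]
    exact mul_le_of_le_one_left (norm_nonneg _) (hexp t ht)
  have hparts : ∫ t in c..x, Complex.exp (l * (x - t)) * g t =
      l⁻¹ * ((Complex.exp (l * (x - c)) * g c - g x) +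
        ∫ t in c..x, Complex.exp (l * (x - t)) * deriv g t) := by
    have hd : ∀ t ∈ uIcc c x, HasDerivAt (fun t : ℝ => -(l⁻¹ * Complex.exp (l * (x - t))))
        (Complex.exp (l * (x - t))) t := fun t _ => by
      have h1 : HasDerivAt (fun t : ℝ => l * ((x : ℂ) - (t : ℂ))) (l * (0 - 1)) t :=
        ((hasDerivAt_const t (x : ℂ)).sub (Complex.ofRealCLM.hasDerivAt (x := t))).const_mul l
      refine ((h1.cexp.const_mul l⁻¹).neg).congr_deriv ?_
      linear_combination Complex.exp (l * (x - t)) * (inv_mul_cancel₀ hl0)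
    have h2 : ∀ t ∈ uIcc c x, HasDerivAt g (deriv g t) t := fun t _ =>
      (hgd.differentiable (by simp) t).hasDerivAt
    have h3 := intervalIntegral.integral_mul_deriv_eq_deriv_mul h2 hd
      (hg'c.intervalIntegrable c x) (hcontE.intervalIntegrable c x)
    have h4 : ∫ t in c..x, Complex.exp (l * (x - t)) * g t =
        ∫ t in c..x, g t * Complex.exp (l * (x - t)) := by
      congr 1; ext t; ring
    rw [h4, h3]
    have h5 : ∫ t in c..x, deriv g t * -(l⁻¹ * Complex.exp (l * (x - t))) =
        -l⁻¹ * ∫ t in c..x, Complex.exp (l * (x - t)) * deriv g t := by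
      rw [← intervalIntegral.integral_const_mul]
      congr 1; ext t; ring
    rw [h5]
    simp only [sub_self, mul_zero, Complex.exp_zero]
    ring
  have hB : ‖∫ t in c..x, Complex.exp (l * (x - t)) * g t‖ ≤ ε / 2 := by
    have h1 : ‖∫ t in c..x, Complex.exp (l * (x - t)) * deriv g t‖ ≤ D := by
      refine norm_integral_le_integral_Icc hc hx (hg'c.intervalIntegrable a b).norm
        (fun t => norm_nonneg _) fun t ht => ?_
      rw [norm_mul]
      exact mul_le_of_le_one_left (norm_nonneg _) (hexp t ht)
    have h2 : ‖Complex.exp (l * (x - c)) * g c‖ ≤ C := by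
      rw [norm_mul]
      exact (mul_le_of_le_one_left (norm_nonneg _) (hexp c left_mem_uIcc)).trans (hC c hc)
    have h3 := hC x hx
    rw [hparts, norm_mul, norm_inv, inv_mul_le_iff₀ hlpos]
    rw [div_le_iff₀ (by positivity)] at hl
    calc _ ≤ ‖Complex.exp (l * (x - c)) * g c‖ + ‖g x‖ +
          ‖∫ t in c..x, Complex.exp (l * (x - t)) * deriv g t‖ :=
        (norm_add_le _ _).trans (by gcongr; exact norm_sub_le _ _)
      _ ≤ 2 * C + D + 1 := by linarith
      _ ≤ _ := hl
  rw [hsplit]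
  exact (norm_add_le _ _).trans (by linarith)

/-- An a priori estimate for diagonal systems with a small perturbation, each component vanishing
at one of its admissible base points. -/
theorem norm_le_of_diagonal_system {ι : Type*} [Fintype ι] {a b : ℝ} (hab : a ≤ b)
    {l : ι → ℂ} {c : ι → ℝ} (hc : ∀ j, c j ∈ Set.Icc a b)
    (hadm : ∀ j, ∀ x ∈ Set.Icc a b, ∀ t ∈ uIcc (c j) x, (l j).re * (x - t) ≤ 0)
    {z F : ι → ℝ → ℂ} {Q : ι → ι → ℝ → ℂ}
    (hF : ∀ j, IntervalIntegrable (F j) volume a b)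
    (hQ : ∀ i j, IntervalIntegrable (Q i j) volume a b)
    (hz : ∀ j, HasIntegralDeriv (z j) (fun t => l j * z j t + F j t + ∑ i, Q j i t * z i t) a b)
    (hz0 : ∀ j, z j (c j) = 0) (hQs : ∀ j, ∑ i, ∫ t in a..b, ‖Q j i t‖ ≤ 1 / 2) {ε : ℝ}
    (hε : ∀ j, ∀ x ∈ Set.Icc a b, ‖∫ t in c j..x, Complex.exp (l j * (x - t)) * F j t‖ ≤ ε)
    (j : ι) {x : ℝ} (hx : x ∈ Set.Icc a b) : ‖z j x‖ ≤ 2 * ε := by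
  have hcont : ∀ j, ContinuousOn (z j) (Set.Icc a b) := fun j => (hz j).continuousOn hab
  have hrep : ∀ j, ∀ x ∈ Set.Icc a b, z j x =
      (∫ t in c j..x, Complex.exp (l j * (x - t)) * F j t) +
        ∑ i, ∫ t in c j..x, Complex.exp (l j * (x - t)) * (Q j i t * z i t) := by
    intro j x hx
    have hE := (HasIntegralDeriv.cexp (-l j) a b).mul hab (hz j)
    have h1 := hE.sub_eq (hc j) hx
    have hsubc : uIcc (c j) x ⊆ uIcc a b := by
      rw [uIcc_of_le hab]
      exact uIcc_subset_Icc (hc j) hx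
    have hcontE : Continuous fun t : ℝ => Complex.exp (l j * (x - t)) := by fun_prop
    have hIF : IntervalIntegrable (fun t => Complex.exp (l j * (x - t)) * F j t) volume (c j) x :=
      ((hF j).mono_set hsubc).continuousOn_mul hcontE.continuousOn
    have hIQ : ∀ i, IntervalIntegrable
        (fun t => Complex.exp (l j * (x - t)) * (Q j i t * z i t)) volume (c j) x := fun i =>
      (((hQ j i).mono_set hsubc).mul_continuousOn ((hcont i).mono
        (by rwa [uIcc_of_le hab] at hsubc))).continuousOn_mul hcontE.continuousOn
    rw [hz0, mul_zero, sub_zero] at h1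
    have h2 : z j x = Complex.exp (l j * x) * (Complex.exp (-l j * x) * z j x) := by
      rw [← mul_assoc, ← Complex.exp_add]
      simp
    rw [h2, h1, ← intervalIntegral.integral_const_mul,
      ← intervalIntegral.integral_finsetSum fun i _ => hIQ i,
      ← intervalIntegral.integral_add hIF (by
        have := IntervalIntegrable.sum Finset.univ (f := fun i t =>
          Complex.exp (l j * (x - t)) * (Q j i t * z i t)) fun i _ => hIQ i
        simp only [Finset.sum_fn] at this
        exact this)]
    congr 1
    ext t
    have h3 : Complex.exp (l j * (x - t)) = Complex.exp (l j * x) * Complex.exp (-l j * t) := by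
      rw [← Complex.exp_add]
      congr 1
      ring
    rw [← Finset.mul_sum, h3]
    ring
  rcases isEmpty_or_nonempty ι with hι | hι
  · exact hι.elim j
  have hmax : ∀ j, ∃ y ∈ Set.Icc a b, ∀ x ∈ Set.Icc a b, ‖z j x‖ ≤ ‖z j y‖ := fun j =>
    isCompact_Icc.exists_isMaxOn ⟨a, le_rfl, hab⟩ (hcont j).norm
  choose y hy hyM using hmax
  obtain ⟨k, -, hk⟩ := Finset.exists_max_image Finset.univ (fun j => ‖z j (y j)‖)
    Finset.univ_nonempty
  have hZ : ∀ j, ∀ x ∈ Set.Icc a b, ‖z j x‖ ≤ ‖z k (y k)‖ := fun j x hx =>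
    (hyM j x hx).trans (hk j (Finset.mem_univ j))
  set Z := ‖z k (y k)‖ with hZdef
  have hZ2 : Z ≤ ε + 1 / 2 * Z := by
    refine (congrArg norm (hrep k (y k) (hy k))).trans_le ?_
    refine (norm_add_le _ _).trans (add_le_add (hε k _ (hy k)) ?_)
    refine (norm_sum_le _ _).trans ?_
    refine (Finset.sum_le_sum fun i _ => norm_integral_le_integral_Icc
      (h := fun t => ‖Q k i t‖ * Z) (hc k) (hy k) ((hQ k i).norm.mul_const Z)
      (fun t => by positivity) fun t ht => ?_).trans ?_
    · rw [norm_mul, norm_mul]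
      refine (mul_le_of_le_one_left (by positivity)
        (norm_cexp_mul_le_one (hadm k _ (hy k) t ht))).trans ?_
      gcongr
      exact hZ i t (uIcc_subset_Icc (hc k) (hy k) ht)
    · simp only [intervalIntegral.integral_mul_const, ← Finset.sum_mul]
      gcongr
      exact hQs k
  have := hZ j x hx
  linarith

theorem rootsOfUnity_sum_eq_ite {d : ℕ} {χ : Fin (d + 1) → ℂ} (hχ : Function.Injective χ)
    (hroot : ∀ j, χ j ^ (d + 1) = 1) (ν m : Fin (d + 1)) :
    ∑ j, (χ j)⁻¹ ^ (ν : ℕ) * χ j ^ (m : ℕ) = if ν = m then (d + 1 : ℂ) else 0 := by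
  have hχ0 : ∀ j, χ j ≠ 0 := fun j h => by simpa [h] using hroot j
  have hn : (d + 1 : ℂ) ≠ 0 := by exact_mod_cast d.succ_ne_zero
  have h1 : (Matrix.of fun l ν : Fin (d + 1) => χ l ^ (ν : ℕ)) *
      (Matrix.of fun ν j : Fin (d + 1) => (d + 1 : ℂ)⁻¹ * (χ j)⁻¹ ^ (ν : ℕ)) = 1 := by
    ext l j
    rw [Matrix.mul_apply]
    simp only [Matrix.of_apply, Matrix.one_apply]
    have h2 : ∀ ν : Fin (d + 1), χ l ^ (ν : ℕ) * ((d + 1 : ℂ)⁻¹ * (χ j)⁻¹ ^ (ν : ℕ)) =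
        (d + 1 : ℂ)⁻¹ * (χ l * (χ j)⁻¹) ^ (ν : ℕ) := fun ν => by
      rw [mul_pow]
      ring
    rw [Finset.sum_congr rfl fun ν _ => h2 ν, ← Finset.mul_sum,
      Fin.sum_univ_eq_sum_range fun i => (χ l * (χ j)⁻¹) ^ i]
    split_ifs with hlj
    · subst hlj
      simp [mul_inv_cancel₀ (hχ0 l), inv_mul_cancel₀ hn]
    · have h3 : χ l * (χ j)⁻¹ ≠ 1 := fun h =>
        hlj (hχ (by rw [← mul_inv_eq_one₀ (hχ0 j)]; exact h))
      rw [geom_sum_eq h3, mul_pow, inv_pow, hroot, hroot]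
      simp
  have h2 := congrArg (fun A => A ν m) (mul_eq_one_comm.1 h1)
  rw [Matrix.mul_apply] at h2
  simp only [Matrix.of_apply, Matrix.one_apply, mul_assoc] at h2
  rw [← Finset.mul_sum, inv_mul_eq_iff_eq_mul₀ hn] at h2
  rw [h2]
  split_ifs <;> simp

theorem inv_pow_val_add_one {d : ℕ} {c : ℂ} (hc : c ^ (d + 1) = 1) (ν : Fin (d + 1)) :
    c⁻¹ ^ ((ν + 1 : Fin (d + 1)) : ℕ) = c⁻¹ ^ (ν : ℕ) * c⁻¹ := by
  rw [← pow_succ]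
  rcases eq_or_ne ν (Fin.last d) with rfl | h
  · simp [hc]
  · rw [Fin.val_add_one_of_lt (Fin.lt_last_iff_ne_last.2 h)]

theorem sum_inv_pow_mul_cyclic {d : ℕ} {c : ℂ} (hc : c ^ (d + 1) = 1) (w : Fin (d + 1) → ℂ) :
    ∑ ν : Fin (d + 1), c⁻¹ ^ (ν : ℕ) * w (ν + 1) = c * ∑ ν : Fin (d + 1), c⁻¹ ^ (ν : ℕ) * w ν := by
  have hc0 : c ≠ 0 := fun h => by simp [h] at hc
  rw [← Equiv.sum_comp (Equiv.addRight (1 : Fin (d + 1))) (fun ν => c⁻¹ ^ (ν : ℕ) * w ν),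
    Finset.mul_sum]
  refine Finset.sum_congr rfl fun ν _ => ?_
  simp only [Equiv.coe_addRight]
  rw [inv_pow_val_add_one hc]
  field_simp

theorem norm_eq_one_of_pow_succ_eq_one {d : ℕ} {c : ℂ} (hc : c ^ (d + 1) = 1) : ‖c‖ = 1 :=
  Complex.norm_eq_one_of_pow_eq_one hc d.succ_ne_zero

theorem norm_le_of_cyclic_system {d : ℕ} {a b : ℝ} (hab : a ≤ b) {χ : Fin (d + 1) → ℂ}
    (hχ : Function.Injective χ) (hroot : ∀ j, χ j ^ (d + 1) = 1) {μ : ℂ}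
    {p : Fin d → ℝ → ℂ} (hp : ∀ m, IntervalIntegrable (p m) volume a b)
    {w r : Fin (d + 1) → ℝ → ℂ} (hr : ∀ ν, IntervalIntegrable (r ν) volume a b)
    (hw : ∀ ν, HasIntegralDeriv (w ν) (fun t => μ * (w (ν + 1) t - w ν t) + r ν t -
      if ν = Fin.last d then ∑ m : Fin d, p m t * μ⁻¹ ^ (d - (m : ℕ)) * w m.castSucc t else 0) a b)
    {c : Fin (d + 1) → ℝ} (hc : ∀ j, c j ∈ Set.Icc a b)
    (hadm : ∀ j, ∀ x ∈ Set.Icc a b, ∀ t ∈ uIcc (c j) x, (μ * (χ j - 1)).re * (x - t) ≤ 0)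
    (hw0 : ∀ j, ∑ ν : Fin (d + 1), (χ j)⁻¹ ^ (ν : ℕ) * w ν (c j) = 0)
    (hsmall : ∑ m : Fin d, ‖μ⁻¹‖ ^ (d - (m : ℕ)) * ∫ t in a..b, ‖p m t‖ ≤ 1 / 2) {ε : ℝ}
    (hε : ∀ j, ∀ x ∈ Set.Icc a b, ‖∫ t in c j..x, Complex.exp (μ * (χ j - 1) * (x - t)) *
      ∑ ν : Fin (d + 1), (χ j)⁻¹ ^ (ν : ℕ) * r ν t‖ ≤ ε) (ν : Fin (d + 1)) {x : ℝ} (hx : x ∈ Set.Icc a b) :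
    ‖w ν x‖ ≤ 2 * ε := by
  have hn : (d + 1 : ℂ) ≠ 0 := by exact_mod_cast d.succ_ne_zero
  have hnR : (0 : ℝ) < d + 1 := by positivity
  have hnorm : ∀ j, ‖χ j‖ = 1 := fun j => norm_eq_one_of_pow_succ_eq_one (hroot j)
  set z : Fin (d + 1) → ℝ → ℂ := fun j x => ∑ ν : Fin (d + 1), (χ j)⁻¹ ^ (ν : ℕ) * w ν x with hz
  have hwz : ∀ (m : Fin (d + 1)) (x : ℝ), w m x = (d + 1 : ℂ)⁻¹ * ∑ l, χ l ^ (m : ℕ) * z l x := by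
    intro m x
    simp only [hz, Finset.mul_sum]
    rw [Finset.sum_comm]
    have h1 : ∀ ν : Fin (d + 1), ∑ l, (d + 1 : ℂ)⁻¹ * (χ l ^ (m : ℕ) * ((χ l)⁻¹ ^ (ν : ℕ) * w ν x)) =
        if ν = m then w ν x else 0 := fun ν => by
      have h2 := rootsOfUnity_sum_eq_ite hχ hroot ν m
      have h3 : ∑ l, (d + 1 : ℂ)⁻¹ * (χ l ^ (m : ℕ) * ((χ l)⁻¹ ^ (ν : ℕ) * w ν x)) =
          (d + 1 : ℂ)⁻¹ * (∑ l, (χ l)⁻¹ ^ (ν : ℕ) * χ l ^ (m : ℕ)) * w ν x := by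
        rw [Finset.mul_sum, Finset.sum_mul]
        exact Finset.sum_congr rfl fun l _ => by ring
      rw [h3, h2]
      split_ifs <;> simp [inv_mul_cancel₀ hn]
    rw [Finset.sum_congr rfl fun ν _ => h1 ν]
    simp
  set Q : Fin (d + 1) → Fin (d + 1) → ℝ → ℂ := fun j l t =>
    -((d + 1 : ℂ)⁻¹ * (χ j)⁻¹ ^ d) * ∑ m : Fin d, p m t * μ⁻¹ ^ (d - (m : ℕ)) * χ l ^ (m : ℕ) with hQ
  have hQi : ∀ j l, IntervalIntegrable (Q j l) volume a b := by
    intro j l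
    refine IntervalIntegrable.const_mul ?_ _
    have h1 := IntervalIntegrable.sum Finset.univ (μ := volume) (a := a) (b := b)
      (f := fun (m : Fin d) t => p m t * μ⁻¹ ^ (d - (m : ℕ)) * χ l ^ (m : ℕ))
      fun m _ => ((hp m).mul_const _).mul_const _
    simpa only [Finset.sum_fn] using h1
  have hQn : ∀ j l t, ‖Q j l t‖ ≤
      (d + 1 : ℝ)⁻¹ * ∑ m : Fin d, ‖μ⁻¹‖ ^ (d - (m : ℕ)) * ‖p m t‖ := by
    intro j l t
    have hn' : ‖(d + 1 : ℂ)‖ = d + 1 := by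
      have : (d + 1 : ℂ) = ((d + 1 : ℕ) : ℂ) := by push_cast; rfl
      rw [this, Complex.norm_natCast]
      push_cast
      rfl
    simp only [hQ, norm_mul, norm_neg, norm_inv, norm_pow, hnorm, hn', inv_one, one_pow, mul_one]
    gcongr
    refine (norm_sum_le _ _).trans (Finset.sum_le_sum fun m _ => ?_)
    simp [hnorm, mul_comm]
  have hQs : ∀ j, ∑ l, ∫ t in a..b, ‖Q j l t‖ ≤ 1 / 2 := by
    intro j
    have hI : ∀ m : Fin d, IntervalIntegrable (fun t => ‖μ⁻¹‖ ^ (d - (m : ℕ)) * ‖p m t‖) volume a b :=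
      fun m => (hp m).norm.const_mul _
    have hIs : IntervalIntegrable
        (fun t => ∑ m : Fin d, ‖μ⁻¹‖ ^ (d - (m : ℕ)) * ‖p m t‖) volume a b := by
      have h1 := IntervalIntegrable.sum Finset.univ (μ := volume) (a := a) (b := b)
        (f := fun (m : Fin d) t => ‖μ⁻¹‖ ^ (d - (m : ℕ)) * ‖p m t‖) fun m _ => hI m
      simpa only [Finset.sum_fn] using h1
    have h1 : ∀ l, ∫ t in a..b, ‖Q j l t‖ ≤ (d + 1 : ℝ)⁻¹ * (1 / 2) := by
      intro l
      refine (intervalIntegral.integral_mono_on hab (hQi j l).norm (hIs.const_mul (d + 1 : ℝ)⁻¹)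
        fun t _ => hQn j l t).trans ?_
      rw [intervalIntegral.integral_const_mul, intervalIntegral.integral_finsetSum fun m _ => hI m]
      simp only [intervalIntegral.integral_const_mul]
      gcongr
    refine (Finset.sum_le_sum fun l _ => h1 l).trans ?_
    simp only [Finset.sum_const, Finset.card_univ, Fintype.card_fin, nsmul_eq_mul]
    push_cast
    rw [mul_inv_cancel_left₀ hnR.ne']
  have hzd : ∀ j, HasIntegralDeriv (z j) (fun t => μ * (χ j - 1) * z j t +
      (∑ ν : Fin (d + 1), (χ j)⁻¹ ^ (ν : ℕ) * r ν t) + ∑ l, Q j l t * z l t) a b := by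
    intro j
    have h1 := HasIntegralDeriv.sum (Finset.univ : Finset (Fin (d + 1)))
      fun ν _ => (hw ν).const_mul ((χ j)⁻¹ ^ (ν : ℕ))
    refine h1.congr hab (fun x _ => by simp [hz]) (.of_forall fun t => ?_)
    have h2 := sum_inv_pow_mul_cyclic (hroot j) fun ν => w ν t
    have h3 : ∑ l, Q j l t * z l t =
        -((χ j)⁻¹ ^ d * ∑ m : Fin d, p m t * μ⁻¹ ^ (d - (m : ℕ)) * w m.castSucc t) := by
      simp only [hQ, hwz _ t, Finset.mul_sum, Finset.sum_mul, ← Finset.sum_neg_distrib]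
      rw [Finset.sum_comm]
      refine Finset.sum_congr rfl fun m _ => Finset.sum_congr rfl fun l _ => ?_
      simp only [Fin.val_castSucc]
      ring
    have h4 : ∑ ν : Fin (d + 1), (χ j)⁻¹ ^ (ν : ℕ) * (if ν = Fin.last d then
        ∑ m : Fin d, p m t * μ⁻¹ ^ (d - (m : ℕ)) * w m.castSucc t else 0) =
        (χ j)⁻¹ ^ d * ∑ m : Fin d, p m t * μ⁻¹ ^ (d - (m : ℕ)) * w m.castSucc t := by
      simp
    rw [h3, ← h4]
    simp only [mul_sub, mul_add, Finset.sum_sub_distrib, Finset.sum_add_distrib] at h2 ⊢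
    have h5 : ∑ ν : Fin (d + 1), (χ j)⁻¹ ^ (ν : ℕ) * (μ * w (ν + 1) t) = μ * (χ j * z j t) := by
      rw [hz, ← h2, Finset.mul_sum]
      exact Finset.sum_congr rfl fun ν _ => by ring
    have h6 : ∑ ν : Fin (d + 1), (χ j)⁻¹ ^ (ν : ℕ) * (μ * w ν t) = μ * z j t := by
      rw [hz, Finset.mul_sum]
      exact Finset.sum_congr rfl fun ν _ => by ring
    rw [h5, h6]
    ring
  have hFi : ∀ j, IntervalIntegrable (fun t => ∑ ν : Fin (d + 1), (χ j)⁻¹ ^ (ν : ℕ) * r ν t) volume a b := by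
    intro j
    have h1 := IntervalIntegrable.sum Finset.univ (μ := volume) (a := a) (b := b)
      (f := fun (ν : Fin (d + 1)) t => (χ j)⁻¹ ^ (ν : ℕ) * r ν t) fun ν _ => (hr ν).const_mul _
    simpa only [Finset.sum_fn] using h1
  have hzb : ∀ l, ‖z l x‖ ≤ 2 * ε := fun l =>
    norm_le_of_diagonal_system hab hc hadm hFi hQi hzd hw0 hQs hε l hx
  rw [hwz]
  have hn' : ‖(d + 1 : ℂ)‖ = d + 1 := by
    have : (d + 1 : ℂ) = ((d + 1 : ℕ) : ℂ) := by push_cast; rfl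
    rw [this, Complex.norm_natCast]
    push_cast
    rfl
  rw [norm_mul, norm_inv, hn', inv_mul_le_iff₀ hnR]
  calc ‖∑ l, χ l ^ (ν : ℕ) * z l x‖ ≤ ∑ l, ‖χ l ^ (ν : ℕ) * z l x‖ := norm_sum_le _ _
    _ ≤ ∑ _l : Fin (d + 1), 2 * ε := Finset.sum_le_sum fun l _ => by simpa [hnorm] using hzb l
    _ = _ := by simp

theorem exists_norm_integral_cyclic_le {d : ℕ} {a b : ℝ} (hab : a ≤ b) {χ : Fin (d + 1) → ℂ}
    (hχ : Function.Injective χ) (hroot : ∀ j, χ j ^ (d + 1) = 1) {k : Fin (d + 1)} (hk : χ k = 1)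
    {φ : Fin (d + 1) → ℝ → ℂ} (hφ : ∀ ν, IntervalIntegrable (φ ν) volume a b)
    (hφ0 : ∀ᵐ t ∂volume.restrict (Set.Icc a b), ∑ ν, φ ν t = 0)
    {Ψ : ℝ → ℝ} (hΨ : IntervalIntegrable Ψ volume a b) (hΨ0 : ∀ t, 0 ≤ Ψ t) {ε : ℝ} (hε : 0 < ε) :
    ∃ Λ : ℝ, ∀ μ : ℂ, Λ ≤ ‖μ‖ → ∀ ψ : Fin (d + 1) → ℝ → ℂ,
      (∀ ν, IntervalIntegrable (ψ ν) volume a b) → (∀ ν, ∀ t ∈ Set.Icc a b, ‖ψ ν t‖ ≤ Ψ t) →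
      ∀ j, ∀ c ∈ Set.Icc a b,
      (∀ x ∈ Set.Icc a b, ∀ t ∈ uIcc c x, (μ * (χ j - 1)).re * (x - t) ≤ 0) →
      ∀ x ∈ Set.Icc a b, ‖∫ t in c..x, Complex.exp (μ * (χ j - 1) * (x - t)) *
        ∑ ν : Fin (d + 1), (χ j)⁻¹ ^ (ν : ℕ) * (φ ν t + μ⁻¹ * ψ ν t)‖ ≤ ε := by
  have hnorm : ∀ j, ‖χ j‖ = 1 := fun j => norm_eq_one_of_pow_succ_eq_one (hroot j)
  have hsumi : ∀ (j : Fin (d + 1)) (f : Fin (d + 1) → ℝ → ℂ),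
      (∀ ν, IntervalIntegrable (f ν) volume a b) →
      IntervalIntegrable (fun t => ∑ ν : Fin (d + 1), (χ j)⁻¹ ^ (ν : ℕ) * f ν t) volume a b := by
    intro j f hf
    have h1 := IntervalIntegrable.sum Finset.univ (μ := volume) (a := a) (b := b)
      (f := fun (ν : Fin (d + 1)) t => (χ j)⁻¹ ^ (ν : ℕ) * f ν t) fun ν _ => (hf ν).const_mul _
    simpa only [Finset.sum_fn] using h1
  have hRL : ∀ j, ∃ Λ : ℝ, ∀ μ : ℂ, Λ ≤ ‖μ‖ → ∀ c ∈ Set.Icc a b,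
      (∀ x ∈ Set.Icc a b, ∀ t ∈ uIcc c x, (μ * (χ j - 1)).re * (x - t) ≤ 0) →
      ∀ x ∈ Set.Icc a b, ‖∫ t in c..x, Complex.exp (μ * (χ j - 1) * (x - t)) *
        ∑ ν : Fin (d + 1), (χ j)⁻¹ ^ (ν : ℕ) * φ ν t‖ ≤ ε / 2 := by
    intro j
    rcases eq_or_ne j k with rfl | hjk
    · refine ⟨0, fun μ _ c hc _ x hx => ?_⟩
      have : ∫ t in c..x, Complex.exp (μ * (χ j - 1) * (x - t)) *
          ∑ ν : Fin (d + 1), (χ j)⁻¹ ^ (ν : ℕ) * φ ν t = 0 := by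
        refine intervalIntegral.integral_zero_ae ?_
        rw [ae_restrict_iff' measurableSet_Icc] at hφ0
        filter_upwards [hφ0] with t ht hmem
        have := ht (uIcc_subset_Icc hc hx (uIoc_subset_uIcc hmem))
        simp [hk, this]
      rw [this, norm_zero]
      exact (half_pos hε).le
    · obtain ⟨Λ, hΛ⟩ := exists_norm_integral_cexp_mul_le hab (hsumi j φ hφ) (half_pos hε)
      have hne : 0 < ‖χ j - 1‖ := norm_pos_iff.2 (sub_ne_zero.2 fun h => hjk (hχ (h.trans hk.symm)))
      refine ⟨Λ / ‖χ j - 1‖, fun μ hμ => hΛ (μ * (χ j - 1)) ?_⟩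
      rwa [norm_mul, ← div_le_iff₀ hne]
  choose Λ hΛ using hRL
  have hI0 : 0 ≤ ∫ t in a..b, Ψ t := intervalIntegral.integral_nonneg hab fun t _ => hΨ0 t
  refine ⟨∑ j, |Λ j| + (2 * ((d + 1) * ∫ t in a..b, Ψ t) / ε + 1),
    fun μ hμ ψ hψi hψ j c hc hadm x hx => ?_⟩
  have hsum0 : 0 ≤ ∑ j, |Λ j| := Finset.sum_nonneg fun j _ => abs_nonneg _
  have hpos0 : 0 ≤ 2 * ((d + 1) * ∫ t in a..b, Ψ t) / ε := by positivity
  have hμpos : 0 < ‖μ‖ := by linarith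
  have hμΛ : Λ j ≤ ‖μ‖ := by
    have h1 := Finset.single_le_sum (f := fun j => |Λ j|) (fun j _ => abs_nonneg _)
      (Finset.mem_univ j)
    have := le_abs_self (Λ j)
    linarith
  have h1 := hΛ j μ hμΛ c hc hadm x hx
  have hsubc : uIcc c x ⊆ uIcc a b := by
    rw [uIcc_of_le hab]
    exact uIcc_subset_Icc hc hx
  have hcontE : Continuous fun t : ℝ => Complex.exp (μ * (χ j - 1) * (x - t)) := by fun_prop
  have hi1 : IntervalIntegrable (fun t => Complex.exp (μ * (χ j - 1) * (x - t)) *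
      ∑ ν : Fin (d + 1), (χ j)⁻¹ ^ (ν : ℕ) * φ ν t) volume c x :=
    ((hsumi j φ hφ).mono_set hsubc).continuousOn_mul hcontE.continuousOn
  have hi2 : IntervalIntegrable (fun t => Complex.exp (μ * (χ j - 1) * (x - t)) *
      ∑ ν : Fin (d + 1), (χ j)⁻¹ ^ (ν : ℕ) * (μ⁻¹ * ψ ν t)) volume c x :=
    ((hsumi j _ fun ν => (hψi ν).const_mul μ⁻¹).mono_set hsubc).continuousOn_mul hcontE.continuousOn
  simp only [mul_add, Finset.sum_add_distrib] at hi1 hi2 ⊢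
  rw [intervalIntegral.integral_add hi1 hi2]
  refine (norm_add_le _ _).trans ?_
  have h2 : ‖∫ t in c..x, Complex.exp (μ * (χ j - 1) * (x - t)) *
      ∑ ν : Fin (d + 1), (χ j)⁻¹ ^ (ν : ℕ) * (μ⁻¹ * ψ ν t)‖ ≤
      ∫ t in a..b, ‖μ‖⁻¹ * ((d + 1) * Ψ t) := by
    refine norm_integral_le_integral_Icc hc hx ((hΨ.const_mul _).const_mul _)
      (fun t => by have := hΨ0 t; positivity) fun t ht => ?_
    rw [norm_mul]
    refine (mul_le_of_le_one_left (norm_nonneg _) (norm_cexp_mul_le_one (hadm x hx t ht))).trans ?_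
    refine (norm_sum_le _ _).trans ?_
    refine (Finset.sum_le_sum (g := fun _ => ‖μ‖⁻¹ * Ψ t) fun ν _ => ?_).trans ?_
    · rw [norm_mul, norm_mul, norm_pow, norm_inv, norm_inv, hnorm, inv_one, one_pow, one_mul]
      gcongr
      exact hψ ν t (uIcc_subset_Icc hc hx ht)
    · simp only [Finset.sum_const, Finset.card_univ, Fintype.card_fin, nsmul_eq_mul]
      push_cast
      apply le_of_eq
      ring
  rw [intervalIntegral.integral_const_mul, intervalIntegral.integral_const_mul] at h2
  have h3 : ‖μ‖⁻¹ * ((d + 1) * ∫ t in a..b, Ψ t) ≤ ε / 2 := by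
    rw [inv_mul_le_iff₀ hμpos]
    have : 2 * ((d + 1) * ∫ t in a..b, Ψ t) / ε ≤ ‖μ‖ := by linarith
    rw [div_le_iff₀ hε] at this
    linarith
  linarith

theorem sum_range_shift_mul_pow (f : ℕ → ℂ) (q : ℂ) (D M : ℕ) :
    ∑ σ ∈ Finset.range M, (if D ≤ σ then f (σ - D) else 0) * q ^ σ =
      q ^ D * ∑ s ∈ Finset.range M, f s * q ^ s -
        q ^ M * ∑ s ∈ Finset.range M, if M ≤ s + D then q ^ (s + D - M) * f s else 0 := by
  have h1 : ∑ σ ∈ Finset.range M, (if D ≤ σ then f (σ - D) else 0) * q ^ σ =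
      ∑ s ∈ Finset.range M, if s + D < M then q ^ (s + D) * f s else 0 := by
    simp only [ite_mul, zero_mul]
    rw [← Finset.sum_filter, ← Finset.sum_filter]
    refine Finset.sum_nbij' (fun σ => σ - D) (fun s => s + D) ?_ ?_ ?_ ?_ ?_
    · intro σ hσ
      simp only [Finset.mem_filter, Finset.mem_range] at hσ ⊢
      omega
    · intro s hs
      simp only [Finset.mem_filter, Finset.mem_range] at hs ⊢
      omega
    · intro σ hσ
      simp only [Finset.mem_filter, Finset.mem_range] at hσ
      omega
    · intro s hs
      simp
    · intro σ hσ
      simp only [Finset.mem_filter, Finset.mem_range] at hσ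
      simp only [Nat.sub_add_cancel hσ.2]
      ring
  rw [h1, Finset.mul_sum, Finset.mul_sum, ← Finset.sum_sub_distrib]
  refine Finset.sum_congr rfl fun s _ => ?_
  by_cases h : M ≤ s + D
  · have h2 : q ^ (s + D) = q ^ M * q ^ (s + D - M) := by rw [← pow_add]; congr 1; omega
    rw [if_neg (not_lt.2 h), if_pos h]
    linear_combination -(f s) * h2
  · rw [if_pos (not_le.1 h), if_neg h]
    ring

theorem formal_residual_eq {d N : ℕ} {μ : ℂ} (hμ : μ ≠ 0) (p : Fin d → ℂ)
    {β dβ : ℕ → Fin (d + 1) → ℂ} (h0 : ∀ ν, β 0 ν = 1)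
    (hrec : ∀ s ≤ N, ∀ ν, β (s + 1) (ν + 1) = β (s + 1) ν + dβ s ν + if ν = Fin.last d then
      ∑ m : Fin d, p m * (if d - (m : ℕ) ≤ s then β (s - (d - (m : ℕ))) m.castSucc else 0) else 0)
    (ν : Fin (d + 1)) :
    μ * ((∑ s ∈ Finset.range (N + 2), β s (ν + 1) * μ⁻¹ ^ s) -
        ∑ s ∈ Finset.range (N + 2), β s ν * μ⁻¹ ^ s) -
      (∑ s ∈ Finset.range (N + 2), dβ s ν * μ⁻¹ ^ s) -
      (if ν = Fin.last d then ∑ m : Fin d, p m * μ⁻¹ ^ (d - (m : ℕ)) *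
        ∑ s ∈ Finset.range (N + 2), β s m.castSucc * μ⁻¹ ^ s else 0) =
    μ⁻¹ ^ (N + 1) * (-(dβ (N + 1) ν + if ν = Fin.last d then ∑ m : Fin d, p m *
        (if d - (m : ℕ) ≤ N + 1 then β (N + 1 - (d - (m : ℕ))) m.castSucc else 0) else 0) +
      μ⁻¹ * if ν = Fin.last d then -∑ m : Fin d, p m * ∑ s ∈ Finset.range (N + 2),
        if N + 2 ≤ s + (d - (m : ℕ)) then μ⁻¹ ^ (s + (d - (m : ℕ)) - (N + 2)) * β s m.castSucc
          else 0 else 0) := by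
  set q := μ⁻¹ with hq
  have hμq : μ * q = 1 := mul_inv_cancel₀ hμ
  have h1 : μ * ((∑ s ∈ Finset.range (N + 2), β s (ν + 1) * q ^ s) -
        ∑ s ∈ Finset.range (N + 2), β s ν * q ^ s) =
      ∑ s ∈ Finset.range (N + 1), (dβ s ν + if ν = Fin.last d then ∑ m : Fin d, p m *
        (if d - (m : ℕ) ≤ s then β (s - (d - (m : ℕ))) m.castSucc else 0) else 0) * q ^ s := by
    rw [← Finset.sum_sub_distrib, Finset.sum_range_succ', h0, h0, sub_self, add_zero,
      Finset.mul_sum]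
    refine Finset.sum_congr rfl fun s hs => ?_
    rw [hrec s (by simp only [Finset.mem_range] at hs; omega) ν, pow_succ]
    linear_combination (dβ s ν + if ν = Fin.last d then ∑ m : Fin d, p m *
        (if d - (m : ℕ) ≤ s then β (s - (d - (m : ℕ))) m.castSucc else 0) else 0) * q ^ s * hμq
  rw [h1]
  by_cases hν : ν = Fin.last d
  · simp only [if_pos hν]
    have h2 : ∑ σ ∈ Finset.range (N + 2), (∑ m : Fin d, p m *
        (if d - (m : ℕ) ≤ σ then β (σ - (d - (m : ℕ))) m.castSucc else 0)) * q ^ σ =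
        (∑ m : Fin d, p m * q ^ (d - (m : ℕ)) *
          ∑ s ∈ Finset.range (N + 2), β s m.castSucc * q ^ s) -
        q ^ (N + 2) * ∑ m : Fin d, p m * ∑ s ∈ Finset.range (N + 2),
          if N + 2 ≤ s + (d - (m : ℕ)) then q ^ (s + (d - (m : ℕ)) - (N + 2)) * β s m.castSucc
            else 0 := by
      rw [Finset.mul_sum, ← Finset.sum_sub_distrib]
      simp only [Finset.sum_mul]
      rw [Finset.sum_comm]
      refine Finset.sum_congr rfl fun m _ => ?_
      have h3 := sum_range_shift_mul_pow (fun s => β s m.castSucc) q (d - (m : ℕ)) (N + 2)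
      simp only [mul_assoc, ← Finset.mul_sum] at h3 ⊢
      rw [h3]
      ring
    rw [Finset.sum_range_succ] at h2
    simp only [add_mul, Finset.sum_add_distrib]
    rw [Finset.sum_range_succ (fun s => dβ s ν * q ^ s) (N + 1)]
    rw [pow_succ q (N + 1)] at h2
    linear_combination h2
  · simp only [if_neg hν]
    rw [Finset.sum_range_succ (fun s => dβ s ν * q ^ s) (N + 1)]
    simp only [add_zero]
    ring

theorem sum_inv_pow_mul_integral_le_half {d : ℕ} {a b : ℝ} (hab : a ≤ b) {p : Fin d → ℝ → ℂ} {μ : ℂ}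
    (hμ1 : 1 ≤ ‖μ‖) (hμ : 2 * ∑ m : Fin d, ∫ t in a..b, ‖p m t‖ ≤ ‖μ‖) :
    ∑ m : Fin d, ‖μ⁻¹‖ ^ (d - (m : ℕ)) * ∫ t in a..b, ‖p m t‖ ≤ 1 / 2 := by
  have hq1 : ‖μ⁻¹‖ ≤ 1 := by rw [norm_inv]; exact inv_le_one_of_one_le₀ hμ1
  have h1 : ∀ m : Fin d, ‖μ⁻¹‖ ^ (d - (m : ℕ)) * ∫ t in a..b, ‖p m t‖ ≤
      ‖μ⁻¹‖ * ∫ t in a..b, ‖p m t‖ := fun m => by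
    gcongr
    · exact intervalIntegral.integral_nonneg hab fun t _ => norm_nonneg _
    · exact pow_le_of_le_one (norm_nonneg _) hq1 (by have := m.2; omega)
  refine (Finset.sum_le_sum fun m _ => h1 m).trans ?_
  rw [← Finset.mul_sum, norm_inv, inv_mul_le_iff₀ (by linarith)]
  linarith

theorem exists_norm_sub_formal_le {d N : ℕ} {a b : ℝ} (hab : a ≤ b)
    {p : Fin d → ℝ → ℂ} (hp : ∀ m, IntervalIntegrable (p m) volume a b)
    {β dβ : ℕ → Fin (d + 1) → ℝ → ℂ}
    (hβ : ∀ s < N + 2, ∀ ν, HasIntegralDeriv (β s ν) (dβ s ν) a b)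
    (h0 : ∀ ν x, β 0 ν x = 1)
    (hrec : ∀ s ≤ N, ∀ ν, ∀ᵐ t ∂volume.restrict (Set.Icc a b),
      β (s + 1) (ν + 1) t = β (s + 1) ν t + dβ s ν t + if ν = Fin.last d then
        ∑ m : Fin d, p m t *
          (if d - (m : ℕ) ≤ s then β (s - (d - (m : ℕ))) m.castSucc t else 0) else 0)
    (hsum : ∀ᵐ t ∂volume.restrict (Set.Icc a b), (∑ ν, dβ (N + 1) ν t) +
      ∑ m : Fin d, p m t *
        (if d - (m : ℕ) ≤ N + 1 then β (N + 1 - (d - (m : ℕ))) m.castSucc t else 0) = 0)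
    {χ : Fin (d + 1) → ℂ} (hχ : Function.Injective χ) (hroot : ∀ j, χ j ^ (d + 1) = 1)
    {k : Fin (d + 1)} (hk : χ k = 1) {ε : ℝ} (hε : 0 < ε) :
    ∃ Λ : ℝ, ∀ μ : ℂ, Λ ≤ ‖μ‖ → ∀ c : Fin (d + 1) → ℝ, (∀ j, c j ∈ Set.Icc a b) →
      (∀ j, ∀ x ∈ Set.Icc a b, ∀ t ∈ uIcc (c j) x, (μ * (χ j - 1)).re * (x - t) ≤ 0) →
      ∀ v : Fin (d + 1) → ℝ → ℂ,
      (∀ ν, HasIntegralDeriv (v ν) (fun t => μ * (v (ν + 1) t - v ν t) -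
        if ν = Fin.last d then ∑ m : Fin d, p m t * μ⁻¹ ^ (d - (m : ℕ)) * v m.castSucc t else 0)
        a b) →
      (∀ j, ∑ ν : Fin (d + 1), (χ j)⁻¹ ^ (ν : ℕ) *
        (v ν (c j) - ∑ s ∈ Finset.range (N + 2), β s ν (c j) * μ⁻¹ ^ s) = 0) →
      ∀ ν, ∀ x ∈ Set.Icc a b,
        ‖v ν x - ∑ s ∈ Finset.range (N + 2), β s ν x * μ⁻¹ ^ s‖ ≤ ε * ‖μ⁻¹‖ ^ (N + 1) := by
  have hcont : ∀ s < N + 2, ∀ ν, ContinuousOn (β s ν) (Set.Icc a b) := fun s hs ν =>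
    (hβ s hs ν).continuousOn hab
  have hbd : ∃ C : ℝ, 0 ≤ C ∧ ∀ s < N + 2, ∀ ν, ∀ t ∈ Set.Icc a b, ‖β s ν t‖ ≤ C := by
    have h1 : ∀ q : Fin (N + 2) × Fin (d + 1), ∃ C, ∀ t ∈ Set.Icc a b, ‖β q.1 q.2 t‖ ≤ C :=
      fun q => isCompact_Icc.exists_bound_of_continuousOn (hcont q.1 q.1.2 q.2)
    choose C hC using h1
    refine ⟨∑ q, |C q|, Finset.sum_nonneg fun _ _ => abs_nonneg _, fun s hs ν t ht => ?_⟩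
    exact ((hC (⟨s, hs⟩, ν) t ht).trans (le_abs_self _)).trans
      (Finset.single_le_sum (f := fun q => |C q|) (fun _ _ => abs_nonneg _) (Finset.mem_univ _))
  obtain ⟨C, hC0, hC⟩ := hbd
  have hΓi : ∀ s < N + 2, IntervalIntegrable (fun t => ∑ m : Fin d, p m t *
      (if d - (m : ℕ) ≤ s then β (s - (d - (m : ℕ))) m.castSucc t else 0)) volume a b := by
    intro s hs
    have h1 := IntervalIntegrable.sum Finset.univ (μ := volume) (a := a) (b := b)
      (f := fun (m : Fin d) t => p m t *
        (if d - (m : ℕ) ≤ s then β (s - (d - (m : ℕ))) m.castSucc t else 0)) fun m _ => by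
      by_cases hm : d - (m : ℕ) ≤ s
      · simp only [if_pos hm]
        refine (hp m).mul_continuousOn ?_
        rw [uIcc_of_le hab]
        exact hcont _ (by omega) _
      · simp only [if_neg hm, mul_zero]
        exact intervalIntegrable_const
    simpa only [Finset.sum_fn] using h1
  set φ : Fin (d + 1) → ℝ → ℂ := fun ν t => -(dβ (N + 1) ν t + if ν = Fin.last d then
    ∑ m : Fin d, p m t *
        (if d - (m : ℕ) ≤ N + 1 then β (N + 1 - (d - (m : ℕ))) m.castSucc t else 0) else 0) with hφ
  have hφi : ∀ ν, IntervalIntegrable (φ ν) volume a b := by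
    intro ν
    refine ((hβ (N + 1) (by omega) ν).integrable.add ?_).neg
    by_cases hν : ν = Fin.last d
    · simpa only [if_pos hν] using hΓi (N + 1) (by omega)
    · simp [if_neg hν]
  have hφ0 : ∀ᵐ t ∂volume.restrict (Set.Icc a b), ∑ ν, φ ν t = 0 := by
    filter_upwards [hsum] with t ht
    simp only [hφ, Finset.sum_neg_distrib, Finset.sum_add_distrib, Finset.sum_ite_eq',
      Finset.mem_univ, if_true]
    rw [ht, neg_zero]
  set Ψ : ℝ → ℝ := fun t => ∑ m : Fin d, ‖p m t‖ * ((N + 2 : ℕ) * C) with hΨ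
  have hΨi : IntervalIntegrable Ψ volume a b := by
    have h1 := IntervalIntegrable.sum Finset.univ (μ := volume) (a := a) (b := b)
      (f := fun (m : Fin d) t => ‖p m t‖ * ((N + 2 : ℕ) * C)) fun m _ => (hp m).norm.mul_const _
    simpa only [Finset.sum_fn] using h1
  have hΨ0 : ∀ t, 0 ≤ Ψ t := fun t => Finset.sum_nonneg fun m _ => by positivity
  obtain ⟨Λ, hΛ⟩ := exists_norm_integral_cyclic_le hab hχ hroot hk hφi hφ0 hΨi hΨ0 (half_pos hε)
  set P := ∑ m : Fin d, ∫ t in a..b, ‖p m t‖ with hP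
  have hPm : ∀ m, 0 ≤ ∫ t in a..b, ‖p m t‖ := fun m =>
    intervalIntegral.integral_nonneg hab fun t _ => norm_nonneg _
  have hP0 : 0 ≤ P := Finset.sum_nonneg fun m _ => hPm m
  refine ⟨|Λ| + 1 + 2 * P, fun μ hμ c hc hadm v hv hv0 ν x hx => ?_⟩
  have hμ1 : 1 ≤ ‖μ‖ := by linarith [abs_nonneg Λ]
  have hμ0 : μ ≠ 0 := norm_pos_iff.1 (by linarith)
  have hq1 : ‖μ⁻¹‖ ≤ 1 := by rw [norm_inv]; exact inv_le_one_of_one_le₀ hμ1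
  set ψ : Fin (d + 1) → ℝ → ℂ := fun ν t => if ν = Fin.last d then
    -∑ m : Fin d, p m t * ∑ s ∈ Finset.range (N + 2),
        if N + 2 ≤ s + (d - (m : ℕ)) then μ⁻¹ ^ (s + (d - (m : ℕ)) - (N + 2)) * β s m.castSucc t
          else 0 else 0 with hψ
  have hψi : ∀ ν, IntervalIntegrable (ψ ν) volume a b := by
    intro ν
    by_cases hν : ν = Fin.last d
    · simp only [hψ, if_pos hν]
      have h1 := IntervalIntegrable.sum Finset.univ (μ := volume) (a := a) (b := b)
        (f := fun (m : Fin d) t => p m t * ∑ s ∈ Finset.range (N + 2),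
          if N + 2 ≤ s + (d - (m : ℕ)) then μ⁻¹ ^ (s + (d - (m : ℕ)) - (N + 2)) * β s m.castSucc t
          else 0) fun m _ => by
        refine (hp m).mul_continuousOn (continuousOn_finsetSum _ fun s hs => ?_)
        rw [uIcc_of_le hab]
        split_ifs
        · exact continuousOn_const.mul (hcont s (Finset.mem_range.1 hs) _)
        · exact continuousOn_const
      simp only [Finset.sum_fn] at h1
      exact h1.neg
    · simp [hψ, if_neg hν]
  have hψb : ∀ ν, ∀ t ∈ Set.Icc a b, ‖ψ ν t‖ ≤ Ψ t := by
    intro ν t ht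
    by_cases hν : ν = Fin.last d
    · simp only [hψ, if_pos hν, norm_neg, hΨ]
      refine (norm_sum_le _ _).trans (Finset.sum_le_sum fun m _ => ?_)
      rw [norm_mul]
      gcongr
      refine (norm_sum_le _ _).trans ?_
      refine (Finset.sum_le_sum (g := fun _ => C) fun s hs => ?_).trans (by simp)
      split_ifs
      · rw [norm_mul, norm_pow]
        exact (mul_le_of_le_one_left (norm_nonneg _) (pow_le_one₀ (norm_nonneg _) hq1)).trans
          (hC s (Finset.mem_range.1 hs) _ t ht)
      · simpa using hC0
    · simpa [hψ, if_neg hν] using hΨ0 t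
  have hmain := hΛ μ (by linarith [le_abs_self Λ]) ψ hψi hψb
  have hr : ∀ ν, IntervalIntegrable (fun t => μ⁻¹ ^ (N + 1) * (φ ν t + μ⁻¹ * ψ ν t)) volume a b :=
    fun ν => ((hφi ν).add ((hψi ν).const_mul _)).const_mul _
  have hw : ∀ ν, HasIntegralDeriv (fun x => v ν x - ∑ s ∈ Finset.range (N + 2), β s ν x * μ⁻¹ ^ s)
      (fun t => μ * ((v (ν + 1) t - ∑ s ∈ Finset.range (N + 2), β s (ν + 1) t * μ⁻¹ ^ s) -
        (v ν t - ∑ s ∈ Finset.range (N + 2), β s ν t * μ⁻¹ ^ s)) +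
        μ⁻¹ ^ (N + 1) * (φ ν t + μ⁻¹ * ψ ν t) -
        if ν = Fin.last d then ∑ m : Fin d, p m t * μ⁻¹ ^ (d - (m : ℕ)) *
          (v m.castSucc t - ∑ s ∈ Finset.range (N + 2), β s m.castSucc t * μ⁻¹ ^ s) else 0) a b := by
    intro ν
    have h1 := HasIntegralDeriv.sum (Finset.range (N + 2)) fun s hs =>
      (hβ s (Finset.mem_range.1 hs) ν).const_mul (μ⁻¹ ^ s)
    refine ((hv ν).sub h1).congr hab (fun x _ => by simp only [mul_comm]) ?_
    have h2 : ∀ᵐ t ∂volume.restrict (Set.Icc a b), ∀ s : ℕ, s ≤ N → ∀ ν,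
        β (s + 1) (ν + 1) t = β (s + 1) ν t + dβ s ν t + if ν = Fin.last d then
        ∑ m : Fin d, p m t *
          (if d - (m : ℕ) ≤ s then β (s - (d - (m : ℕ))) m.castSucc t else 0) else 0 := by
      rw [ae_all_iff]
      intro s
      by_cases hs : s ≤ N
      · filter_upwards [ae_all_iff.2 fun ν => hrec s hs ν] with t ht _ using ht
      · exact .of_forall fun t h => absurd h hs
    filter_upwards [h2] with t ht
    have h3 := formal_residual_eq (N := N) hμ0 (fun m => p m t) (β := fun s ν => β s ν t)
      (dβ := fun s ν => dβ s ν t) (fun ν => h0 ν t) ht ν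
    simp only [hφ, hψ]
    rw [← h3]
    by_cases hν : ν = Fin.last d
    · simp only [if_pos hν, mul_sub, Finset.sum_sub_distrib]
      simp only [mul_comm (dβ _ _ _)]
      ring
    · simp only [if_neg hν, mul_comm (dβ _ _ _)]
      ring
  have hsmall : ∑ m : Fin d, ‖μ⁻¹‖ ^ (d - (m : ℕ)) * ∫ t in a..b, ‖p m t‖ ≤ 1 / 2 :=
    sum_inv_pow_mul_integral_le_half hab hμ1 (by linarith [abs_nonneg Λ])
  have hfin := norm_le_of_cyclic_system hab hχ hroot hp hr hw hc hadm hv0 hsmall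
    (ε := ‖μ⁻¹‖ ^ (N + 1) * (ε / 2)) (fun j x hx => ?_) ν hx
  · refine hfin.trans (le_of_eq ?_)
    ring
  · have h1 := hmain j (c j) (hc j) (hadm j) x hx
    have h2 : ∀ t : ℝ, Complex.exp (μ * (χ j - 1) * (x - t)) * ∑ ν : Fin (d + 1),
        (χ j)⁻¹ ^ (ν : ℕ) * (μ⁻¹ ^ (N + 1) * (φ ν t + μ⁻¹ * ψ ν t)) =
        μ⁻¹ ^ (N + 1) * (Complex.exp (μ * (χ j - 1) * (x - t)) * ∑ ν : Fin (d + 1),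
        (χ j)⁻¹ ^ (ν : ℕ) * (φ ν t + μ⁻¹ * ψ ν t)) := fun t => by
      simp only [Finset.mul_sum]
      exact Finset.sum_congr rfl fun ν _ => by ring
    simp only [h2, intervalIntegral.integral_const_mul, norm_mul, norm_pow]
    gcongr

theorem memW_zero {f : ℝ → ℂ} {a b : ℝ} : MemW 0 f a b ↔ IntervalIntegrable f volume a b := by
  constructor
  · rintro ⟨g, rfl, hg, -⟩
    exact hg 0 le_rfl
  · exact fun h => ⟨fun _ => f, rfl, fun _ _ => h, fun ν hν => absurd hν ν.not_lt_zero⟩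

theorem memW_succ {M : ℕ} {f : ℝ → ℂ} {a b : ℝ} (hab : a ≤ b) :
    MemW (M + 1) f a b ↔ ∃ f' : ℝ → ℂ, HasIntegralDeriv f f' a b ∧ MemW M f' a b := by
  constructor
  · rintro ⟨g, rfl, hg, hg'⟩
    exact ⟨g 1, ⟨hg 1 (by omega), hg' 0 (by omega)⟩, fun ν => g (ν + 1), rfl,
      fun ν hν => hg _ (by omega), fun ν hν => hg' _ (by omega)⟩
  · rintro ⟨f', hf, g, rfl, hg, hg'⟩
    refine ⟨fun ν => Nat.casesOn ν f g, rfl, fun ν hν => ?_, fun ν hν => ?_⟩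
    · cases ν with
      | zero => exact ((hf.continuousOn hab).mono (by rw [uIcc_of_le hab])).intervalIntegrable
      | succ ν => exact hg ν (by omega)
    · cases ν with
      | zero => exact hf.eq
      | succ ν => exact hg' ν (by omega)

namespace MemW

variable {M M' : ℕ} {f g : ℝ → ℂ} {a b : ℝ}

theorem mono (hf : MemW M f a b) (h : M' ≤ M) : MemW M' f a b := by
  obtain ⟨g, hg0, hg, hg'⟩ := hf
  exact ⟨g, hg0, fun ν hν => hg ν (hν.trans h), fun ν hν => hg' ν (hν.trans_le h)⟩

theorem const (hab : a ≤ b) (M : ℕ) (c : ℂ) : MemW M (fun _ => c) a b := by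
  induction M generalizing c with
  | zero => exact memW_zero.2 intervalIntegrable_const
  | succ M ih => exact (memW_succ hab).2 ⟨_, HasIntegralDeriv.const c a b, ih 0⟩

theorem add (hab : a ≤ b) (hf : MemW M f a b) (hg : MemW M g a b) :
    MemW M (fun x => f x + g x) a b := by
  induction M generalizing f g with
  | zero => exact memW_zero.2 ((memW_zero.1 hf).add (memW_zero.1 hg))
  | succ M ih =>
    obtain ⟨f', hf, hf'⟩ := (memW_succ hab).1 hf
    obtain ⟨g', hg, hg'⟩ := (memW_succ hab).1 hg
    exact (memW_succ hab).2 ⟨_, hf.add hg, ih hf' hg'⟩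

theorem const_mul (hab : a ≤ b) (c : ℂ) (hf : MemW M f a b) : MemW M (fun x => c * f x) a b := by
  induction M generalizing f with
  | zero => exact memW_zero.2 ((memW_zero.1 hf).const_mul c)
  | succ M ih =>
    obtain ⟨f', hf, hf'⟩ := (memW_succ hab).1 hf
    exact (memW_succ hab).2 ⟨_, hf.const_mul c, ih hf'⟩

theorem sum (hab : a ≤ b) {ι : Type*} (s : Finset ι) {F : ι → ℝ → ℂ}
    (hF : ∀ i ∈ s, MemW M (F i) a b) : MemW M (fun x => ∑ i ∈ s, F i x) a b := by
  classical
  induction s using Finset.induction_on with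
  | empty => simpa using const hab M 0
  | insert i s hi ih =>
    simp only [Finset.sum_insert hi]
    exact (hF i (Finset.mem_insert_self i s)).add hab
      (ih fun j hj => hF j (Finset.mem_insert_of_mem hj))

theorem mul (hab : a ≤ b) (hf : MemW M f a b) (hg : MemW (M + 1) g a b) :
    MemW M (fun x => f x * g x) a b := by
  induction M generalizing f g with
  | zero =>
    obtain ⟨g', hg, -⟩ := (memW_succ hab).1 hg
    refine memW_zero.2 ((memW_zero.1 hf).mul_continuousOn ?_)
    rw [uIcc_of_le hab]
    exact hg.continuousOn hab
  | succ M ih =>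
    obtain ⟨f', hf1, hf'⟩ := (memW_succ hab).1 hf
    obtain ⟨g', hg1, hg'⟩ := (memW_succ hab).1 hg
    refine (memW_succ hab).2 ⟨_, hf1.mul hab hg1, (ih hf' (hg.mono (by omega))).add hab ?_⟩
    have := ih (hg'.mono (Nat.le_succ M)) hf
    simpa only [mul_comm] using this

end MemW

/-- `g` is a tower of `M` successive derivatives on `[a, b]`, the last one integrable. -/
def IsDerivTower (M : ℕ) (g : ℕ → ℝ → ℂ) (a b : ℝ) : Prop :=
  (∀ ν ≤ M, IntervalIntegrable (g ν) volume a b) ∧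
    ∀ ν < M, ∀ x ∈ Set.Icc a b, g ν x = g ν a + ∫ t in a..x, g (ν + 1) t

theorem IsDerivTower.memW {M : ℕ} {g : ℕ → ℝ → ℂ} {a b : ℝ} (h : IsDerivTower M g a b) {r M' : ℕ}
    (hr : M' + r ≤ M) : MemW M' (g r) a b :=
  ⟨fun ν => g (r + ν), rfl, fun ν hν => h.1 _ (by omega), fun ν hν => h.2 _ (by omega)⟩

theorem IsDerivTower.hasIntegralDeriv {M : ℕ} {g : ℕ → ℝ → ℂ} {a b : ℝ} (h : IsDerivTower M g a b)
    {r : ℕ} (hr : r < M) : HasIntegralDeriv (g r) (g (r + 1)) a b :=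
  ⟨h.1 _ (by omega), h.2 _ hr⟩

/-- The right-hand side of the recurrence for `β_s'`. -/
noncomputable def betaDeriv {d : ℕ} (p : Fin d → ℝ → ℂ) (B : ℕ → ℕ → ℝ → ℂ) (s : ℕ) (x : ℝ) : ℂ :=
  -(1 / ((d + 1 : ℕ) : ℂ)) *
    ((∑ r ∈ Finset.Icc 2 (d + 1), ((d + 1).choose r : ℂ) *
        (if r ≤ s + 1 then B (s + 1 - r) r x else 0)) +
      ∑ m : Fin d, p m x *
        (if d + 1 ≤ s + (m : ℕ) + 1 then betaNu B (s + (m : ℕ) + 1 - (d + 1)) (m : ℕ) x else 0))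

theorem betaNu_congr {B B' : ℕ → ℕ → ℝ → ℂ} {s ν : ℕ} (h : ∀ σ ≤ s, B σ = B' σ) :
    betaNu B s ν = betaNu B' s ν := by
  funext x
  unfold betaNu
  refine Finset.sum_congr rfl fun r _ => ?_
  rw [h (s - r) (Nat.sub_le s r)]

theorem betaDeriv_congr {d : ℕ} (p : Fin d → ℝ → ℂ) {B B' : ℕ → ℕ → ℝ → ℂ} {s : ℕ}
    (h : ∀ σ < s, B σ = B' σ) : betaDeriv p B s = betaDeriv p B' s := by
  funext x
  unfold betaDeriv
  congr 2
  · refine Finset.sum_congr rfl fun r hr => ?_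
    rw [Finset.mem_Icc] at hr
    by_cases h1 : r ≤ s + 1
    · rw [if_pos h1, if_pos h1, h (s + 1 - r) (by omega)]
    · rw [if_neg h1, if_neg h1]
  · refine Finset.sum_congr rfl fun m _ => ?_
    by_cases h1 : d + 1 ≤ s + (m : ℕ) + 1
    · rw [if_pos h1, if_pos h1, betaNu_congr fun σ hσ => h σ (by have := m.2; omega)]
    · rw [if_neg h1, if_neg h1]

theorem memW_betaNu {N : ℕ} {B : ℕ → ℕ → ℝ → ℂ} {a b : ℝ} (hab : a ≤ b) {s M : ℕ} (ν : ℕ)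
    (hM : M + s ≤ N + 2) (h : ∀ σ ≤ s, IsDerivTower (N + 2 - σ) (B σ) a b) :
    MemW M (betaNu B s ν) a b := by
  unfold betaNu
  refine MemW.sum hab _ fun r _ => ?_
  by_cases hr : r ≤ s
  · simp only [if_pos hr]
    exact ((h (s - r) (by omega)).memW (by omega)).const_mul hab _
  · simp only [if_neg hr]
    exact MemW.const hab M 0

theorem memW_betaDeriv {d N : ℕ} {p : Fin d → ℝ → ℂ} {B : ℕ → ℕ → ℝ → ℂ} {a b : ℝ} (hab : a ≤ b)
    (hp : ∀ m : Fin d, MemW (N + (m : ℕ) + 2 - (d + 1)) (p m) a b) {s : ℕ}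
    (hs : s ≤ N + 1) (h : ∀ σ < s, IsDerivTower (N + 2 - σ) (B σ) a b) :
    MemW (N + 1 - s) (betaDeriv p B s) a b := by
  unfold betaDeriv
  refine MemW.const_mul hab _ (MemW.add hab (MemW.sum hab _ fun r hr => ?_)
    (MemW.sum hab _ fun m _ => ?_))
  · rw [Finset.mem_Icc] at hr
    by_cases h1 : r ≤ s + 1
    · simp only [if_pos h1]
      exact ((h (s + 1 - r) (by omega)).memW (by omega)).const_mul hab _
    · simp only [if_neg h1, mul_zero]
      exact MemW.const hab _ 0
  · by_cases h1 : d + 1 ≤ s + (m : ℕ) + 1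
    · simp only [if_pos h1]
      have hm := m.2
      exact ((hp m).mono (by omega)).mul hab
        (memW_betaNu hab _ (by omega) fun σ hσ => h σ (by omega))
    · simp only [if_neg h1, mul_zero]
      exact MemW.const hab _ 0

theorem exists_beta_tower {d N : ℕ} {p : Fin d → ℝ → ℂ} {a b : ℝ} (hab : a ≤ b)
    (hp : ∀ m : Fin d, MemW (N + (m : ℕ) + 2 - (d + 1)) (p m) a b) :
    ∃ B : ℕ → ℕ → ℝ → ℂ, (B 0 0 = fun _ => 1) ∧ (∀ r, 1 ≤ r → B 0 r = fun _ => 0) ∧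
      (∀ s ≤ N + 1, IsDerivTower (N + 2 - s) (B s) a b) ∧
      (∀ s, 1 ≤ s → s ≤ N + 1 → B s 0 a = 0) ∧
      ∀ s, 1 ≤ s → s ≤ N + 1 → B s 1 = betaDeriv p B s := by
  have key : ∀ S, S ≤ N + 1 → ∃ B : ℕ → ℕ → ℝ → ℂ,
      (B 0 0 = fun _ => 1) ∧ (∀ r, 1 ≤ r → B 0 r = fun _ => 0) ∧
      (∀ s ≤ S, IsDerivTower (N + 2 - s) (B s) a b) ∧
      (∀ s, 1 ≤ s → s ≤ S → B s 0 a = 0) ∧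
      ∀ s, 1 ≤ s → s ≤ S → B s 1 = betaDeriv p B s := by
    intro S
    induction S with
    | zero =>
      intro _
      refine ⟨fun _ r => if r = 0 then fun _ => 1 else fun _ => 0, by simp, fun r hr => by
        simp [Nat.one_le_iff_ne_zero.1 hr], fun s _ => ⟨fun ν _ => ?_, fun ν _ x _ => ?_⟩,
        fun s h1 h2 => by omega, fun s h1 h2 => by omega⟩
      · dsimp only
        split_ifs <;> exact intervalIntegrable_const
      · simp only [Nat.add_eq_zero_iff, one_ne_zero, and_false, if_false,
          intervalIntegral.integral_zero, add_zero]
        split_ifs <;> rfl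
    | succ S ih =>
      intro hS
      obtain ⟨B, h00, h0, htow, hnorm, hrec⟩ := ih (by omega)
      obtain ⟨g, hg0, hg, hg'⟩ := memW_betaDeriv (B := B) hab hp hS
        fun σ hσ => htow σ (by omega)
      set G : ℕ → ℝ → ℂ := fun r => Nat.casesOn r (fun x => ∫ t in a..x, g 0 t) g with hG
      have hGtow : IsDerivTower (N + 2 - (S + 1)) G a b := by
        have h1 : HasIntegralDeriv (G 0) (g 0) a b :=
          ⟨hg 0 (Nat.zero_le _), fun x _ => by simp [hG]⟩
        refine ⟨fun ν hν => ?_, fun ν hν => ?_⟩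
        · cases ν with
          | zero => exact ((h1.continuousOn hab).mono (by rw [uIcc_of_le hab])).intervalIntegrable
          | succ ν => exact hg ν (by omega)
        · cases ν with
          | zero => exact h1.eq
          | succ ν => exact hg' ν (by omega)
      have hlow : ∀ σ < S + 1, Function.update B (S + 1) G σ = B σ := fun σ hσ =>
        Function.update_of_ne (by omega) _ _
      refine ⟨Function.update B (S + 1) G, ?_, fun r hr => ?_, fun s hs => ?_, fun s h1 hs => ?_,
        fun s h1 hs => ?_⟩
      · rw [hlow 0 (by omega), h00]
      · rw [hlow 0 (by omega), h0 r hr]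
      · rcases Nat.lt_or_ge s (S + 1) with h | h
        · rw [hlow s h]
          exact htow s (by omega)
        · obtain rfl : s = S + 1 := by omega
          rwa [Function.update_self]
      · rcases Nat.lt_or_ge s (S + 1) with h | h
        · rw [hlow s h]
          exact hnorm s h1 (by omega)
        · obtain rfl : s = S + 1 := by omega
          rw [Function.update_self]
          simp [hG]
      · rw [betaDeriv_congr p fun σ hσ => hlow σ (by omega)]
        rcases Nat.lt_or_ge s (S + 1) with h | h
        · rw [hlow s h]
          exact hrec s h1 (by omega)
        · obtain rfl : s = S + 1 := by omega
          rw [Function.update_self]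
          exact hg0
  exact key (N + 1) le_rfl

/-- The derivative of `betaNu B s ν`. -/
noncomputable def betaNuDeriv (B : ℕ → ℕ → ℝ → ℂ) (s ν : ℕ) (x : ℝ) : ℂ :=
  ∑ r ∈ Finset.range (ν + 1), if r ≤ s then (ν.choose r : ℂ) * B (s - r) (r + 1) x else 0

theorem hasIntegralDeriv_betaNu {N : ℕ} {B : ℕ → ℕ → ℝ → ℂ} {a b : ℝ}
    (h : ∀ s ≤ N + 1, IsDerivTower (N + 2 - s) (B s) a b) {s : ℕ} (hs : s < N + 2) (ν : ℕ) :
    HasIntegralDeriv (betaNu B s ν) (betaNuDeriv B s ν) a b := by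
  refine HasIntegralDeriv.sum _ fun r _ => ?_
  by_cases hr : r ≤ s
  · simp only [if_pos hr]
    exact ((h (s - r) (by omega)).hasIntegralDeriv (by omega)).const_mul _
  · simp only [if_neg hr]
    exact HasIntegralDeriv.const 0 a b

theorem betaNu_succ_eq (B : ℕ → ℕ → ℝ → ℂ) (s ν : ℕ) (x : ℝ) :
    betaNu B (s + 1) ν x = B (s + 1) 0 x +
      ∑ r ∈ Finset.range ν, if r ≤ s then (ν.choose (r + 1) : ℂ) * B (s - r) (r + 1) x else 0 := by
  unfold betaNu
  rw [Finset.sum_range_succ', add_comm]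
  simp

theorem betaNu_succ_succ (B : ℕ → ℕ → ℝ → ℂ) (s ν : ℕ) (x : ℝ) :
    betaNu B (s + 1) (ν + 1) x = betaNu B (s + 1) ν x + betaNuDeriv B s ν x := by
  have h1 : ∑ r ∈ Finset.range ν,
      (if r ≤ s then (ν.choose (r + 1) : ℂ) * B (s - r) (r + 1) x else 0) =
      ∑ r ∈ Finset.range (ν + 1),
        if r ≤ s then (ν.choose (r + 1) : ℂ) * B (s - r) (r + 1) x else 0 := by
    rw [Finset.sum_range_succ]
    simp
  rw [betaNu_succ_eq, betaNu_succ_eq, h1, add_assoc, betaNuDeriv, ← Finset.sum_add_distrib]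
  congr 1
  refine Finset.sum_congr rfl fun r _ => ?_
  split_ifs
  · rw [Nat.choose_succ_succ]
    push_cast
    ring
  · simp

theorem betaNu_zero_left {B : ℕ → ℕ → ℝ → ℂ} (h : B 0 0 = fun _ => 1) (ν : ℕ) (x : ℝ) :
    betaNu B 0 ν x = 1 := by
  unfold betaNu
  rw [Finset.sum_range_succ']
  simp [h]

theorem betaNu_zero_right (B : ℕ → ℕ → ℝ → ℂ) (s : ℕ) (x : ℝ) : betaNu B s 0 x = B s 0 x := by
  simp [betaNu]

theorem betaNu_recurrence {d N : ℕ} {p : Fin d → ℝ → ℂ} {B : ℕ → ℕ → ℝ → ℂ}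
    (h0 : ∀ r, 1 ≤ r → B 0 r = fun _ => 0)
    (hrec : ∀ s, 1 ≤ s → s ≤ N + 1 → B s 1 = betaDeriv p B s) {s : ℕ} (hs : s ≤ N + 1) (x : ℝ) :
    betaNu B (s + 1) (d + 1) x + (∑ m : Fin d, p m x *
      (if d - (m : ℕ) ≤ s then betaNu B (s - (d - (m : ℕ))) (m : ℕ) x else 0)) =
      betaNu B (s + 1) 0 x := by
  have hn : ((d + 1 : ℕ) : ℂ) ≠ 0 := by exact_mod_cast d.succ_ne_zero
  have hp : ∀ m : Fin d, (if d - (m : ℕ) ≤ s then betaNu B (s - (d - (m : ℕ))) (m : ℕ) x else 0) =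
      if d + 1 ≤ s + (m : ℕ) + 1 then betaNu B (s + (m : ℕ) + 1 - (d + 1)) (m : ℕ) x else 0 := by
    intro m
    have hm := m.2
    by_cases h : d - (m : ℕ) ≤ s
    · rw [if_pos h, if_pos (by omega)]
      congr 1
      omega
    · rw [if_neg h, if_neg (by omega)]
  have hexp : betaNu B (s + 1) (d + 1) x = B (s + 1) 0 x + (((d + 1 : ℕ) : ℂ) * B s 1 x +
      ∑ r ∈ Finset.Icc 2 (d + 1), ((d + 1).choose r : ℂ) *
        (if r ≤ s + 1 then B (s + 1 - r) r x else 0)) := by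
    rw [betaNu_succ_eq, Finset.sum_range_succ']
    have h1 : ∑ r ∈ Finset.Icc 2 (d + 1), ((d + 1).choose r : ℂ) *
        (if r ≤ s + 1 then B (s + 1 - r) r x else 0) = ∑ k ∈ Finset.range d,
        if k + 1 ≤ s then ((d + 1).choose (k + 1 + 1) : ℂ) * B (s - (k + 1)) (k + 1 + 1) x else 0 := by
      rw [← Finset.Ico_succ_right_eq_Icc, Finset.sum_Ico_eq_sum_range]
      refine Finset.sum_congr (by simp) fun k _ => ?_
      rw [show 2 + k = k + 1 + 1 by ring]
      by_cases h : k + 1 ≤ s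
      · rw [if_pos h, if_pos (by omega), Nat.add_sub_add_right]
      · rw [if_neg h, if_neg (by omega), mul_zero]
    rw [h1]
    simp [add_comm]
  rw [hexp, betaNu_zero_right]
  simp only [hp]
  rcases Nat.eq_zero_or_pos s with rfl | hs1
  · rw [h0 1 le_rfl]
    have e1 : ∑ r ∈ Finset.Icc 2 (d + 1), ((d + 1).choose r : ℂ) *
        (if r ≤ 0 + 1 then B (0 + 1 - r) r x else 0) = 0 :=
      Finset.sum_eq_zero fun r hr => by
        rw [Finset.mem_Icc] at hr
        rw [if_neg (by omega), mul_zero]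
    have e2 : ∑ m : Fin d, p m x * (if d + 1 ≤ 0 + (m : ℕ) + 1 then
        betaNu B (0 + (m : ℕ) + 1 - (d + 1)) (m : ℕ) x else 0) = 0 :=
      Finset.sum_eq_zero fun m _ => by
        have := m.2
        rw [if_neg (by omega), mul_zero]
    rw [e1, e2]
    simp
  · rw [hrec s hs1 hs, betaDeriv]
    field_simp
    ring

theorem sum_betaNuDeriv (B : ℕ → ℕ → ℝ → ℂ) (s n : ℕ) (x : ℝ) :
    ∑ ν ∈ Finset.range n, betaNuDeriv B s ν x = betaNu B (s + 1) n x - betaNu B (s + 1) 0 x := by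
  rw [← Finset.sum_range_sub fun ν => betaNu B (s + 1) ν x]
  refine Finset.sum_congr rfl fun ν _ => ?_
  rw [betaNu_succ_succ]
  ring

/-- `U` solves on `[a, b]` the first order system equivalent to
`y^{(d+1)} + ∑ m < d, p m * y^{(m)} = c * y`. -/
def IsCompanionSolution {d : ℕ} (p : Fin d → ℝ → ℂ) (c : ℂ) (U : Fin (d + 1) → ℝ → ℂ) (a b : ℝ) :
    Prop :=
  ∀ ν, HasIntegralDeriv (U ν) (fun t => (if ν = Fin.last d then c else 1) * U (ν + 1) t -
    if ν = Fin.last d then ∑ m : Fin d, p m t * U m.castSucc t else 0) a b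

theorem IsCompanionSolution.mono {d : ℕ} {p : Fin d → ℝ → ℂ} {c : ℂ} {U : Fin (d + 1) → ℝ → ℂ}
    {a b a' b' : ℝ} (h : IsCompanionSolution p c U a b) (ha : a ≤ a') (hb : b' ≤ b)
    (hab : a' ≤ b') : IsCompanionSolution p c U a' b' :=
  fun ν => (h ν).mono ha hb hab

theorem exists_companion_fundamental_matrix {d : ℕ} {T : ℝ} (hT : 0 ≤ T) {p : Fin d → ℝ → ℂ}
    (hp : ∀ m, IntervalIntegrable (p m) volume 0 T) :
    ∃ Φ : ℂ → ℝ → Matrix (Fin (d + 1)) (Fin (d + 1)) ℂ,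
      (∀ c g, IsCompanionSolution p c (fun ν x => (Φ c x).mulVec g ν) 0 T) ∧
      (∀ c, ∀ x ∈ Set.Icc 0 T, (Φ c x).det ≠ 0) ∧
      (∀ i j, ContinuousOn (fun q : ℝ × ℂ => Φ q.2 q.1 i j) (Set.Icc 0 T ×ˢ Set.univ)) ∧
      ∀ x ∈ Set.Icc 0 T, ∀ i j, Differentiable ℂ fun c => Φ c x i j := by
  set A₀ : ℝ → Matrix (Fin (d + 1)) (Fin (d + 1)) ℂ := fun t => Matrix.of fun ν j =>
    (if ν = Fin.last d then 0 else if j = ν + 1 then 1 else 0) -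
      if ν = Fin.last d then Fin.lastCases (motive := fun _ => ℂ) 0 (fun m => p m t) j else 0
    with hA₀
  set A₁ : ℝ → Matrix (Fin (d + 1)) (Fin (d + 1)) ℂ := fun _ => Matrix.of fun ν j =>
    if ν = Fin.last d then if j = ν + 1 then 1 else 0 else 0 with hA₁
  obtain ⟨Φ, h1, h2, h3, h4⟩ := exists_fundamental_matrix_det_ne_zero (A₀ := A₀) (A₁ := A₁) hT
    (fun i j => by
      simp only [hA₀, Matrix.of_apply]
      refine intervalIntegrable_const.sub ?_
      split_ifs
      · refine Fin.lastCases ?_ (fun m => ?_) j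
        · simp
        · simpa using hp m
      · exact intervalIntegrable_const)
    (fun i j => by simp only [hA₁]; exact intervalIntegrable_const)
  refine ⟨Φ, fun c g ν => ?_, h2, h3, h4⟩
  have h5 := HasIntegralDeriv.sum (Finset.univ : Finset (Fin (d + 1)))
    fun j _ => (h1 c ν j).const_mul (g j)
  refine h5.congr hT (fun x _ => by simp [Matrix.mulVec, dotProduct, mul_comm])
    (.of_forall fun t => ?_)
  have h6 : ∑ j, g j * ((A₀ t + c • A₁ t) * Φ c t) ν j =
      (A₀ t + c • A₁ t).mulVec ((Φ c t).mulVec g) ν := by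
    rw [Matrix.mulVec_mulVec]
    simp [Matrix.mulVec, dotProduct, mul_comm]
  have h7 : ∀ w : Fin (d + 1) → ℂ, (A₀ t + c • A₁ t).mulVec w ν =
      (if ν = Fin.last d then c else 1) * w (ν + 1) -
        if ν = Fin.last d then ∑ m : Fin d, p m t * w m.castSucc else 0 := fun w => by
    simp only [Matrix.mulVec, dotProduct, Matrix.add_apply, Matrix.smul_apply, hA₀, hA₁,
      Matrix.of_apply, smul_eq_mul]
    by_cases hν : ν = Fin.last d
    · simp only [if_pos hν, add_mul, sub_mul, Finset.sum_add_distrib, Finset.sum_sub_distrib]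
      rw [Fin.sum_univ_castSucc
        (fun j => Fin.lastCases (motive := fun _ => ℂ) 0 (fun m => p m t) j * w j)]
      simp
      ring
    · simp [if_neg hν]
  exact ((h6.trans (h7 _))).symm

theorem IsCompanionSolution.scaled {d : ℕ} {p : Fin d → ℝ → ℂ} {μ : ℂ} (hμ : μ ≠ 0)
    {U : Fin (d + 1) → ℝ → ℂ} {a b : ℝ} (hab : a ≤ b)
    (h : IsCompanionSolution p (μ ^ (d + 1)) U a b) (ν : Fin (d + 1)) :
    HasIntegralDeriv (fun x => μ⁻¹ ^ (ν : ℕ) * (Complex.exp (-μ * x) * U ν x))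
      (fun t => μ * (μ⁻¹ ^ ((ν + 1 : Fin (d + 1)) : ℕ) * (Complex.exp (-μ * t) * U (ν + 1) t) -
          μ⁻¹ ^ (ν : ℕ) * (Complex.exp (-μ * t) * U ν t)) -
        if ν = Fin.last d then ∑ m : Fin d, p m t * μ⁻¹ ^ (d - (m : ℕ)) *
          (μ⁻¹ ^ ((m.castSucc : Fin (d + 1)) : ℕ) * (Complex.exp (-μ * t) * U m.castSucc t)) else 0)
      a b := by
  have hμq : μ * μ⁻¹ = 1 := mul_inv_cancel₀ hμ
  refine (((HasIntegralDeriv.cexp (-μ) a b).mul hab (h ν)).const_mul (μ⁻¹ ^ (ν : ℕ))).congr hab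
    (fun x _ => rfl) (.of_forall fun t => ?_)
  by_cases hν : ν = Fin.last d
  · subst hν
    have h1 : ∑ m : Fin d, p m t * μ⁻¹ ^ (d - (m : ℕ)) *
        (μ⁻¹ ^ ((m.castSucc : Fin (d + 1)) : ℕ) * (Complex.exp (-μ * t) * U m.castSucc t)) =
        μ⁻¹ ^ d * Complex.exp (-μ * t) * ∑ m : Fin d, p m t * U m.castSucc t := by
      rw [Finset.mul_sum]
      refine Finset.sum_congr rfl fun m _ => ?_
      have h2 : μ⁻¹ ^ d = μ⁻¹ ^ (d - (m : ℕ)) * μ⁻¹ ^ (m : ℕ) := by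
        rw [← pow_add]
        congr 1
        have := m.2
        omega
      rw [h2, Fin.val_castSucc]
      ring
    have h2 : μ⁻¹ ^ d * μ ^ (d + 1) = μ := by
      rw [pow_succ, ← mul_assoc, ← mul_pow, inv_mul_cancel₀ hμ, one_pow, one_mul]
    simp only [if_true]
    rw [h1]
    simp only [Fin.last_add_one, Fin.val_zero, pow_zero, one_mul, Fin.val_last]
    linear_combination -(Complex.exp (-μ * t) * U 0 t) * h2
  · simp only [if_neg hν]
    rw [Fin.val_add_one_of_lt (Fin.lt_last_iff_ne_last.2 hν), pow_succ]
    linear_combination (μ⁻¹ ^ (ν : ℕ) * Complex.exp (-μ * t) * U (ν + 1) t) * hμq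

theorem boundary_sum_eq {d N L : ℕ} (hd : d ≤ L) (hN : N + 1 ≤ L) {ρ Rk Rj : ℂ} (hρ : ρ ≠ 0)
    (hRk : Rk ≠ 0) (U : Fin (d + 1) → ℂ) (β : ℕ → Fin (d + 1) → ℂ) (c : ℝ) :
    ρ ^ L * Complex.exp (ρ * Rk * c) * ∑ ν : Fin (d + 1), (Rj / Rk)⁻¹ ^ (ν : ℕ) *
      ((ρ * Rk)⁻¹ ^ (ν : ℕ) * (Complex.exp (-(ρ * Rk) * c) * U ν) -
        ∑ s ∈ Finset.range (N + 2), β s ν * (ρ * Rk)⁻¹ ^ s) =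
    (∑ ν : Fin (d + 1), Rj⁻¹ ^ (ν : ℕ) * ρ ^ (L - (ν : ℕ)) * U ν) -
      Complex.exp (ρ * Rk * c) * ∑ ν : Fin (d + 1), (Rj / Rk)⁻¹ ^ (ν : ℕ) *
        ∑ s ∈ Finset.range (N + 2), β s ν * Rk⁻¹ ^ s * ρ ^ (L - s) := by
  have he : Complex.exp (ρ * Rk * c) * Complex.exp (-(ρ * Rk) * c) = 1 := by
    rw [← Complex.exp_add]
    simp
  have hpow : ∀ s ≤ L, ρ ^ L * ρ⁻¹ ^ s = ρ ^ (L - s) := fun s hs => by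
    rw [inv_pow, pow_sub₀ _ hρ hs]
  simp only [Finset.mul_sum, mul_sub]
  rw [← Finset.sum_sub_distrib, Finset.sum_congr rfl]
  intro ν _
  congr 1
  · rw [← hpow ν (by have := ν.2; omega)]
    have h1 : (Rj / Rk)⁻¹ ^ (ν : ℕ) * (ρ * Rk)⁻¹ ^ (ν : ℕ) = Rj⁻¹ ^ (ν : ℕ) * ρ⁻¹ ^ (ν : ℕ) := by
      rw [← mul_pow, ← mul_pow]
      congr 1
      field_simp
    linear_combination ρ ^ L * U ν * (Complex.exp (ρ * Rk * c) * Complex.exp (-(ρ * Rk) * c)) * h1 +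
      ρ ^ L * U ν * (Rj⁻¹ ^ (ν : ℕ) * ρ⁻¹ ^ (ν : ℕ)) * he
  · refine Finset.sum_congr rfl fun s hs => ?_
    rw [← hpow s (by rw [Finset.mem_range] at hs; omega), mul_inv, mul_pow]
    ring

section Assembly

open Filter Topology Bornology

theorem asymptotics_mul_upperTriangular {l : Filter ℂ} (hl : l ≤ cobounded ℂ) {m N : ℕ} {I : Type*}
    {E y y' b : ℂ → Fin m → I → ℂ} {V : ℂ → Matrix (Fin m) (Fin m) ℂ}
    (hE : ∀ᶠ ρ in l, ∀ j k, j ≤ k → ∀ i, ‖E ρ j i‖ ≤ ‖E ρ k i‖) {C : ℝ}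
    (hb : ∀ᶠ ρ in l, ∀ k i, ‖b ρ k i‖ ≤ C)
    (hy : ∀ ε > 0, ∀ᶠ ρ in l, ∀ k i,
      ‖y ρ k i - E ρ k i * b ρ k i‖ ≤ ε * ‖E ρ k i‖ / ‖ρ‖ ^ (N + 1))
    (hV : ∀ᶠ ρ in l, ∀ j k, k < j → V ρ j k = 0)
    (hVO : ∀ j k, (fun ρ => (V ρ - 1) j k) =O[l] fun ρ => (ρ ^ (N + 2))⁻¹)
    (hy' : ∀ᶠ ρ in l, ∀ k i, y' ρ k i = ∑ j, y ρ j i * V ρ j k) :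
    ∀ ε > 0, ∀ᶠ ρ in l, ∀ k i,
      ‖y' ρ k i - E ρ k i * b ρ k i‖ ≤ ε * ‖E ρ k i‖ / ‖ρ‖ ^ (N + 1) := by
  intro ε hε
  have hVb : ∃ D : ℝ, 0 < D ∧ ∀ᶠ ρ in l, ∀ j k, ‖(V ρ - 1) j k‖ ≤ D * ‖(ρ ^ (N + 2))⁻¹‖ := by
    have h1 : ∀ q : Fin m × Fin m, ∃ D : ℝ, 0 < D ∧
        ∀ᶠ ρ in l, ‖(V ρ - 1) q.1 q.2‖ ≤ D * ‖(ρ ^ (N + 2))⁻¹‖ := fun q =>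
      (hVO q.1 q.2).exists_pos.imp fun D hD => ⟨hD.1, hD.2.bound⟩
    choose D hD0 hD using h1
    refine ⟨∑ q, D q + 1, by have := Finset.sum_nonneg fun q (_ : q ∈ Finset.univ) => (hD0 q).le
                             linarith, ?_⟩
    filter_upwards [eventually_all.2 hD] with ρ h j k
    refine (h (j, k)).trans ?_
    gcongr
    have := Finset.single_le_sum (fun q _ => (hD0 q).le) (Finset.mem_univ (j, k))
    linarith
  obtain ⟨D, hD0, hD⟩ := hVb
  have hnorm : ∀ r : ℝ, ∀ᶠ ρ in l, r ≤ ‖ρ‖ := fun r =>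
    hl (tendsto_norm_cobounded_atTop.eventually_ge_atTop r)
  filter_upwards [hE, hb, hy 1 one_pos, hy (ε / 2) (half_pos hε), hV, hy', hD, hnorm 1,
    hnorm (2 * (m * ((|C| + 1) * D)) / ε)] with ρ hE hb hy1 hy2 hV hy' hD hρ1 hρ k i
  have hρ0 : 0 < ‖ρ‖ := by linarith
  have hbound : ∀ j, ‖y ρ j i‖ ≤ (|C| + 1) * ‖E ρ j i‖ := fun j => by
    have h1 := hy1 j i
    have h2 : 1 * ‖E ρ j i‖ / ‖ρ‖ ^ (N + 1) ≤ ‖E ρ j i‖ := by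
      rw [one_mul]
      exact div_le_self (norm_nonneg _) (one_le_pow₀ hρ1)
    have h3 : ‖E ρ j i * b ρ j i‖ ≤ |C| * ‖E ρ j i‖ := by
      rw [norm_mul, mul_comm]
      gcongr
      exact (hb j i).trans (le_abs_self C)
    calc ‖y ρ j i‖ = ‖(y ρ j i - E ρ j i * b ρ j i) + E ρ j i * b ρ j i‖ := by rw [sub_add_cancel]
      _ ≤ _ := (norm_add_le _ _).trans (by linarith)
  have hterm : ∀ j, ‖y ρ j i * (V ρ - 1) j k‖ ≤
      (|C| + 1) * ‖E ρ k i‖ * (D * ‖(ρ ^ (N + 2))⁻¹‖) := fun j => by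
    rcases le_or_gt j k with hjk | hjk
    · rw [norm_mul]
      gcongr
      · exact (hbound j).trans (by gcongr; exact hE j k hjk i)
      · exact hD j k
    · rw [Matrix.sub_apply, hV j k hjk, Matrix.one_apply_ne hjk.ne', sub_zero, mul_zero, norm_zero]
      positivity
  have hdecomp : y' ρ k i - E ρ k i * b ρ k i =
      (y ρ k i - E ρ k i * b ρ k i) + ∑ j, y ρ j i * (V ρ - 1) j k := by
    have h1 : ∑ j, y ρ j i * (V ρ - 1) j k = ∑ j, y ρ j i * V ρ j k - y ρ k i := by
      simp [Matrix.sub_apply, mul_sub, Finset.sum_sub_distrib, Matrix.one_apply]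
    rw [hy', h1]
    ring
  rw [hdecomp]
  refine (norm_add_le _ _).trans ?_
  have h1 : ‖∑ j, y ρ j i * (V ρ - 1) j k‖ ≤ ε / 2 * ‖E ρ k i‖ / ‖ρ‖ ^ (N + 1) := by
    refine (norm_sum_le _ _).trans ((Finset.sum_le_sum fun j _ => hterm j).trans ?_)
    rw [Finset.sum_const, Finset.card_univ, Fintype.card_fin, nsmul_eq_mul, norm_inv, norm_pow,
      le_div_iff₀ (by positivity)]
    rw [div_le_iff₀ hε] at hρ
    have h2 : ‖ρ‖ ^ (N + 2) = ‖ρ‖ ^ (N + 1) * ‖ρ‖ := pow_succ _ _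
    have h3 : (m : ℝ) * ((|C| + 1) * ‖E ρ k i‖ * (D * (‖ρ‖ ^ (N + 2))⁻¹)) * ‖ρ‖ ^ (N + 1) =
        (m * ((|C| + 1) * D)) * ‖ρ‖⁻¹ * ‖E ρ k i‖ := by
      rw [h2]
      field_simp
    rw [h3]
    gcongr
    rw [← div_eq_mul_inv, div_le_iff₀ hρ0]
    linarith
  have h2 := hy2 k i
  calc _ ≤ ε / 2 * ‖E ρ k i‖ / ‖ρ‖ ^ (N + 1) + ε / 2 * ‖E ρ k i‖ / ‖ρ‖ ^ (N + 1) := add_le_add h2 h1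
    _ = _ := by ring

end Assembly

/-- `β s ν` and their derivatives `dβ s ν` are the coefficients of a formal solution
`exp (μ * x) * ∑ s, β s 0 x * μ⁻¹ ^ s`, solving the equation up to order `N + 1`. -/
structure IsFormalSolution {d : ℕ} (N : ℕ) (p : Fin d → ℝ → ℂ)
    (β dβ : ℕ → Fin (d + 1) → ℝ → ℂ) (a b : ℝ) : Prop where
  hasIntegralDeriv : ∀ s < N + 2, ∀ ν, HasIntegralDeriv (β s ν) (dβ s ν) a b
  zero_eq_one : ∀ ν x, β 0 ν x = 1
  recurrence : ∀ s ≤ N, ∀ ν, ∀ᵐ t ∂volume.restrict (Set.Icc a b),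
    β (s + 1) (ν + 1) t = β (s + 1) ν t + dβ s ν t + if ν = Fin.last d then
      ∑ m : Fin d, p m t *
        (if d - (m : ℕ) ≤ s then β (s - (d - (m : ℕ))) m.castSucc t else 0) else 0
  sum_eq_zero : ∀ᵐ t ∂volume.restrict (Set.Icc a b), (∑ ν, dβ (N + 1) ν t) +
    ∑ m : Fin d, p m t *
      (if d - (m : ℕ) ≤ N + 1 then β (N + 1 - (d - (m : ℕ))) m.castSucc t else 0) = 0

/-- The set of `ρ` for which the real parts of `ρ * R j` are nondecreasing in `j`. -/
def orderedSector {m : ℕ} (R : Fin m → ℂ) : Set ℂ :=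
  {ρ | ∀ j l, j ≤ l → (ρ * R j).re ≤ (ρ * R l).re}

/-- The end of `[α, T]` at which the `j`-th boundary condition on the `k`-th solution is posed. -/
noncomputable def basePoint {m : ℕ} (α T : ℝ) (k j : Fin m) : ℝ := if j ≤ k then α else T

/-- The matrix of the boundary conditions on the coordinates of the `k`-th solution with respect
to `Φ`. -/
noncomputable def boundaryMatrix {d : ℕ} (R : Fin (d + 1) → ℂ)
    (Φ : ℂ → ℝ → Matrix (Fin (d + 1)) (Fin (d + 1)) ℂ) (N : ℕ) (α T : ℝ) (k : Fin (d + 1)) (ρ : ℂ) :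
    Matrix (Fin (d + 1)) (Fin (d + 1)) ℂ :=
  Matrix.of fun j i => ∑ ν : Fin (d + 1), (R j)⁻¹ ^ (ν : ℕ) * ρ ^ (d + N + 1 - (ν : ℕ)) *
    Φ (ρ ^ (d + 1)) (basePoint α T k j) ν i

/-- The right hand side of the boundary conditions on the `k`-th solution. -/
noncomputable def boundaryVector {d : ℕ} (R : Fin (d + 1) → ℂ) (β : ℕ → Fin (d + 1) → ℝ → ℂ)
    (N : ℕ) (α T : ℝ) (k : Fin (d + 1)) (ρ : ℂ) (j : Fin (d + 1)) : ℂ :=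
  Complex.exp (ρ * R k * basePoint α T k j) * ∑ ν : Fin (d + 1), (R j / R k)⁻¹ ^ (ν : ℕ) *
    ∑ s ∈ Finset.range (N + 2), β s ν (basePoint α T k j) * (R k)⁻¹ ^ s * ρ ^ (d + N + 1 - s)

section Boundary

variable {d N : ℕ} {α T : ℝ} {R : Fin (d + 1) → ℂ} {p : Fin d → ℝ → ℂ}

theorem basePoint_mem (hαT : α ≤ T) (k j : Fin (d + 1)) : basePoint α T k j ∈ Set.Icc α T := by
  unfold basePoint
  split_ifs
  · exact left_mem_Icc.2 hαT
  · exact right_mem_Icc.2 hαT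

theorem re_mul_sub_nonpos {ρ : ℂ} (hρ : ρ ∈ orderedSector R) {k : Fin (d + 1)} (hk : R k ≠ 0)
    (j : Fin (d + 1)) {x t : ℝ} (hx : x ∈ Set.Icc α T) (ht : t ∈ uIcc (basePoint α T k j) x) :
    (ρ * R k * (R j / R k - 1)).re * (x - t) ≤ 0 := by
  have h1 : ρ * R k * (R j / R k - 1) = ρ * R j - ρ * R k := by field_simp
  rw [h1, Complex.sub_re]
  unfold basePoint at ht
  split_ifs at ht with hjk
  · rw [Set.uIcc_of_le hx.1] at ht
    exact mul_nonpos_of_nonpos_of_nonneg (sub_nonpos.2 (hρ j k hjk)) (sub_nonneg.2 ht.2)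
  · rw [Set.uIcc_of_ge hx.2] at ht
    exact mul_nonpos_of_nonneg_of_nonpos (sub_nonneg.2 (hρ k j (not_le.1 hjk).le))
      (sub_nonpos.2 ht.1)

theorem boundaryMatrix_mulVec (Φ : ℂ → ℝ → Matrix (Fin (d + 1)) (Fin (d + 1)) ℂ)
    (k : Fin (d + 1)) (ρ : ℂ) (g : Fin (d + 1) → ℂ) (j : Fin (d + 1)) :
    (boundaryMatrix R Φ N α T k ρ).mulVec g j =
      ∑ ν : Fin (d + 1), (R j)⁻¹ ^ (ν : ℕ) * ρ ^ (d + N + 1 - (ν : ℕ)) *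
        (Φ (ρ ^ (d + 1)) (basePoint α T k j)).mulVec g ν := by
  simp only [boundaryMatrix, Matrix.mulVec, dotProduct, Matrix.of_apply, Finset.sum_mul,
    Finset.mul_sum]
  rw [Finset.sum_comm]
  simp only [mul_assoc]

variable (hα : 0 ≤ α) (hαT : α ≤ T) (hp : ∀ m, IntervalIntegrable (p m) volume α T)
  {Φ : ℂ → ℝ → Matrix (Fin (d + 1)) (Fin (d + 1)) ℂ}
  (hΦ : ∀ c g, IsCompanionSolution p c (fun ν x => (Φ c x).mulVec g ν) 0 T)
  (hinj : Function.Injective R) (hroot : ∀ j, R j ^ (d + 1) = 1)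

include hroot

theorem root_ne_zero (k : Fin (d + 1)) : R k ≠ 0 := by
  intro h
  simpa [h] using hroot k

theorem div_root_pow (j k : Fin (d + 1)) : (R j / R k) ^ (d + 1) = 1 := by
  rw [div_pow, hroot, hroot, div_one]

theorem norm_root_eq_one (k : Fin (d + 1)) : ‖R k‖ = 1 := norm_eq_one_of_pow_succ_eq_one (hroot k)

theorem norm_mul_root (ρ : ℂ) (k : Fin (d + 1)) : ‖ρ * R k‖ = ‖ρ‖ := by
  rw [norm_mul, norm_root_eq_one hroot, mul_one]

include hinj

theorem div_root_injective (k : Fin (d + 1)) : Function.Injective fun j => R j / R k :=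
  fun _ _ h => hinj ((div_left_inj' (root_ne_zero hroot k)).1 h)

include hα hαT hp hΦ

theorem exists_det_boundaryMatrix_ne_zero (hΦ0 : ∀ c, ∀ x ∈ Set.Icc 0 T, (Φ c x).det ≠ 0)
    (N : ℕ) (k : Fin (d + 1)) :
    ∃ Λ : ℝ, ∀ ρ ∈ orderedSector R, Λ ≤ ‖ρ‖ → (boundaryMatrix R Φ N α T k ρ).det ≠ 0 := by
  refine ⟨max 1 (2 * ∑ m : Fin d, ∫ t in α..T, ‖p m t‖), fun ρ hρ hΛ hdet => ?_⟩
  have hΛ1 := (le_max_left _ _).trans hΛ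
  have hΛ2 := (le_max_right _ _).trans hΛ
  have hρ0 : ρ ≠ 0 := norm_pos_iff.1 (by linarith)
  have hRk := root_ne_zero hroot k
  have hμ0 : ρ * R k ≠ 0 := mul_ne_zero hρ0 hRk
  obtain ⟨g, hg0, hg⟩ := Matrix.exists_mulVec_eq_zero_iff.2 hdet
  have hμpow : (ρ * R k) ^ (d + 1) = ρ ^ (d + 1) := by rw [mul_pow, hroot, mul_one]
  have hsol := (hΦ (ρ ^ (d + 1)) g).mono hα le_rfl hαT
  rw [← hμpow] at hsol
  have hscaled := hsol.scaled hμ0 hαT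
  have hw0 : ∀ j, ∑ ν : Fin (d + 1), (R j / R k)⁻¹ ^ (ν : ℕ) * ((ρ * R k)⁻¹ ^ (ν : ℕ) *
      (Complex.exp (-(ρ * R k) * basePoint α T k j) *
        (Φ ((ρ * R k) ^ (d + 1)) (basePoint α T k j)).mulVec g ν)) = 0 := fun j => by
    have h1 := boundary_sum_eq (N := N) (L := d + N + 1) (by omega) (by omega) hρ0 hRk (Rj := R j)
      ((Φ ((ρ * R k) ^ (d + 1)) (basePoint α T k j)).mulVec g) 0 (basePoint α T k j)
    have h2 := congrFun hg j
    rw [boundaryMatrix_mulVec, ← hμpow] at h2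
    rw [h2] at h1
    simpa [hρ0, hRk] using h1
  have h := norm_le_of_cyclic_system hαT (div_root_injective hinj hroot k) (div_root_pow hroot · k)
    (μ := ρ * R k) hp (r := fun _ _ => 0) (fun _ => intervalIntegrable_const)
    (fun ν => by simpa only [add_zero] using hscaled ν) (basePoint_mem hαT k)
    (fun j x hx t ht => re_mul_sub_nonpos hρ hRk j hx ht) hw0
    (sum_inv_pow_mul_integral_le_half hαT (by rwa [norm_mul_root hroot])
      (by rwa [norm_mul_root hroot])) (ε := 0) (fun j x hx => by simp)
  have hU : (Φ ((ρ * R k) ^ (d + 1)) α).mulVec g = 0 := by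
    funext ν
    have h1 := norm_le_zero_iff.1 ((h ν (left_mem_Icc.2 hαT)).trans_eq (mul_zero 2))
    simpa [hμ0, hρ0, hRk] using h1
  refine hΦ0 _ α ⟨hα, hαT⟩ (Matrix.exists_mulVec_eq_zero_iff.1 ⟨g, hg0, hU⟩)

theorem exists_norm_mulVec_sub_le {β dβ : ℕ → Fin (d + 1) → ℝ → ℂ}
    (hβ : IsFormalSolution N p β dβ α T) (k : Fin (d + 1)) {ε : ℝ} (hε : 0 < ε) :
    ∃ Λ : ℝ, ∀ ρ ∈ orderedSector R, Λ ≤ ‖ρ‖ → ∀ g,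
      (boundaryMatrix R Φ N α T k ρ).mulVec g = boundaryVector R β N α T k ρ →
      ∀ ν : Fin (d + 1), ∀ x ∈ Set.Icc α T,
        ‖(Φ (ρ ^ (d + 1)) x).mulVec g ν - (ρ * R k) ^ (ν : ℕ) * Complex.exp (ρ * R k * x) *
          ∑ s ∈ Finset.range (N + 2), β s ν x * (ρ * R k)⁻¹ ^ s‖ ≤
          ε * ‖(ρ * R k) ^ (ν : ℕ) * Complex.exp (ρ * R k * x)‖ / ‖ρ‖ ^ (N + 1) := by
  have hRk := root_ne_zero hroot k
  obtain ⟨Λ, hΛ⟩ := exists_norm_sub_formal_le hαT hp hβ.hasIntegralDeriv hβ.zero_eq_one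
    hβ.recurrence hβ.sum_eq_zero (div_root_injective hinj hroot k) (div_root_pow hroot · k)
    (div_self hRk) hε
  refine ⟨max 1 Λ, fun ρ hρ hρΛ g hg ν x hx => ?_⟩
  have hΛ1 := (le_max_left _ _).trans hρΛ
  have hΛ2 := (le_max_right _ _).trans hρΛ
  have hρ0 : ρ ≠ 0 := norm_pos_iff.1 (by linarith)
  have hμ0 : ρ * R k ≠ 0 := mul_ne_zero hρ0 hRk
  have hμpow : (ρ * R k) ^ (d + 1) = ρ ^ (d + 1) := by rw [mul_pow, hroot, mul_one]
  have hsol := (hΦ (ρ ^ (d + 1)) g).mono hα le_rfl hαT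
  rw [← hμpow] at hsol
  have h := hΛ (ρ * R k) (by rwa [norm_mul_root hroot]) (basePoint α T k) (basePoint_mem hαT k)
    (fun j x hx t ht => re_mul_sub_nonpos hρ hRk j hx ht) _ (hsol.scaled hμ0 hαT) (fun j => by
      have h1 := boundary_sum_eq (N := N) (L := d + N + 1) (by omega) (by omega) hρ0 hRk
        (Rj := R j) ((Φ ((ρ * R k) ^ (d + 1)) (basePoint α T k j)).mulVec g)
        (fun s ν => β s ν (basePoint α T k j)) (basePoint α T k j)
      have h2 := congrFun hg j
      rw [boundaryMatrix_mulVec, ← hμpow, boundaryVector] at h2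
      rw [h2, sub_self] at h1
      exact (mul_eq_zero.1 h1).resolve_left
        (mul_ne_zero (pow_ne_zero _ hρ0) (Complex.exp_ne_zero _))) ν x hx
  have hE : ∀ U b : ℂ, U - (ρ * R k) ^ (ν : ℕ) * Complex.exp (ρ * R k * x) * b =
      (ρ * R k) ^ (ν : ℕ) * Complex.exp (ρ * R k * x) *
        ((ρ * R k)⁻¹ ^ (ν : ℕ) * (Complex.exp (-(ρ * R k) * x) * U) - b) := fun U b => by
    have h1 : (ρ * R k) ^ (ν : ℕ) * (ρ * R k)⁻¹ ^ (ν : ℕ) = 1 := by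
      rw [← mul_pow, mul_inv_cancel₀ hμ0, one_pow]
    have h2 : Complex.exp (ρ * R k * x) * Complex.exp (-(ρ * R k) * x) = 1 := by
      rw [← Complex.exp_add]
      simp
    linear_combination -U * h1 - U * (ρ * R k) ^ (ν : ℕ) * (ρ * R k)⁻¹ ^ (ν : ℕ) * h2
  rw [hμpow] at h
  rw [hE, norm_mul, mul_comm ε, mul_div_assoc]
  gcongr
  refine h.trans_eq ?_
  rw [norm_inv, norm_mul_root hroot, inv_pow, div_eq_mul_inv]

end Boundary

section Coefficients

open Filter Topology Bornology

theorem isClosed_orderedSector {m : ℕ} (R : Fin m → ℂ) : IsClosed (orderedSector R) := by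
  simp only [orderedSector, Set.ofPred_forall]
  exact isClosed_iInter fun j => isClosed_iInter fun l => isClosed_iInter fun _ =>
    isClosed_le (by fun_prop) (by fun_prop)

theorem convex_orderedSector {m : ℕ} (R : Fin m → ℂ) : Convex ℝ (orderedSector R) := by
  intro ρ hρ σ hσ a b ha hb _ j l hjl
  have h1 := mul_le_mul_of_nonneg_left (hρ j l hjl) ha
  have h2 := mul_le_mul_of_nonneg_left (hσ j l hjl) hb
  have h3 : ∀ z : ℂ, ((a • ρ + b • σ) * z).re = a * (ρ * z).re + b * (σ * z).re := fun z => by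
    rw [add_mul, smul_mul_assoc, smul_mul_assoc, Complex.add_re, Complex.smul_re, Complex.smul_re,
      smul_eq_mul, smul_eq_mul]
  rw [h3, h3]
  exact add_le_add h1 h2

/-- `(ρ * R k) ^ ν * exp (ρ * R k * x)` as a function of `(ν, x)`. -/
noncomputable def leadingTerm {d : ℕ} (R : Fin (d + 1) → ℂ) {α T : ℝ} (ρ : ℂ) (k : Fin (d + 1))
    (i : Fin (d + 1) × Set.Icc α T) : ℂ :=
  (ρ * R k) ^ (i.1 : ℕ) * Complex.exp (ρ * R k * (i.2 : ℝ))

/-- The partial sum `∑ s < N + 2, β s ν x * (ρ * R k)⁻¹ ^ s` as a function of `(ν, x)`. -/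
noncomputable def formalFactor {d : ℕ} (R : Fin (d + 1) → ℂ) (β : ℕ → Fin (d + 1) → ℝ → ℂ) (N : ℕ)
    {α T : ℝ} (ρ : ℂ) (k : Fin (d + 1)) (i : Fin (d + 1) × Set.Icc α T) : ℂ :=
  ∑ s ∈ Finset.range (N + 2), β s i.1 i.2 * (ρ * R k)⁻¹ ^ s

variable {d N : ℕ} {α T : ℝ} {R : Fin (d + 1) → ℂ} {p : Fin d → ℝ → ℂ}
  {β dβ : ℕ → Fin (d + 1) → ℝ → ℂ} {Φ : ℂ → ℝ → Matrix (Fin (d + 1)) (Fin (d + 1)) ℂ}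

theorem norm_leadingTerm_le (hα : 0 ≤ α) (hroot : ∀ j, R j ^ (d + 1) = 1) {ρ : ℂ}
    (hρ : ρ ∈ orderedSector R) {j k : Fin (d + 1)} (hjk : j ≤ k) (i : Fin (d + 1) × Set.Icc α T) :
    ‖leadingTerm R ρ j i‖ ≤ ‖leadingTerm R ρ k i‖ := by
  have hx : 0 ≤ (i.2 : ℝ) := hα.trans i.2.2.1
  rw [leadingTerm, leadingTerm, norm_mul, norm_mul, norm_pow, norm_pow, norm_mul_root hroot,
    norm_mul_root hroot, Complex.norm_exp, Complex.norm_exp, Complex.re_mul_ofReal,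
    Complex.re_mul_ofReal]
  gcongr ‖ρ‖ ^ _ * Real.exp (?_ * _)
  exact hρ j k hjk

theorem IsFormalSolution.exists_norm_formalFactor_le (hαT : α ≤ T)
    (hβ : IsFormalSolution N p β dβ α T) (hroot : ∀ j, R j ^ (d + 1) = 1) :
    ∃ C : ℝ, ∀ ρ : ℂ, 1 ≤ ‖ρ‖ → ∀ k, ∀ i : Fin (d + 1) × Set.Icc α T,
      ‖formalFactor R β N ρ k i‖ ≤ C := by
  have h1 : ∀ q : Fin (N + 2) × Fin (d + 1), ∃ C, ∀ t ∈ Set.Icc α T, ‖β q.1 q.2 t‖ ≤ C :=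
    fun q => isCompact_Icc.exists_bound_of_continuousOn
      ((hβ.hasIntegralDeriv q.1 q.1.2 q.2).continuousOn hαT)
  choose C hC using h1
  refine ⟨∑ s : Fin (N + 2), ∑ ν, |C (s, ν)|, fun ρ hρ k i => ?_⟩
  rw [formalFactor, ← Fin.sum_univ_eq_sum_range fun s => β s i.1 i.2 * (ρ * R k)⁻¹ ^ s]
  refine (norm_sum_le _ _).trans (Finset.sum_le_sum fun s _ => ?_)
  have h2 : ‖(ρ * R k)⁻¹ ^ (s : ℕ)‖ ≤ 1 := by
    rw [norm_pow, norm_inv, norm_mul_root hroot]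
    exact pow_le_one₀ (by positivity) (inv_le_one_of_one_le₀ hρ)
  rw [norm_mul]
  refine (mul_le_of_le_one_right (norm_nonneg _) h2).trans ?_
  exact ((hC (s, i.1) i.2 i.2.2).trans (le_abs_self _)).trans
    (Finset.single_le_sum (f := fun ν => |C (s, ν)|) (fun _ _ => abs_nonneg _) (Finset.mem_univ _))

theorem IsFormalSolution.tendsto_formalFactor (hβ : IsFormalSolution N p β dβ α T)
    {l : Filter ℂ} (hl : l ≤ cobounded ℂ) (k : Fin (d + 1))
    (i : Fin (d + 1) × Set.Icc α T) :
    Tendsto (fun ρ => formalFactor R β N ρ k i) l (𝓝 1) := by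
  have h1 : Tendsto (fun ρ : ℂ => (ρ * R k)⁻¹) l (𝓝 0) := by
    have h2 := ((tendsto_inv₀_cobounded (α := ℂ)).mono_left hl).mul_const (R k)⁻¹
    simpa [mul_comm] using h2
  have h2 : Tendsto (fun ρ : ℂ => ∑ s ∈ Finset.range (N + 1), β (s + 1) i.1 i.2 *
      (ρ * R k)⁻¹ ^ (s + 1) + 1) l (𝓝 (∑ s ∈ Finset.range (N + 1), β (s + 1) i.1 i.2 *
      0 ^ (s + 1) + 1)) :=
    (tendsto_finsetSum _ fun s _ => (h1.pow (s + 1)).const_mul _).add_const 1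
  refine (h2.congr fun ρ => ?_).trans (by simp)
  rw [formalFactor, Finset.sum_range_succ' _ (N + 1), hβ.zero_eq_one]
  simp

variable (hα : 0 ≤ α) (hαT : α ≤ T)

include hα hαT

theorem differentiable_boundaryMatrix
    (hΦd : ∀ x ∈ Set.Icc 0 T, ∀ i j, Differentiable ℂ fun c => Φ c x i j) (k i j : Fin (d + 1)) :
    Differentiable ℂ fun ρ => boundaryMatrix R Φ N α T k ρ i j := by
  have hmem : basePoint α T k i ∈ Set.Icc 0 T :=
    ⟨hα.trans (basePoint_mem hαT k i).1, (basePoint_mem hαT k i).2⟩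
  simp only [boundaryMatrix, Matrix.of_apply]
  refine Differentiable.fun_sum fun ν _ => ?_
  have h1 : Differentiable ℂ fun ρ : ℂ => Φ (ρ ^ (d + 1)) (basePoint α T k i) ν j :=
    (hΦd _ hmem ν j).comp (differentiable_id.pow (d + 1))
  fun_prop

omit hα hαT in
theorem differentiable_boundaryVector (k j : Fin (d + 1)) :
    Differentiable ℂ fun ρ => boundaryVector R β N α T k ρ j := by
  unfold boundaryVector
  fun_prop

variable (hp : ∀ m, IntervalIntegrable (p m) volume α T)
  (hΦ : ∀ c g, IsCompanionSolution p c (fun ν x => (Φ c x).mulVec g ν) 0 T)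
  (hΦ0 : ∀ c, ∀ x ∈ Set.Icc 0 T, (Φ c x).det ≠ 0)
  (hΦd : ∀ x ∈ Set.Icc 0 T, ∀ i j, Differentiable ℂ fun c => Φ c x i j)
  (hinj : Function.Injective R) (hroot : ∀ j, R j ^ (d + 1) = 1)
  (hβ : IsFormalSolution N p β dβ α T) [(cobounded ℂ ⊓ 𝓟 (orderedSector R)).NeBot]

include hp hΦ hΦ0 hΦd hinj hroot hβ

theorem exists_analytic_coefficients {ω : ℂ} (hω : ω ≠ 0)
    (hK : ∀ ρ ∈ orderedSector R, 0 ≤ (ω * ρ).re) (k : Fin (d + 1)) :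
    ∃ g : ℂ → Fin (d + 1) → ℂ, (∀ i, AnalyticOnNhd ℂ (fun ρ => g ρ i) (orderedSector R)) ∧
      ∀ ε > 0, ∀ᶠ ρ in cobounded ℂ ⊓ 𝓟 (orderedSector R), ∀ i : Fin (d + 1) × Set.Icc α T,
        ‖(Φ (ρ ^ (d + 1)) i.2).mulVec (g ρ) i.1 - leadingTerm R ρ k i * formalFactor R β N ρ k i‖ ≤
          ε * ‖leadingTerm R ρ k i‖ / ‖ρ‖ ^ (N + 1) := by
  set K := orderedSector R with hKdef
  set l := cobounded ℂ ⊓ 𝓟 K with hl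
  have hlc : l ≤ cobounded ℂ := inf_le_left
  have hlK : ∀ᶠ ρ in l, ρ ∈ K := mem_inf_of_right (mem_principal_self K)
  have hnorm : ∀ r : ℝ, ∀ᶠ ρ in l, r ≤ ‖ρ‖ := fun r =>
    hlc (tendsto_norm_cobounded_atTop.eventually_ge_atTop r)
  set A := boundaryMatrix R Φ N α T k with hA
  set r := boundaryVector R β N α T k with hr
  have hAd : ∀ i j, Differentiable ℂ fun ρ => A ρ i j :=
    differentiable_boundaryMatrix hα hαT hΦd k
  have hdet : Differentiable ℂ fun ρ => (A ρ).det := by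
    simp only [Matrix.det_apply]
    refine Differentiable.fun_sum fun σ _ => Differentiable.const_smul ?_ _
    exact Differentiable.fun_finsetProd fun i _ => hAd _ _
  have hadj : ∀ i j, Differentiable ℂ fun ρ => (A ρ).adjugate i j := fun i j => by
    simp only [Matrix.adjugate_apply, Matrix.det_apply]
    refine Differentiable.fun_sum fun σ _ => Differentiable.const_smul ?_ _
    refine Differentiable.fun_finsetProd fun m _ => ?_
    simp only [Matrix.updateRow_apply]
    split_ifs
    · fun_prop
    · exact hAd _ _
  have hcol : ∀ i, Differentiable ℂ fun ρ => (A ρ).adjugate.mulVec (r ρ) i := fun i => by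
    simp only [Matrix.mulVec, dotProduct]
    exact Differentiable.fun_sum fun j _ => (hadj i j).mul (differentiable_boundaryVector k j)
  obtain ⟨Λ, hΛ⟩ := exists_det_boundaryMatrix_ne_zero hα hαT hp hΦ hinj hroot hΦ0 N k
  have hdet0 : ∀ᶠ ρ in l, (A ρ).det ≠ 0 := by
    filter_upwards [hlK, hnorm Λ] with ρ h1 h2 using hΛ ρ h1 h2
  obtain ⟨H, U, hH, hH0, hHU, -, hUO⟩ := exists_upperTriangular_det_ne_zero
    (isClosed_orderedSector R) (convex_orderedSector R).isPreconnected hω hK (M := N + 2)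
    (by omega) (m := 1) (G := fun ρ => Matrix.of fun _ _ => (A ρ).det)
    (fun i j ρ _ => hdet.analyticAt ρ) (by simpa using hdet0)
  have hH00 : ∀ ρ ∈ K, H ρ 0 0 ≠ 0 := fun ρ hρ => by simpa using hH0 ρ hρ
  have hHU0 : ∀ᶠ ρ in l, H ρ 0 0 = (A ρ).det * U ρ 0 0 := by
    filter_upwards [hHU] with ρ h
    rw [h]
    simp [Matrix.mul_apply]
  have hUO' : (fun ρ => U ρ 0 0 - 1) =O[l] fun ρ => (ρ ^ (N + 2))⁻¹ := by simpa using hUO 0 0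
  have hpow0 : Tendsto (fun ρ : ℂ => (ρ ^ (N + 2))⁻¹) l (𝓝 0) := by
    have h1 := ((tendsto_inv₀_cobounded (α := ℂ)).mono_left hlc).pow (N + 2)
    simpa [inv_pow] using h1
  have hU1 : Tendsto (fun ρ => U ρ 0 0) l (𝓝 1) := by
    have h1 := (hUO'.trans_tendsto hpow0).add_const 1
    simpa using h1
  have hU0 : ∀ᶠ ρ in l, U ρ 0 0 ≠ 0 := hU1.eventually_ne one_ne_zero
  have hUinvO : (fun ρ => (U ρ 0 0)⁻¹ - 1) =O[l] fun ρ => (ρ ^ (N + 2))⁻¹ := by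
    have h1 := hUO'.neg_left.mul ((hU1.inv₀ one_ne_zero).isBigO_one ℂ)
    refine (h1.congr' ?_ ?_)
    · filter_upwards [hU0] with ρ h
      field_simp
      ring
    · exact .of_forall fun ρ => mul_one _
  refine ⟨fun ρ => (H ρ 0 0)⁻¹ • (A ρ).adjugate.mulVec (r ρ), fun i ρ hρ => ?_, ?_⟩
  · exact ((hH 0 0 ρ hρ).fun_inv (hH00 ρ hρ)).fun_mul ((hcol i).analyticAt ρ)
  obtain ⟨C, hC⟩ := hβ.exists_norm_formalFactor_le hαT hroot
  have hmain := asymptotics_mul_upperTriangular (m := 1) (N := N) hlc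
    (I := Fin (d + 1) × Set.Icc α T) (E := fun ρ _ i => leadingTerm R ρ k i)
    (b := fun ρ _ i => formalFactor R β N ρ k i)
    (y := fun ρ _ i => (Φ (ρ ^ (d + 1)) i.2).mulVec
      ((A ρ).det⁻¹ • (A ρ).adjugate.mulVec (r ρ)) i.1)
    (y' := fun ρ _ i => (Φ (ρ ^ (d + 1)) i.2).mulVec
      ((H ρ 0 0)⁻¹ • (A ρ).adjugate.mulVec (r ρ)) i.1)
    (V := fun ρ => Matrix.of fun _ _ => (U ρ 0 0)⁻¹)
    (.of_forall fun _ _ _ _ _ => le_rfl) (C := C)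
    (by filter_upwards [hnorm 1] with ρ h _ i using hC ρ h k i)
    (fun ε hε => by
      obtain ⟨Λ', hΛ'⟩ := exists_norm_mulVec_sub_le hα hαT hp hΦ hinj hroot hβ k hε
      filter_upwards [hlK, hnorm Λ', hdet0] with ρ h1 h2 h3 _ i
      refine hΛ' ρ h1 h2 _ ?_ i.1 i.2 i.2.2
      rw [Matrix.mulVec_smul, Matrix.mulVec_mulVec, ← hA, Matrix.mul_adjugate, Matrix.smul_mulVec,
        Matrix.one_mulVec, smul_smul, inv_mul_cancel₀ h3, one_smul])
    (.of_forall fun _ j k h => absurd h (by simp [Subsingleton.elim j k]))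
    (fun i j => by simpa [Subsingleton.elim i j] using hUinvO)
    (by
      filter_upwards [hHU0] with ρ h _ i
      simp only [Fin.sum_univ_one, Matrix.of_apply, Matrix.mulVec_smul, Pi.smul_apply, smul_eq_mul]
      rw [h, mul_inv]
      ring)
  intro ε hε
  filter_upwards [hmain ε hε] with ρ h i using h 0 i

theorem exists_coefficient_matrix {ω : ℂ} (hω : ω ≠ 0)
    (hK : ∀ ρ ∈ orderedSector R, 0 ≤ (ω * ρ).re) :
    ∃ G : ℂ → Matrix (Fin (d + 1)) (Fin (d + 1)) ℂ,
      (∀ i j, AnalyticOnNhd ℂ (fun ρ => G ρ i j) (orderedSector R)) ∧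
      (∀ ρ ∈ orderedSector R, (G ρ).det ≠ 0) ∧
      ∀ ε > 0, ∀ᶠ ρ in cobounded ℂ ⊓ 𝓟 (orderedSector R), ∀ k,
        ∀ i : Fin (d + 1) × Set.Icc α T,
        ‖(Φ (ρ ^ (d + 1)) i.2 * G ρ) i.1 k - leadingTerm R ρ k i * formalFactor R β N ρ k i‖ ≤
          ε * ‖leadingTerm R ρ k i‖ / ‖ρ‖ ^ (N + 1) := by
  have hcol := exists_analytic_coefficients hα hαT hp hΦ hΦ0 hΦd hinj hroot hβ hω hK
  choose g hg hgas using hcol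
  set K := orderedSector R with hKdef
  set l := cobounded ℂ ⊓ 𝓟 K with hl
  have hlc : l ≤ cobounded ℂ := inf_le_left
  have hlK : ∀ᶠ ρ in l, ρ ∈ K := mem_inf_of_right (mem_principal_self K)
  have hnorm : ∀ r : ℝ, ∀ᶠ ρ in l, r ≤ ‖ρ‖ := fun r =>
    hlc (tendsto_norm_cobounded_atTop.eventually_ge_atTop r)
  set G : ℂ → Matrix (Fin (d + 1)) (Fin (d + 1)) ℂ := fun ρ => Matrix.of fun i k => g k ρ i with hG
  have hGas : ∀ ε > 0, ∀ᶠ ρ in l, ∀ k, ∀ i : Fin (d + 1) × Set.Icc α T,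
      ‖(Φ (ρ ^ (d + 1)) i.2 * G ρ) i.1 k - leadingTerm R ρ k i * formalFactor R β N ρ k i‖ ≤
        ε * ‖leadingTerm R ρ k i‖ / ‖ρ‖ ^ (N + 1) := fun ε hε => by
    filter_upwards [eventually_all.2 fun k => hgas k ε hε] with ρ h k i using h k i
  set W : ℂ → Matrix (Fin (d + 1)) (Fin (d + 1)) ℂ := fun ρ =>
    Matrix.diagonal (fun ν : Fin (d + 1) => ρ⁻¹ ^ (ν : ℕ)) * (Φ (ρ ^ (d + 1)) α * G ρ) *
      Matrix.diagonal fun k => Complex.exp (-(ρ * R k * α)) with hW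
  have hWlim : Tendsto W l (𝓝 (Matrix.vandermonde R).transpose) := by
    refine tendsto_pi_nhds.2 fun ν => tendsto_pi_nhds.2 fun k => ?_
    set i : Fin (d + 1) × Set.Icc α T := (ν, ⟨α, left_mem_Icc.2 hαT⟩) with hi
    have h1 : Tendsto (fun ρ => R k ^ (ν : ℕ) * formalFactor R β N ρ k i) l
        (𝓝 (R k ^ (ν : ℕ) * 1)) :=
      (hβ.tendsto_formalFactor hlc k i).const_mul _
    have h2 : Tendsto (fun ρ => W ρ ν k - R k ^ (ν : ℕ) * formalFactor R β N ρ k i) l (𝓝 0) := by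
      rw [Metric.tendsto_nhds]
      intro ε hε
      filter_upwards [hGas (ε / 2) (half_pos hε), hnorm 1] with ρ h hρ
      have hρ0 : ρ ≠ 0 := norm_pos_iff.1 (by linarith)
      have h3 : ρ⁻¹ ^ (ν : ℕ) * ρ ^ (ν : ℕ) = 1 := by
        rw [← mul_pow, inv_mul_cancel₀ hρ0, one_pow]
      have h4 : Complex.exp (ρ * R k * α) * Complex.exp (-(ρ * R k * α)) = 1 := by
        rw [← Complex.exp_add]
        simp
      have h5 : W ρ ν k - R k ^ (ν : ℕ) * formalFactor R β N ρ k i =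
          ρ⁻¹ ^ (ν : ℕ) * Complex.exp (-(ρ * R k * α)) *
          ((Φ (ρ ^ (d + 1)) i.2 * G ρ) i.1 k - leadingTerm R ρ k i * formalFactor R β N ρ k i) := by
        simp only [hW, Matrix.mul_diagonal, Matrix.diagonal_mul, leadingTerm, hi, mul_pow]
        linear_combination R k ^ (ν : ℕ) * formalFactor R β N ρ k i *
          (Complex.exp (ρ * R k * α) * Complex.exp (-(ρ * R k * α)) * h3 + h4)
      have h6 : ‖ρ⁻¹ ^ (ν : ℕ) * Complex.exp (-(ρ * R k * α))‖ * ‖leadingTerm R ρ k i‖ = 1 := by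
        rw [← norm_mul, leadingTerm, mul_pow]
        have h7 : ρ⁻¹ ^ (ν : ℕ) * Complex.exp (-(ρ * R k * α)) *
            (ρ ^ (ν : ℕ) * R k ^ (ν : ℕ) * Complex.exp (ρ * R k * α)) = R k ^ (ν : ℕ) := by
          linear_combination R k ^ (ν : ℕ) *
            (Complex.exp (ρ * R k * α) * Complex.exp (-(ρ * R k * α)) * h3 + h4)
        simp only [hi]
        rw [h7, norm_pow, norm_root_eq_one hroot, one_pow]
      rw [dist_zero_right, h5, norm_mul]
      calc _ ≤ ‖ρ⁻¹ ^ (ν : ℕ) * Complex.exp (-(ρ * R k * α))‖ *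
            (ε / 2 * ‖leadingTerm R ρ k i‖ / ‖ρ‖ ^ (N + 1)) := by gcongr; exact h k i
        _ = ε / 2 / ‖ρ‖ ^ (N + 1) := by linear_combination (ε / 2 / ‖ρ‖ ^ (N + 1)) * h6
        _ ≤ ε / 2 := div_le_self (by positivity) (one_le_pow₀ hρ)
        _ < ε := half_lt_self hε
    have h3 := h2.add h1
    simpa using h3
  have hdetG : ∀ᶠ ρ in l, (G ρ).det ≠ 0 := by
    have h1 : Tendsto (fun ρ => (W ρ).det) l (𝓝 (Matrix.vandermonde R).transpose.det) :=
      ((continuous_id.matrix_det).tendsto _).comp hWlim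
    have h2 : (Matrix.vandermonde R).transpose.det ≠ 0 := by
      rw [Matrix.det_transpose]
      exact Matrix.det_vandermonde_ne_zero_iff.2 hinj
    filter_upwards [h1.eventually_ne h2] with ρ h h3
    refine h ?_
    rw [hW]
    simp [Matrix.det_mul, h3]
  obtain ⟨H, U, hH, hH0, hHU, hUt, hUO⟩ := exists_upperTriangular_det_ne_zero
    (isClosed_orderedSector R) (convex_orderedSector R).isPreconnected hω hK (M := N + 2)
    (by omega) (G := G) (fun i j => hg j i) hdetG
  obtain ⟨C, hC⟩ := hβ.exists_norm_formalFactor_le hαT hroot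
  refine ⟨H, hH, hH0, asymptotics_mul_upperTriangular (N := N) hlc
    (I := Fin (d + 1) × Set.Icc α T) (E := fun ρ k i => leadingTerm R ρ k i)
    (b := fun ρ k i => formalFactor R β N ρ k i)
    (y := fun ρ k i => (Φ (ρ ^ (d + 1)) i.2 * G ρ) i.1 k)
    (y' := fun ρ k i => (Φ (ρ ^ (d + 1)) i.2 * H ρ) i.1 k) (V := U) ?_ (C := C) ?_ hGas
    (.of_forall fun ρ j k h => hUt ρ j k h) hUO ?_⟩
  · filter_upwards [hlK] with ρ h j k hjk i using norm_leadingTerm_le hα hroot h hjk i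
  · filter_upwards [hnorm 1] with ρ h k i using hC ρ h k i
  · filter_upwards [hHU] with ρ h k i
    rw [h, ← Matrix.mul_assoc, Matrix.mul_apply]

end Coefficients

open Filter Topology Bornology in
theorem neBot_cobounded_inf_orderedSector {m : ℕ} {R : Fin m → ℂ} {ρ : ℂ} (hρ0 : ρ ≠ 0)
    (hρ : ρ ∈ orderedSector R) : (cobounded ℂ ⊓ 𝓟 (orderedSector R)).NeBot := by
  have h1 : Tendsto (fun t : ℝ => (t : ℂ) * ρ) atTop (cobounded ℂ ⊓ 𝓟 (orderedSector R)) := by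
    refine tendsto_inf.2 ⟨?_, tendsto_principal.2 ?_⟩
    · rw [← tendsto_norm_atTop_iff_cobounded]
      have h2 : Tendsto (fun t : ℝ => |t| * ‖ρ‖) atTop atTop :=
        tendsto_abs_atTop_atTop.atTop_mul_const (norm_pos_iff.2 hρ0)
      simpa using h2
    · filter_upwards [eventually_ge_atTop 0] with t ht j l hjl
      rw [mul_assoc, mul_assoc, Complex.re_ofReal_mul, Complex.re_ofReal_mul]
      exact mul_le_mul_of_nonneg_left (hρ j l hjl) ht
  exact h1.neBot

theorem isFormalSolution_betaNu {d N : ℕ} {p : Fin d → ℝ → ℂ} {B : ℕ → ℕ → ℝ → ℂ} {a b : ℝ}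
    (h0 : B 0 0 = fun _ => 1) (h0' : ∀ r, 1 ≤ r → B 0 r = fun _ => 0)
    (hB : ∀ s ≤ N + 1, IsDerivTower (N + 2 - s) (B s) a b)
    (hrec : ∀ s, 1 ≤ s → s ≤ N + 1 → B s 1 = betaDeriv p B s) :
    IsFormalSolution N p (fun s ν => betaNu B s ν) (fun s ν => betaNuDeriv B s ν) a b where
  hasIntegralDeriv s hs ν := hasIntegralDeriv_betaNu hB hs ν
  zero_eq_one ν x := betaNu_zero_left h0 ν x
  recurrence s hs ν := .of_forall fun t => by
    rw [← betaNu_succ_succ]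
    by_cases hν : ν = Fin.last d
    · rw [if_pos hν, hν, Fin.last_add_one]
      exact (betaNu_recurrence h0' hrec (by omega) t).symm
    · rw [if_neg hν, add_zero, Fin.val_add_one_of_lt (Fin.lt_last_iff_ne_last.2 hν)]
  sum_eq_zero := .of_forall fun t => by
    rw [Fin.sum_univ_eq_sum_range fun ν => betaNuDeriv B (N + 1) ν t, sum_betaNuDeriv]
    have h := betaNu_recurrence h0' hrec le_rfl t
    simp only [Fin.val_castSucc]
    linear_combination h

theorem IsCompanionSolution.isSolutionODE {d : ℕ} {T : ℝ} (hT : 0 ≤ T) {p : Fin d → ℝ → ℂ} {ρ : ℂ}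
    {U : Fin (d + 1) → ℝ → ℂ} (h : IsCompanionSolution p (ρ ^ (d + 1)) U 0 T) :
    IsSolutionODE (d + 1) T p ρ fun ν x => if hν : ν < d + 1 then U ⟨ν, hν⟩ x else
      ρ ^ (d + 1) * U 0 x - ∑ m : Fin d, p m x * U m.castSucc x := by
  have hlast := h (Fin.last d)
  simp only [if_true, Fin.last_add_one] at hlast
  refine ⟨fun ν hν x hx => ?_, ?_, fun x hx => ?_, .of_forall fun x => ?_⟩
  · have hν' : ν < d := by simpa using hν
    simp only [dif_pos (show ν < d + 1 by omega), dif_pos (show ν + 1 < d + 1 by omega)]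
    set i : Fin (d + 1) := ⟨ν, by omega⟩ with hi
    have hne : i ≠ Fin.last d := fun h => by
      rw [Fin.ext_iff, Fin.val_last] at h
      simp only [hi] at h
      omega
    have hsucc : i + 1 = ⟨ν + 1, by omega⟩ :=
      Fin.ext (Fin.val_add_one_of_lt (Fin.lt_last_iff_ne_last.2 hne))
    have hU := h i
    simp only [if_neg hne, one_mul, sub_zero, hsucc] at hU
    have hc := (h ⟨ν + 1, by omega⟩).continuousOn hT
    have := Fact.mk hx
    have hd := intervalIntegral.integral_hasDerivWithinAt_right (s := Set.Icc 0 T)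
      (t := Set.Icc 0 T) (hU.integrable_sub (left_mem_Icc.2 hT) hx)
      (hc.stronglyMeasurableAtFilter_nhdsWithin measurableSet_Icc x) (hc x hx)
    exact (hd.const_add (U i 0)).congr (fun y hy => hU.eq y hy) (hU.eq x hx)
  · simpa using hlast.integrable
  · simpa [Fin.last] using hlast.eq x hx
  · simp [Fin.castSucc, Fin.castAdd, Fin.castLE]

theorem one_add_sum_div_eq (b : ℕ → ℂ) (h0 : b 0 = 1) (N : ℕ) (μ : ℂ) :
    1 + ∑ s ∈ Finset.Icc 1 (N + 1), b s / μ ^ s = ∑ s ∈ Finset.range (N + 2), b s * μ⁻¹ ^ s := by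
  have h1 : Finset.Icc 1 (N + 1) = Finset.Ico 1 (N + 2) := by
    ext
    simp only [Finset.mem_Icc, Finset.mem_Ico]
    omega
  rw [h1, Finset.range_eq_Ico,
    Finset.sum_eq_sum_Ico_succ_bot (by omega) fun s => b s * μ⁻¹ ^ s, h0]
  simp [div_eq_mul_inv]

open Filter Topology Bornology in
theorem exists_fundamental_system {d N : ℕ} {T α : ℝ} (hα : 0 ≤ α) (hαT : α ≤ T)
    {R : Fin (d + 1) → ℂ} (hinj : Function.Injective R) (hroot : ∀ j, R j ^ (d + 1) = 1)
    {p : Fin d → ℝ → ℂ} (hp : ∀ m, IntervalIntegrable (p m) volume 0 T)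
    {β dβ : ℕ → Fin (d + 1) → ℝ → ℂ} (hβ : IsFormalSolution N p β dβ α T)
    [(cobounded ℂ ⊓ 𝓟 (orderedSector R)).NeBot] {ω : ℂ} (hω : ω ≠ 0)
    (hK : ∀ ρ ∈ orderedSector R, 0 ≤ (ω * ρ).re) :
    ∃ Y : Fin (d + 1) → ℂ → ℕ → ℝ → ℂ,
      (∀ k, ∀ ρ, IsSolutionODE (d + 1) T p ρ (Y k ρ)) ∧
      (∀ ρ ∈ orderedSector R, ∀ x ∈ Set.Icc (0 : ℝ) T,
        (Matrix.of fun ν k : Fin (d + 1) => Y k ρ (ν : ℕ) x).det ≠ 0) ∧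
      (∀ k, ∀ ν < d + 1, ContinuousOn (fun q : ℝ × ℂ => Y k q.2 ν q.1)
        (Set.Icc (0 : ℝ) T ×ˢ orderedSector R)) ∧
      (∀ k, ∀ ν < d + 1, ∀ x ∈ Set.Icc (0 : ℝ) T,
        AnalyticOnNhd ℂ (fun ρ => Y k ρ ν x) (orderedSector R)) ∧
      ∀ ε > (0 : ℝ), ∃ ρ₀ : ℝ, ∀ ρ ∈ orderedSector R, ρ₀ ≤ ‖ρ‖ →
        ∀ k, ∀ ν : Fin (d + 1), ∀ x ∈ Set.Icc α T,
          ‖Y k ρ ν x - (ρ * R k) ^ (ν : ℕ) * Complex.exp (ρ * R k * x) *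
            ∑ s ∈ Finset.range (N + 2), β s ν x * (ρ * R k)⁻¹ ^ s‖ ≤
          ε * ‖(ρ * R k) ^ (ν : ℕ) * Complex.exp (ρ * R k * x)‖ / ‖ρ‖ ^ (N + 1) := by
  have hT : 0 ≤ T := hα.trans hαT
  obtain ⟨Φ, hΦ, hΦ0, hΦc, hΦd⟩ := exists_companion_fundamental_matrix hT hp
  have hpα : ∀ m, IntervalIntegrable (p m) volume α T := fun m => (hp m).mono_set (by
    rw [Set.uIcc_of_le hαT, Set.uIcc_of_le hT]
    exact Set.Icc_subset_Icc_left hα)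
  obtain ⟨G, hG, hG0, hGas⟩ :=
    exists_coefficient_matrix hα hαT hpα hΦ hΦ0 hΦd hinj hroot hβ hω hK
  refine ⟨fun k ρ ν x => if hν : ν < d + 1 then
    (Φ (ρ ^ (d + 1)) x).mulVec (fun i => G ρ i k) ⟨ν, hν⟩ else
      ρ ^ (d + 1) * (Φ (ρ ^ (d + 1)) x).mulVec (fun i => G ρ i k) 0 -
        ∑ m : Fin d, p m x * (Φ (ρ ^ (d + 1)) x).mulVec (fun i => G ρ i k) m.castSucc,
    fun k ρ => (hΦ _ _).isSolutionODE hT, fun ρ hρ x hx => ?_, fun k ν hν => ?_,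
    fun k ν hν x hx => ?_, fun ε hε => ?_⟩
  · have h1 : (Matrix.of fun ν k : Fin (d + 1) => if hν : (ν : ℕ) < d + 1 then
        (Φ (ρ ^ (d + 1)) x).mulVec (fun i => G ρ i k) ⟨ν, hν⟩ else
        ρ ^ (d + 1) * (Φ (ρ ^ (d + 1)) x).mulVec (fun i => G ρ i k) 0 -
        ∑ m : Fin d, p m x * (Φ (ρ ^ (d + 1)) x).mulVec (fun i => G ρ i k) m.castSucc) =
        Φ (ρ ^ (d + 1)) x * G ρ := by
      ext ν k
      rw [Matrix.of_apply, dif_pos ν.2]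
      rfl
    rw [h1, Matrix.det_mul]
    exact mul_ne_zero (hΦ0 _ x hx) (hG0 ρ hρ)
  · simp only [dif_pos hν, Matrix.mulVec, dotProduct]
    refine continuousOn_finsetSum _ fun i _ => ContinuousOn.mul ?_ ?_
    · exact (hΦc ⟨ν, hν⟩ i).comp (f := fun q : ℝ × ℂ => (q.1, q.2 ^ (d + 1)))
        (by fun_prop) fun q hq => ⟨hq.1, Set.mem_univ _⟩
    · exact (hG i k).continuousOn.comp continuousOn_snd fun q hq => hq.2
  · simp only [dif_pos hν, Matrix.mulVec, dotProduct]
    intro ρ hρ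
    refine Finset.analyticAt_fun_sum _ fun i _ => AnalyticAt.fun_mul ?_ (hG i k ρ hρ)
    have h1 : Differentiable ℂ fun ρ : ℂ => Φ (ρ ^ (d + 1)) x ⟨ν, hν⟩ i :=
      (hΦd x hx ⟨ν, hν⟩ i).comp (differentiable_id.pow (d + 1))
    exact h1.analyticAt ρ
  · obtain ⟨ρ₀, -, h⟩ := hasBasis_cobounded_norm.eventually_iff.1
      (eventually_inf_principal.1 (hGas ε hε))
    refine ⟨ρ₀, fun ρ hρ hρ0 k ν x hx => ?_⟩
    simp only [dif_pos ν.2]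
    exact h hρ0 hρ k (ν, ⟨x, hx⟩)

/-- Theorem 1.2.  Under the smoothness assumptions
`p_m ∈ W_{N+m−n+2}[α,T]` there are functions `β_s` (represented by the derivative tower
`B s r = β_s^{(r)}`, `β_s ∈ W_{N−s+2}[α,T]`, `β_0 ≡ 1`, `β_s(α) = 0` and recurrence
(1.20)) and a fundamental system of solutions `y_k` of (1.1) for `ρ ∈ S̄`, `|ρ| ≥ ρ_α`,
whose derivatives are jointly continuous, analytic in `ρ` on `{ρ ∈ S : |ρ| > ρ_α}`, and
satisfy, uniformly in `x ∈ [α,T]`,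
`y_k^{(ν)}(x,ρ) = (ρR_k)^ν e^{ρR_k x}(1 + Σ_{s=1}^{N+1} β_{sν}(x)/(ρR_k)^s + o(1/ρ^{N+1}))`. -/
theorem birkhoff_fss_higher_order (n : ℕ) (hn : 2 ≤ n) (T α : ℝ) (hT : 0 < T)
    (hα : α ∈ Set.Ico 0 T) (N : ℕ)
    (R : Fin n → ℂ) (hinj : Function.Injective R) (hroot : ∀ j, R j ^ n = 1)
    (p : Fin (n - 1) → ℝ → ℂ)
    (hp : ∀ m, IntervalIntegrable (p m) volume 0 T)
    (hpW : ∀ m : Fin (n - 1), MemW (N + (m : ℕ) + 2 - n) (p m) α T)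
    (S : Set ℂ) (hS : IsOpen S)
    (hord : ∀ ρ ∈ S, ∀ k l : Fin n, k < l → (ρ * R k).re < (ρ * R l).re) :
    ∃ B : ℕ → ℕ → ℝ → ℂ,
      -- `β_0 ≡ 1` (and its derivatives vanish)
      (B 0 0 = fun _ => 1) ∧ (∀ r, 1 ≤ r → B 0 r = fun _ => 0) ∧
      -- `β_s ∈ W_{N−s+2}[α,T]`, with `B s` as its derivative tower
      (∀ s ≤ N + 1,
        (∀ r ≤ N + 2 - s, IntervalIntegrable (B s r) volume α T) ∧
        (∀ r < N + 2 - s, ∀ x ∈ Set.Icc α T,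
            B s r x = B s r α + ∫ t in α..x, B s (r + 1) t)) ∧
      -- normalization `β_s(α) = 0` for `s ≥ 1`
      (∀ s, 1 ≤ s → s ≤ N + 1 → B s 0 α = 0) ∧
      -- the recurrence (1.20):
      -- `β_s' = −(1/n)(Σ_{r=2}^n C(n,r) β_{s+1−r}^{(r)} + Σ_{m=0}^{n−2} p_m β_{s−n+m+1,m})`
      (∀ s, 1 ≤ s → s ≤ N + 1 → ∀ᵐ x ∂(volume.restrict (Set.Icc α T)),
        B s 1 x = -(1 / (n : ℂ)) *
          ((∑ r ∈ Finset.Icc 2 n, (n.choose r : ℂ) *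
              (if r ≤ s + 1 then B (s + 1 - r) r x else 0)) +
            ∑ m : Fin (n - 1), p m x *
              (if n ≤ s + (m : ℕ) + 1 then betaNu B (s + (m : ℕ) + 1 - n) (m : ℕ) x
               else 0))) ∧
    ∃ Y : Fin n → ℂ → ℕ → ℝ → ℂ,
      -- each `y_k(·,ρ)` is a solution of (1.1)
      (∀ k : Fin n, ∀ ρ ∈ closure S, rhoAlpha n T α p ≤ ‖ρ‖ →
          IsSolutionODE n T p ρ (Y k ρ)) ∧
      -- fundamental system: the Wronskian does not vanish
      (∀ ρ ∈ closure S, rhoAlpha n T α p ≤ ‖ρ‖ → ∀ x ∈ Set.Icc (0 : ℝ) T,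
          (Matrix.of fun ν k : Fin n => Y k ρ (ν : ℕ) x).det ≠ 0) ∧
      -- (1) joint continuity
      (∀ k : Fin n, ∀ ν < n, ContinuousOn (fun q : ℝ × ℂ => Y k q.2 ν q.1)
          (Set.Icc (0 : ℝ) T ×ˢ {ρ | ρ ∈ closure S ∧ rhoAlpha n T α p ≤ ‖ρ‖})) ∧
      -- (2) analyticity in `ρ`
      (∀ k : Fin n, ∀ ν < n, ∀ x ∈ Set.Icc (0 : ℝ) T,
          AnalyticOnNhd ℂ (fun ρ => Y k ρ ν x) {ρ | ρ ∈ S ∧ rhoAlpha n T α p < ‖ρ‖}) ∧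
      -- (3) the asymptotics (1.19), uniformly in `x ∈ [α,T]`
      (∀ ε > (0 : ℝ), ∃ ρ₀ : ℝ, ∀ ρ ∈ closure S, rhoAlpha n T α p ≤ ‖ρ‖ → ρ₀ ≤ ‖ρ‖ →
          ∀ k : Fin n, ∀ ν < n, ∀ x ∈ Set.Icc α T,
            ‖Y k ρ ν x - (ρ * R k) ^ ν * Complex.exp (ρ * R k * x) *
                (1 + ∑ s ∈ Finset.Icc 1 (N + 1), betaNu B s ν x / (ρ * R k) ^ s)‖
              ≤ ε * ‖(ρ * R k) ^ ν * Complex.exp (ρ * R k * x)‖ / ‖ρ‖ ^ (N + 1)) := by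
  obtain ⟨d, rfl⟩ : ∃ d, n = d + 1 := ⟨n - 1, by omega⟩
  obtain ⟨B, h0, h0', hB, hBα, hrec⟩ := exists_beta_tower (d := d) hα.2.le hpW
  refine ⟨B, h0, h0', hB, hBα,
    fun s hs hs' => .of_forall fun x => congrFun (hrec s hs hs') x, ?_⟩
  have hβ := isFormalSolution_betaNu h0 h0' hB hrec
  obtain rfl | ⟨ρ₁, hρ₁⟩ := S.eq_empty_or_nonempty
  · exact ⟨fun _ _ _ _ => 0, by simp, by simp, by simp, by simp, by simp⟩
  have hSK : S ⊆ orderedSector R := fun ρ hρ j l hjl => by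
    obtain rfl | h := hjl.eq_or_lt
    · exact le_rfl
    · exact (hord ρ hρ j l h).le
  have hcl : closure S ⊆ orderedSector R := closure_minimal hSK (isClosed_orderedSector R)
  have hlast : (0 : Fin (d + 1)) < Fin.last d := by
    rw [Fin.lt_def, Fin.val_last, Fin.val_zero]
    omega
  have hρ₁0 : ρ₁ ≠ 0 := by
    rintro rfl
    simpa using hord 0 hρ₁ 0 (Fin.last d) hlast
  have hω : R (Fin.last d) - R 0 ≠ 0 := sub_ne_zero.2 (hinj.ne hlast.ne')
  have hK : ∀ ρ ∈ orderedSector R, 0 ≤ ((R (Fin.last d) - R 0) * ρ).re := fun ρ hρ => by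
    rw [mul_comm, mul_sub, Complex.sub_re]
    exact sub_nonneg.2 (hρ 0 (Fin.last d) hlast.le)
  have := neBot_cobounded_inf_orderedSector hρ₁0 (hSK hρ₁)
  obtain ⟨Y, hsol, hdet, hcont, han, has⟩ :=
    exists_fundamental_system hα.1 hα.2.le hinj hroot hp hβ hω hK
  refine ⟨Y, fun k ρ _ _ => hsol k ρ, fun ρ hρ _ => hdet ρ (hcl hρ), fun k ν hν =>
    (hcont k ν hν).mono (Set.prod_mono_right fun ρ hρ => hcl hρ.1), fun k ν hν x hx =>
    (han k ν hν x hx).mono fun ρ hρ => hSK hρ.1, fun ε hε => ?_⟩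
  obtain ⟨ρ₀, h⟩ := has ε hε
  refine ⟨ρ₀, fun ρ hρ _ hρ0 k ν hν x hx => ?_⟩
  rw [one_add_sum_div_eq (fun s => betaNu B s ν x) (betaNu_zero_left h0 ν x)]
  exact h ρ (hcl hρ) hρ0 k ⟨ν, hν⟩ x hx
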